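/- Let ℓ ∈ {3, 4} and let a be a fixed real number with 0.404392 ≤ a < 1/2. Then there exist real constants c_0, c_1, c_2, c_3 and c'_0, …, c'_{ℓ−1} such that for every ε > 0 there is a constant C(ε) > 0 with |∑_{n ≤ X} d_{4,ℓ}(n;a) − X·∑_{k=0}^{3} c_k (log X)^k − X^{1−a}·∑_{k=0}^{ℓ−1} c'_k (log X)^k| ≤ C(ε) X^{1/2+ε} for all X ≥ 2. -/

import Mathlib

open Real

/-- `d_k(n)`, the number of ordered ways of writing `n` as a product of `k` positive
integer factors: the `k`-th power of `ArithmeticFunction.zeta` under Dirichlet convolution. -/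
def dk (k : ℕ) (n : ℕ) : ℕ := (ArithmeticFunction.zeta ^ k : ArithmeticFunction ℕ) n

/-- The weighted divisor function `d_{4,ℓ}(n;a) = ∑_{n = n₁n₂} d₄(n₁) d_ℓ(n₂) n₂^{-a}`. -/
noncomputable def dWeighted (ℓ : ℕ) (a : ℝ) (n : ℕ) : ℝ :=
  ∑ p ∈ n.divisorsAntidiagonal, (dk 4 p.1 : ℝ) * (dk ℓ p.2 : ℝ) * (p.2 : ℝ) ^ (-a)

section MeanValue

lemma sum_union_le_of_nonneg {f : ℕ → ℝ} (hf : ∀ n, 0 ≤ f n) (s t : Finset ℕ) :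
    ∑ n ∈ s ∪ t, f n ≤ ∑ n ∈ s, f n + ∑ n ∈ t, f n := by
  rw [← Finset.sum_union_inter]
  exact le_add_of_nonneg_right (Finset.sum_nonneg fun n _ => hf n)

/-- The sum of `n^T` over `n < m` is at most `m^{T+1} / (T + 1)`. -/
lemma sum_range_rpow_le {T : ℝ} (hT : 0 ≤ T) (m : ℕ) :
    ∑ n ∈ Finset.range m, (n : ℝ) ^ T ≤ (m : ℝ) ^ (T + 1) / (T + 1) := by
  induction m with
  | zero => simp; positivity
  | succ m ih =>
    rw [Finset.sum_range_succ]
    have key : (m : ℝ) ^ T ≤ ((m + 1 : ℝ) ^ (T + 1) - (m : ℝ) ^ (T + 1)) / (T + 1) := by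
      rcases Nat.eq_zero_or_pos m with rfl | hm
      · rcases hT.eq_or_lt with rfl | hT'
        · simp
        · simp only [Nat.cast_zero, zero_add, one_rpow]
          rw [zero_rpow hT'.ne', zero_rpow (by positivity)]
          positivity
      have hm' : (0 : ℝ) < m := by exact_mod_cast hm
      have hb := one_add_mul_self_le_rpow_one_add (s := 1 / (m : ℝ)) (p := T + 1)
        (by have : 0 ≤ 1 / (m : ℝ) := by positivity
            linarith) (by linarith)
      have e1 : (m + 1 : ℝ) ^ (T + 1) = (1 + 1 / (m : ℝ)) ^ (T + 1) * (m : ℝ) ^ (T + 1) := by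
        rw [← mul_rpow (by positivity) hm'.le]; congr 1; field_simp
      have e2 : (m : ℝ) ^ (T + 1) = (m : ℝ) ^ T * m := by rw [rpow_add_one hm'.ne']
      rw [le_div_iff₀ (by linarith), e1]
      have h3 : (1 + (T + 1) * (1 / (m : ℝ))) * (m : ℝ) ^ (T + 1) ≤
        (1 + 1 / (m : ℝ)) ^ (T + 1) * (m : ℝ) ^ (T + 1) :=
        mul_le_mul_of_nonneg_right hb (by positivity)
      have h4 : (1 + (T + 1) * (1 / (m : ℝ))) * (m : ℝ) ^ (T + 1) =
        (m : ℝ) ^ (T + 1) + (m : ℝ) ^ T * (T + 1) := by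
        rw [e2]; field_simp
      linarith
    push_cast
    have := add_le_add ih key
    refine this.trans (le_of_eq ?_)
    ring

/-- The sum of `n^{-T}` over `m < n ≤ M` is at most `m^{1-T} / (T - 1)`. -/
lemma sum_Ioc_rpow_neg_le {T : ℝ} (hT : 2 ≤ T) {m : ℕ} (hm : 0 < m) (M : ℕ) :
    ∑ n ∈ Finset.Ioc m M, (n : ℝ) ^ (-T) ≤ (m : ℝ) ^ (1 - T) / (T - 1) := by
  have hm0 : (0 : ℝ) < m := by exact_mod_cast hm
  rcases lt_or_ge M m with h | h
  · rw [Finset.Ioc_eq_empty (by lia)]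
    simp only [Finset.sum_empty]
    have : 0 < T - 1 := by linarith
    positivity
  suffices ∑ n ∈ Finset.Ioc m M, (n : ℝ) ^ (-T) ≤
      ((m : ℝ) ^ (1 - T) - (M : ℝ) ^ (1 - T)) / (T - 1) by
    refine this.trans (div_le_div_of_nonneg_right ?_ (by linarith))
    have : (0 : ℝ) ≤ (M : ℝ) ^ (1 - T) := by positivity
    linarith
  induction M, h using Nat.le_induction with
  | base => simp
  | succ M hM ih =>
    rw [Finset.sum_Ioc_succ_top hM]
    have hM' : (0 : ℝ) < M := by exact_mod_cast (by lia : 0 < M)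
    have key : ((M + 1 : ℕ) : ℝ) ^ (-T) ≤
        ((M : ℝ) ^ (1 - T) - ((M + 1 : ℕ) : ℝ) ^ (1 - T)) / (T - 1) := by
      push_cast
      have hb := one_add_mul_self_le_rpow_one_add (s := 1 / (M : ℝ)) (p := T - 1)
        (by have : 0 ≤ 1 / (M : ℝ) := by positivity
            linarith) (by linarith)
      have e0 : (M + 1 : ℝ) ^ (1 - T) = (M + 1 : ℝ) ^ (-T) * (M + 1) := by
        rw [← rpow_add_one (by positivity)]; congr 1; ring
      have e1 : (M : ℝ) ^ (1 - T) = (1 + 1 / (M : ℝ)) ^ (T - 1) * (M + 1 : ℝ) ^ (1 - T) := by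
        have : (M + 1 : ℝ) = (1 + 1 / (M : ℝ)) * M := by field_simp
        rw [this, mul_rpow (by positivity) hM'.le, ← mul_assoc, ← rpow_add (by positivity)]
        simp
      rw [le_div_iff₀ (by linarith), e1]
      have h3 : (1 + (T - 1) * (1 / (M : ℝ))) * (M + 1 : ℝ) ^ (1 - T) ≤
        (1 + 1 / (M : ℝ)) ^ (T - 1) * (M + 1 : ℝ) ^ (1 - T) :=
        mul_le_mul_of_nonneg_right hb (by positivity)
      have h4 : (M + 1 : ℝ) ^ (1 - T) * (1 / M) ≥ (M + 1 : ℝ) ^ (-T) := by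
        rw [e0]
        have : (M + 1 : ℝ) ^ (-T) * (M + 1) * (1 / M) =
          (M + 1 : ℝ) ^ (-T) + (M + 1 : ℝ) ^ (-T) * (1 / M) := by field_simp
        rw [this]
        have : 0 ≤ (M + 1 : ℝ) ^ (-T) * (1 / M) := by positivity
        linarith
      nlinarith
    calc _ ≤ _ := add_le_add ih key
      _ = _ := by ring

lemma sum_exp_neg_abs_log_le {T : ℝ} (hT : 2 ≤ T) (S : Finset ℕ) (hS : 0 ∉ S) {m : ℕ}
    (hm : 0 < m) :
    ∑ n ∈ S, Real.exp (-(T * |Real.log m - Real.log n|)) ≤ 3 * (T + m) / T := by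
  have hm0 : (0 : ℝ) < m := by exact_mod_cast hm
  obtain ⟨M, hM⟩ : ∃ M : ℕ, ∀ n ∈ S, n ≤ M := ⟨S.sup id, fun n hn => Finset.le_sup (f := id) hn⟩
  have hsub : S ⊆ (Finset.range m \ {0}) ∪ ({m} ∪ Finset.Ioc m M) := by
    intro n hn
    have h1 := hM n hn
    have h2 : n ≠ 0 := fun h => hS (h ▸ hn)
    simp only [Finset.mem_union, Finset.mem_sdiff, Finset.mem_range, Finset.mem_singleton,
      Finset.mem_Ioc]
    lia
  have hnn : ∀ n : ℕ, 0 ≤ Real.exp (-(T * |Real.log m - Real.log n|)) := fun n => (exp_pos _).le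
  refine (Finset.sum_le_sum_of_subset_of_nonneg hsub fun n _ _ => hnn n).trans ?_
  refine ((sum_union_le_of_nonneg hnn _ _).trans
    (add_le_add_right (sum_union_le_of_nonneg hnn _ _) _)).trans ?_
  have h1 : ∑ n ∈ Finset.range m \ {0}, Real.exp (-(T * |Real.log m - Real.log n|)) ≤
      m / (T + 1) := by
    calc _ ≤ ∑ n ∈ Finset.range m \ {0}, (n : ℝ) ^ T * (m : ℝ) ^ (-T) := by
          refine Finset.sum_le_sum fun n hn => le_of_eq ?_
          simp only [Finset.mem_sdiff, Finset.mem_range, Finset.mem_singleton] at hn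
          have hn0 : (0 : ℝ) < n := by exact_mod_cast Nat.pos_of_ne_zero hn.2
          have : Real.log n ≤ Real.log m := Real.log_le_log hn0 (by exact_mod_cast hn.1.le)
          rw [abs_of_nonneg (by linarith), rpow_def_of_pos hn0, rpow_def_of_pos hm0, ← Real.exp_add]
          congr 1; ring
      _ ≤ ∑ n ∈ Finset.range m, (n : ℝ) ^ T * (m : ℝ) ^ (-T) :=
          Finset.sum_le_sum_of_subset_of_nonneg Finset.sdiff_subset fun n _ _ => by positivity
      _ = (∑ n ∈ Finset.range m, (n : ℝ) ^ T) * (m : ℝ) ^ (-T) := by rw [Finset.sum_mul]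
      _ ≤ (m : ℝ) ^ (T + 1) / (T + 1) * (m : ℝ) ^ (-T) :=
          mul_le_mul_of_nonneg_right (sum_range_rpow_le (by linarith) m) (by positivity)
      _ = m / (T + 1) := by
          rw [div_mul_eq_mul_div, ← rpow_add hm0]; simp
  have h2 : ∑ n ∈ Finset.Ioc m M, Real.exp (-(T * |Real.log m - Real.log n|)) ≤ m / (T - 1) := by
    calc _ ≤ ∑ n ∈ Finset.Ioc m M, (n : ℝ) ^ (-T) * (m : ℝ) ^ T := by
          refine Finset.sum_le_sum fun n hn => le_of_eq ?_
          simp only [Finset.mem_Ioc] at hn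
          have hn0 : (0 : ℝ) < n := by exact_mod_cast (by lia : 0 < n)
          have : Real.log m ≤ Real.log n := Real.log_le_log hm0 (by exact_mod_cast hn.1.le)
          rw [abs_of_nonpos (by linarith), rpow_def_of_pos hn0, rpow_def_of_pos hm0, ← Real.exp_add]
          congr 1; ring
      _ = (∑ n ∈ Finset.Ioc m M, (n : ℝ) ^ (-T)) * (m : ℝ) ^ T := by rw [Finset.sum_mul]
      _ ≤ (m : ℝ) ^ (1 - T) / (T - 1) * (m : ℝ) ^ T :=
          mul_le_mul_of_nonneg_right (sum_Ioc_rpow_neg_le hT hm M) (by positivity)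
      _ = m / (T - 1) := by
          rw [div_mul_eq_mul_div, ← rpow_add hm0]; simp
  have h3 : (m : ℝ) / (T + 1) ≤ m / T :=
    div_le_div_of_nonneg_left hm0.le (by linarith) (by linarith)
  have h4 : (m : ℝ) / (T - 1) ≤ 2 * (m / T) := by
    rw [← mul_div_assoc, div_le_div_iff₀ (by linarith) (by linarith)]
    nlinarith
  simp only [Finset.sum_singleton, sub_self, abs_zero, mul_zero, neg_zero, Real.exp_zero]
  have h5 : 3 * (T + m) / T = 3 + 3 * (m / T) := by field_simp
  linarith

lemma integral_gaussian_mul_exp {T : ℝ} (hT : 0 < T) (x : ℝ) :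
    ∫ t : ℝ, Complex.exp (-((1 / T ^ 2 : ℝ) : ℂ) * (t : ℂ) ^ 2 + (Complex.I * x) * t) =
      ((√π * T * Real.exp (-(T * x) ^ 2 / 4) : ℝ) : ℂ) := by
  have h := integral_cexp_quadratic (b := -((1 / T ^ 2 : ℝ) : ℂ)) (by
    rw [← Complex.ofReal_neg, Complex.ofReal_re]; simp; positivity) (Complex.I * x) 0
  simp only [add_zero] at h
  rw [h]
  have h1 : (π / -(-((1 / T ^ 2 : ℝ) : ℂ))) ^ (1 / 2 : ℂ) = ((√π * T : ℝ) : ℂ) := by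
    rw [neg_neg, ← Complex.ofReal_div, show (1 / 2 : ℂ) = ((1 / 2 : ℝ) : ℂ) by push_cast; rfl,
      ← Complex.ofReal_cpow (by positivity), ← Real.sqrt_eq_rpow]
    congr 1
    rw [show π / (1 / T ^ 2) = π * T ^ 2 by field_simp, Real.sqrt_mul pi_pos.le, Real.sqrt_sq hT.le]
  rw [h1]
  push_cast
  congr 2
  have hT' : (T : ℂ) ≠ 0 := by exact_mod_cast hT.ne'
  rw [mul_pow Complex.I, Complex.I_sq]
  field_simp
  ring

lemma integrable_gaussian_mul_exp {T : ℝ} (hT : 0 < T) (x : ℝ) : MeasureTheory.Integrable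
    fun t : ℝ => Complex.exp (-((1 / T ^ 2 : ℝ) : ℂ) * (t : ℂ) ^ 2 + (Complex.I * x) * t) := by
  have := integrable_cexp_quadratic (b := ((1 / T ^ 2 : ℝ) : ℂ)) (by
    rw [Complex.ofReal_re]; positivity) (Complex.I * x) 0
  simpa using this

lemma exp_neg_sq_le (y : ℝ) : Real.exp (-y ^ 2 / 4) ≤ Real.exp 1 * Real.exp (-|y|) := by
  rw [← Real.exp_add, Real.exp_le_exp]
  nlinarith [sq_abs y, sq_nonneg (|y| / 2 - 1)]

lemma natCast_cpow_mul_I {n : ℕ} (hn : n ≠ 0) (t : ℝ) :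
    (n : ℂ) ^ (-(t : ℂ) * Complex.I) = Complex.exp (-(Complex.I * Real.log n) * t) := by
  rw [Complex.cpow_def_of_ne_zero (by exact_mod_cast hn), ← Complex.natCast_log]
  congr 1; ring

/-- The constant of the mean value theorem. -/
noncomputable def mvConst : ℝ := Real.exp 4 * (√π * Real.exp 1 * 3)

lemma mvConst_pos : 0 < mvConst := by unfold mvConst; positivity

lemma mvConst_nonneg : 0 ≤ mvConst := mvConst_pos.le

lemma continuous_dirichletSum (S : Finset ℕ) (a : ℕ → ℂ) (hS : 0 ∉ S) :
    Continuous fun t : ℝ => ∑ n ∈ S, a n * (n : ℂ) ^ (-(t : ℂ) * Complex.I) := by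
  refine continuous_finsetSum _ fun n hn => continuous_const.mul ?_
  have : (n : ℂ) ≠ 0 := by
    have : n ≠ 0 := fun h => hS (h ▸ hn)
    exact_mod_cast this
  exact Continuous.const_cpow (by fun_prop) (Or.inl this)

/-- The mean value theorem for Dirichlet polynomials. -/
theorem mean_value {T : ℝ} (hT : 2 ≤ T) (S : Finset ℕ) (hS : 0 ∉ S) (a : ℕ → ℂ) :
    ∫ t in T..2 * T, ‖∑ n ∈ S, a n * (n : ℂ) ^ (-(t : ℂ) * Complex.I)‖ ^ 2 ≤
      mvConst * ∑ n ∈ S, ‖a n‖ ^ 2 * (T + n) := by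
  have hT0 : 0 < T := by linarith
  have hne : ∀ n ∈ S, n ≠ 0 := fun n hn h => hS (h ▸ hn)
  set P : ℝ → ℂ := fun t => ∑ n ∈ S, a n * (n : ℂ) ^ (-(t : ℂ) * Complex.I) with hP
  have hPc : Continuous P := continuous_dirichletSum S a hS
  have expand : ∀ t : ℝ, ((Real.exp (-(1 / T ^ 2) * t ^ 2) * ‖P t‖ ^ 2 : ℝ) : ℂ) =
      ∑ m ∈ S, ∑ n ∈ S, (a m * (starRingEnd ℂ) (a n)) *
        Complex.exp (-((1 / T ^ 2 : ℝ) : ℂ) * (t : ℂ) ^ 2 +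
          (Complex.I * (Real.log n - Real.log m : ℝ)) * t) := by
    intro t
    rw [Complex.ofReal_mul, Complex.ofReal_pow, ← Complex.mul_conj', hP, map_sum,
      Finset.sum_mul_sum, Finset.mul_sum]
    refine Finset.sum_congr rfl fun m hm => ?_
    rw [Finset.mul_sum]
    refine Finset.sum_congr rfl fun n hn => ?_
    rw [map_mul, natCast_cpow_mul_I (hne m hm), natCast_cpow_mul_I (hne n hn),
      ← Complex.exp_conj, Complex.exp_add]
    have : (starRingEnd ℂ) (-(Complex.I * (Real.log n)) * t) = (Complex.I * (Real.log n)) * t := by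
      rw [map_mul, map_neg, map_mul, Complex.conj_ofReal, Complex.conj_ofReal, Complex.conj_I]
      ring
    rw [this]
    have e : (Complex.I * (Real.log n - Real.log m : ℝ)) * (t : ℂ) =
      (-(Complex.I * (Real.log m)) * t) + (Complex.I * (Real.log n)) * t := by push_cast; ring
    rw [e, Complex.exp_add]
    push_cast
    ring
  have hint : MeasureTheory.Integrable fun t : ℝ =>
      ((Real.exp (-(1 / T ^ 2) * t ^ 2) * ‖P t‖ ^ 2 : ℝ) : ℂ) := by
    simp_rw [expand]
    exact MeasureTheory.integrable_finsetSum _ fun m _ =>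
      MeasureTheory.integrable_finsetSum _ fun n _ =>
        (integrable_gaussian_mul_exp hT0 _).const_mul _
  have hintR : MeasureTheory.Integrable fun t : ℝ =>
      Real.exp (-(1 / T ^ 2) * t ^ 2) * ‖P t‖ ^ 2 := by
    have h := hint.re
    simp only [RCLike.re_to_complex, Complex.ofReal_re] at h
    exact h
  have heval : ((∫ t : ℝ, Real.exp (-(1 / T ^ 2) * t ^ 2) * ‖P t‖ ^ 2 : ℝ) : ℂ) =
      ∑ m ∈ S, ∑ n ∈ S, (a m * (starRingEnd ℂ) (a n)) *
        ((√π * T * Real.exp (-(T * (Real.log n - Real.log m)) ^ 2 / 4) : ℝ) : ℂ) := by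
    rw [← integral_complex_ofReal]
    simp_rw [expand]
    rw [MeasureTheory.integral_finsetSum _ fun m _ =>
      MeasureTheory.integrable_finsetSum _ fun n _ =>
        (integrable_gaussian_mul_exp hT0 _).const_mul _]
    refine Finset.sum_congr rfl fun m _ => ?_
    rw [MeasureTheory.integral_finsetSum _ fun n _ =>
        (integrable_gaussian_mul_exp hT0 _).const_mul _]
    refine Finset.sum_congr rfl fun n _ => ?_
    rw [MeasureTheory.integral_const_mul, integral_gaussian_mul_exp hT0]
  have hbound : ∫ t : ℝ, Real.exp (-(1 / T ^ 2) * t ^ 2) * ‖P t‖ ^ 2 ≤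
      √π * Real.exp 1 * 3 * ∑ n ∈ S, ‖a n‖ ^ 2 * (T + n) := by
    have h0 : ∫ t : ℝ, Real.exp (-(1 / T ^ 2) * t ^ 2) * ‖P t‖ ^ 2 ≤
        ‖((∫ t : ℝ, Real.exp (-(1 / T ^ 2) * t ^ 2) * ‖P t‖ ^ 2 : ℝ) : ℂ)‖ := by
      rw [Complex.norm_real]; exact le_abs_self _
    refine h0.trans ?_
    rw [heval]
    set E : ℕ → ℕ → ℝ := fun m n => Real.exp (-(T * |Real.log m - Real.log n|)) with hE
    have hEs : ∀ m n, E m n = E n m := fun m n => by simp only [hE]; rw [abs_sub_comm]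
    calc _ ≤ ∑ m ∈ S, ∑ n ∈ S, (√π * T * Real.exp 1) *
          ((‖a m‖ ^ 2 * E m n + ‖a n‖ ^ 2 * E n m) / 2) := by
          refine (norm_sum_le _ _).trans (Finset.sum_le_sum fun m _ =>
            (norm_sum_le _ _).trans (Finset.sum_le_sum fun n _ => ?_))
          rw [norm_mul, norm_mul, RCLike.norm_conj, Complex.norm_real, Real.norm_of_nonneg
            (by positivity)]
          have h1 := exp_neg_sq_le (T * (Real.log n - Real.log m))
          rw [abs_mul, abs_of_pos hT0, abs_sub_comm] at h1
          have h2 : ‖a m‖ * ‖a n‖ ≤ (‖a m‖ ^ 2 + ‖a n‖ ^ 2) / 2 := by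
            nlinarith [sq_nonneg (‖a m‖ - ‖a n‖)]
          rw [hEs n m]
          calc _ ≤ (‖a m‖ ^ 2 + ‖a n‖ ^ 2) / 2 * (√π * T * (Real.exp 1 * E m n)) := by
                gcongr
            _ = _ := by ring
      _ = (√π * T * Real.exp 1) * ∑ m ∈ S, ‖a m‖ ^ 2 * ∑ n ∈ S, E m n := by
          simp_rw [← Finset.mul_sum, ← Finset.sum_div, Finset.sum_add_distrib]
          rw [Finset.sum_comm (f := fun m n => ‖a n‖ ^ 2 * E n m)]
          simp_rw [← Finset.mul_sum]
          ring
      _ ≤ (√π * T * Real.exp 1) * ∑ m ∈ S, ‖a m‖ ^ 2 * (3 * (T + m) / T) := by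
          gcongr with m hm
          exact sum_exp_neg_abs_log_le hT S hS (Nat.pos_of_ne_zero (hne m hm))
      _ = _ := by
          rw [Finset.mul_sum, Finset.mul_sum]
          refine Finset.sum_congr rfl fun m _ => ?_
          field_simp
  calc _ ≤ ∫ t in T..2 * T, Real.exp 4 * (Real.exp (-(1 / T ^ 2) * t ^ 2) * ‖P t‖ ^ 2) := by
        refine intervalIntegral.integral_mono_on (by linarith)
          ((hPc.norm.pow 2).intervalIntegrable _ _)
          (hintR.const_mul _).intervalIntegrable fun t ht => ?_
        have h1 : 1 ≤ Real.exp 4 * Real.exp (-(1 / T ^ 2) * t ^ 2) := by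
          rw [← Real.exp_add, ← Real.exp_zero, Real.exp_le_exp, Real.exp_zero]
          have : 1 / T ^ 2 * t ^ 2 ≤ 4 := by
            rw [one_div, inv_mul_le_iff₀ (by positivity)]
            nlinarith [ht.1, ht.2]
          linarith
        have h2 := mul_le_mul_of_nonneg_right h1 (sq_nonneg ‖P t‖)
        linarith
    _ = Real.exp 4 * ∫ t in T..2 * T, (Real.exp (-(1 / T ^ 2) * t ^ 2) * ‖P t‖ ^ 2) := by
        rw [intervalIntegral.integral_const_mul]
    _ ≤ Real.exp 4 * ∫ t : ℝ, (Real.exp (-(1 / T ^ 2) * t ^ 2) * ‖P t‖ ^ 2) := by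
        gcongr
        rw [intervalIntegral.integral_of_le (by linarith)]
        exact MeasureTheory.setIntegral_le_integral hintR
          (Filter.Eventually.of_forall fun t => by positivity)
    _ ≤ _ := by
        rw [mvConst, mul_assoc]
        gcongr

end MeanValue

section DivisorBound

/-- The mean value theorem for absolutely convergent Dirichlet series. -/
theorem mean_value_tsum {T : ℝ} (hT : 2 ≤ T) (a : ℕ → ℂ) (h0 : a 0 = 0)
    (ha : Summable fun n => ‖a n‖) (ha2 : Summable fun n : ℕ => ‖a n‖ ^ 2 * (T + n)) :
    ∫ t in T..2 * T, ‖∑' n : ℕ, a n * (n : ℂ) ^ (-(t : ℂ) * Complex.I)‖ ^ 2 ≤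
      mvConst * ∑' n : ℕ, ‖a n‖ ^ 2 * (T + n) := by
  have hterm : ∀ (t : ℝ) (n : ℕ), ‖a n * (n : ℂ) ^ (-(t : ℂ) * Complex.I)‖ ≤ ‖a n‖ := by
    intro t n
    rcases Nat.eq_zero_or_pos n with rfl | hn
    · simp [h0]
    · rw [norm_mul, Complex.norm_natCast_cpow_of_pos hn]
      simp
  have hsum : ∀ t : ℝ, Summable fun n : ℕ => a n * (n : ℂ) ^ (-(t : ℂ) * Complex.I) := fun t =>
    Summable.of_norm_bounded ha (hterm t)
  set S : ℕ → Finset ℕ := fun N => (Finset.range N).erase 0 with hS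
  have hSsum : ∀ (f : ℕ → ℂ) (N : ℕ), f 0 = 0 → ∑ n ∈ S N, f n = ∑ n ∈ Finset.range N, f n := by
    intro f N hf
    exact Finset.sum_erase _ hf
  have hlim : Filter.Tendsto (fun N => ∫ t in T..2 * T,
      ‖∑ n ∈ S N, a n * (n : ℂ) ^ (-(t : ℂ) * Complex.I)‖ ^ 2) Filter.atTop
      (nhds (∫ t in T..2 * T, ‖∑' n : ℕ, a n * (n : ℂ) ^ (-(t : ℂ) * Complex.I)‖ ^ 2)) := by
    refine intervalIntegral.tendsto_integral_filter_of_dominated_convergence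
      (fun _ => (∑' n, ‖a n‖) ^ 2) (Filter.Eventually.of_forall fun N => ?_)
      (Filter.Eventually.of_forall fun N => Filter.Eventually.of_forall fun t _ => ?_)
      intervalIntegrable_const (Filter.Eventually.of_forall fun t _ => ?_)
    · exact ((continuous_dirichletSum (S N) a (Finset.notMem_erase _ _)).norm.pow
        2).aestronglyMeasurable
    · rw [Real.norm_of_nonneg (by positivity)]
      gcongr
      refine (norm_sum_le _ _).trans ((Finset.sum_le_sum fun n _ => hterm t n).trans ?_)
      exact ha.sum_le_tsum _ fun _ _ => norm_nonneg _
    · refine ((Filter.Tendsto.congr (fun N => ?_) (hsum t).hasSum.tendsto_sum_nat).norm.pow 2)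
      rw [hSsum _ _ (by simp [h0])]
  refine le_of_tendsto' hlim fun N => (mean_value hT (S N) (Finset.notMem_erase _ _) a).trans ?_
  refine mul_le_mul_of_nonneg_left (ha2.sum_le_tsum _ fun n _ => ?_) mvConst_nonneg
  positivity

lemma succ_le_mul_two_rpow {ε : ℝ} (hε : 0 < ε) (v : ℕ) :
    ((v : ℝ) + 1) ≤ (1 + 1 / (ε * Real.log 2)) * 2 ^ (v * ε) := by
  have hl : 0 < Real.log 2 := Real.log_pos (by norm_num)
  have h1 : 1 + v * ε * Real.log 2 ≤ (2 : ℝ) ^ (v * ε) := by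
    rw [rpow_def_of_pos (by norm_num)]
    have := Real.add_one_le_exp (Real.log 2 * (v * ε))
    linarith
  calc ((v : ℝ) + 1) ≤ (1 + 1 / (ε * Real.log 2)) * (1 + v * ε * Real.log 2) := by
        have h2 : (1 + 1 / (ε * Real.log 2)) * (1 + v * ε * Real.log 2) =
          1 + v * ε * Real.log 2 + 1 / (ε * Real.log 2) + v := by field_simp; ring
        rw [h2]
        have : 0 ≤ v * ε * Real.log 2 := by positivity
        have : 0 ≤ 1 / (ε * Real.log 2) := by positivity
        linarith
    _ ≤ _ := by gcongr

lemma card_divisors_le_rpow {ε : ℝ} (hε : 0 < ε) :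
    ∃ C : ℝ, 1 ≤ C ∧ ∀ n : ℕ, n ≠ 0 → (n.divisors.card : ℝ) ≤ C * (n : ℝ) ^ ε := by
  have hl : 0 < Real.log 2 := Real.log_pos (by norm_num)
  set K : ℝ := 1 + 1 / (ε * Real.log 2) with hK
  have hK1 : 1 ≤ K := by
    have : 0 ≤ 1 / (ε * Real.log 2) := by positivity
    linarith
  obtain ⟨P, hP⟩ := exists_nat_ge ((2 : ℝ) ^ (1 / ε))
  refine ⟨K ^ P, one_le_pow₀ hK1, fun n hn => ?_⟩
  rw [Nat.card_divisors hn]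
  have hnpow : (n : ℝ) ^ ε = ∏ p ∈ n.primeFactors, ((p : ℝ) ^ (n.factorization p * ε)) := by
    conv_lhs => rw [← Nat.prod_factorization_pow_eq_self hn]
    rw [Finsupp.prod, Nat.support_factorization, Nat.cast_prod, ← Real.finsetProd_rpow _ _
      (fun i _ => by positivity)]
    refine Finset.prod_congr rfl fun p _ => ?_
    rw [Nat.cast_pow, ← rpow_natCast, ← rpow_mul (by positivity)]
  have hKP : ∏ p ∈ n.primeFactors, (if p < P then K else 1) ≤ K ^ P := by
    rw [Finset.prod_ite, Finset.prod_const, Finset.prod_const_one, mul_one]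
    refine pow_le_pow_right₀ hK1 ?_
    calc _ ≤ (Finset.range P).card := Finset.card_le_card fun p hp => by
          simp only [Finset.mem_filter] at hp; exact Finset.mem_range.2 hp.2
      _ = P := Finset.card_range P
  rw [Nat.cast_prod, hnpow]
  calc _ ≤ ∏ p ∈ n.primeFactors,
        ((if p < P then K else 1) * (p : ℝ) ^ (n.factorization p * ε)) := by
        refine Finset.prod_le_prod (fun _ _ => by positivity) fun p hp => ?_
        have hp2 : (2 : ℝ) ≤ p := by exact_mod_cast (Nat.prime_of_mem_primeFactors hp).two_le
        push_cast
        split_ifs with h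
        · refine (succ_le_mul_two_rpow hε _).trans ?_
          gcongr
        · have h1 : (2 : ℝ) ^ (1 / ε) ≤ p := hP.trans (by exact_mod_cast not_lt.1 h)
          have h2 : (2 : ℝ) ≤ (p : ℝ) ^ ε := by
            calc (2 : ℝ) = ((2 : ℝ) ^ (1 / ε)) ^ ε := by
                  rw [← rpow_mul (by norm_num)]; field_simp; simp
              _ ≤ _ := by gcongr
          rw [one_mul, mul_comm, rpow_mul (by positivity), rpow_natCast]
          calc ((n.factorization p : ℝ) + 1) ≤ 2 ^ (n.factorization p) := by
                exact_mod_cast Nat.lt_two_pow_self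
            _ ≤ _ := by gcongr
    _ = (∏ p ∈ n.primeFactors, (if p < P then K else 1)) *
          ∏ p ∈ n.primeFactors, (p : ℝ) ^ (n.factorization p * ε) := Finset.prod_mul_distrib
    _ ≤ _ := by gcongr

lemma dk_succ (k n : ℕ) : dk (k + 1) n = ∑ d ∈ n.divisors, dk k d := by
  simp only [dk, pow_succ]
  rw [ArithmeticFunction.mul_zeta_apply]

lemma dk_le_rpow (k : ℕ) {ε : ℝ} (hε : 0 < ε) :
    ∃ C : ℝ, 1 ≤ C ∧ ∀ n : ℕ, n ≠ 0 → (dk k n : ℝ) ≤ C * (n : ℝ) ^ ε := by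
  induction k generalizing ε with
  | zero =>
    refine ⟨1, le_rfl, fun n hn => ?_⟩
    have h1 : (1 : ℝ) ≤ (n : ℝ) ^ ε :=
      one_le_rpow (by exact_mod_cast Nat.pos_of_ne_zero hn) hε.le
    simp only [dk, pow_zero, ArithmeticFunction.one_apply, one_mul]
    split_ifs
    · simpa using h1
    · simp; linarith
  | succ k ih =>
    obtain ⟨C, hC, h⟩ := ih (half_pos hε)
    obtain ⟨D, hD, h'⟩ := card_divisors_le_rpow (half_pos hε)
    refine ⟨C * D, one_le_mul_of_one_le_of_one_le hC hD, fun n hn => ?_⟩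
    have hn0 : (0 : ℝ) < n := by exact_mod_cast Nat.pos_of_ne_zero hn
    rw [dk_succ, Nat.cast_sum]
    calc _ ≤ ∑ d ∈ n.divisors, C * (n : ℝ) ^ (ε / 2) := by
          refine Finset.sum_le_sum fun d hd => (h d ?_).trans ?_
          · exact (Nat.pos_of_mem_divisors hd).ne'
          · have : (d : ℝ) ≤ n := by exact_mod_cast Nat.divisor_le hd
            gcongr
      _ = n.divisors.card * (C * (n : ℝ) ^ (ε / 2)) := by rw [Finset.sum_const, nsmul_eq_mul]
      _ ≤ (D * (n : ℝ) ^ (ε / 2)) * (C * (n : ℝ) ^ (ε / 2)) := by gcongr; exact h' n hn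
      _ = _ := by
          rw [show (n : ℝ) ^ ε = (n : ℝ) ^ (ε / 2) * (n : ℝ) ^ (ε / 2) by
            rw [← rpow_add hn0]; ring_nf]
          ring

lemma dWeighted_nonneg (ℓ : ℕ) (a : ℝ) (n : ℕ) : 0 ≤ dWeighted ℓ a n :=
  Finset.sum_nonneg fun _ _ => by positivity

lemma dWeighted_le_rpow (ℓ : ℕ) {a : ℝ} (ha : 0 ≤ a) {ε : ℝ} (hε : 0 < ε) :
    ∃ C : ℝ, 1 ≤ C ∧ ∀ n : ℕ, n ≠ 0 → dWeighted ℓ a n ≤ C * (n : ℝ) ^ ε := by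
  obtain ⟨C, hC, h⟩ := dk_le_rpow 4 (ε := ε / 3) (by positivity)
  obtain ⟨D, hD, h'⟩ := dk_le_rpow ℓ (ε := ε / 3) (by positivity)
  obtain ⟨E, hE, h''⟩ := card_divisors_le_rpow (ε := ε / 3) (by positivity)
  refine ⟨E * (C * D), one_le_mul_of_one_le_of_one_le hE (one_le_mul_of_one_le_of_one_le hC hD),
    fun n hn => ?_⟩
  have hn0 : (0 : ℝ) < n := by exact_mod_cast Nat.pos_of_ne_zero hn
  calc dWeighted ℓ a n ≤ ∑ p ∈ n.divisorsAntidiagonal,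
        (C * (n : ℝ) ^ (ε / 3)) * (D * (n : ℝ) ^ (ε / 3)) := by
        refine Finset.sum_le_sum fun p hp => ?_
        have hp1 := Nat.ne_zero_of_mem_divisorsAntidiagonal hp
        have hm := Nat.mem_divisorsAntidiagonal.1 hp
        have l1 : p.1 ≤ n := Nat.le_of_dvd (Nat.pos_of_ne_zero hn) ⟨p.2, hm.1.symm⟩
        have l2 : p.2 ≤ n := Nat.le_of_dvd (Nat.pos_of_ne_zero hn) ⟨p.1, by rw [mul_comm, hm.1]⟩
        have l1' : (p.1 : ℝ) ≤ n := by exact_mod_cast l1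
        have l2' : (p.2 : ℝ) ≤ n := by exact_mod_cast l2
        have e1 : (dk 4 p.1 : ℝ) ≤ C * (n : ℝ) ^ (ε / 3) := (h _ hp1.1).trans (by gcongr)
        have e2 : (dk ℓ p.2 : ℝ) ≤ D * (n : ℝ) ^ (ε / 3) := (h' _ hp1.2).trans (by gcongr)
        have e3 : (p.2 : ℝ) ^ (-a) ≤ 1 := rpow_le_one_of_one_le_of_nonpos
          (by exact_mod_cast Nat.pos_of_ne_zero hp1.2) (by linarith)
        calc _ ≤ (C * (n : ℝ) ^ (ε / 3)) * (D * (n : ℝ) ^ (ε / 3)) * 1 := by gcongr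
          _ = _ := mul_one _
    _ = n.divisors.card * ((C * (n : ℝ) ^ (ε / 3)) * (D * (n : ℝ) ^ (ε / 3))) := by
        rw [Finset.sum_const, nsmul_eq_mul]
        congr 2
        rw [← Nat.map_div_right_divisors, Finset.card_map]
    _ ≤ (E * (n : ℝ) ^ (ε / 3)) * ((C * (n : ℝ) ^ (ε / 3)) * (D * (n : ℝ) ^ (ε / 3))) := by
        gcongr; exact h'' n hn
    _ = _ := by
        have : (n : ℝ) ^ ε = (n : ℝ) ^ (ε / 3) * (n : ℝ) ^ (ε / 3) * (n : ℝ) ^ (ε / 3) := by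
          rw [← rpow_add hn0, ← rpow_add hn0]; ring_nf
        rw [this]; ring

end DivisorBound

section ExponentialSums

/-- The additive character `x ↦ exp (2πix)` of the real line. -/
noncomputable def eChar (x : ℝ) : ℂ := Complex.exp ((2 * π * x : ℝ) * Complex.I)

lemma norm_eChar (x : ℝ) : ‖eChar x‖ = 1 := Complex.norm_exp_ofReal_mul_I _

lemma eChar_add (x y : ℝ) : eChar (x + y) = eChar x * eChar y := by
  rw [eChar, eChar, eChar, ← Complex.exp_add]; congr 1; push_cast; ring

lemma eChar_neg (x : ℝ) : eChar (-x) = (starRingEnd ℂ) (eChar x) := by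
  rw [eChar, eChar, ← Complex.exp_conj, map_mul, Complex.conj_ofReal, Complex.conj_I]
  congr 1; push_cast; ring

lemma eChar_eq (x : ℝ) :
    eChar x = ((Real.cos (2 * π * x) : ℝ) : ℂ) + ((Real.sin (2 * π * x) : ℝ) : ℂ) * Complex.I := by
  rw [eChar, Complex.exp_mul_I, Complex.ofReal_cos, Complex.ofReal_sin]

/-- `1 / (1 - e(x))`, written through the cotangent. -/
noncomputable def invOneSubE (x : ℝ) : ℂ :=
  1 / 2 + ((Real.cos (π * x) / Real.sin (π * x) / 2 : ℝ) : ℂ) * Complex.I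

lemma invOneSubE_mul {x : ℝ} (hx : Real.sin (π * x) ≠ 0) : invOneSubE x * (1 - eChar x) = 1 := by
  rw [invOneSubE, eChar_eq, show 2 * π * x = 2 * (π * x) by ring, Real.cos_two_mul,
    Real.sin_two_mul]
  have h := Real.sin_sq_add_cos_sq (π * x)
  set s := Real.sin (π * x)
  set c := Real.cos (π * x)
  have hc : c ^ 2 = 1 - s ^ 2 := by linarith
  apply Complex.ext
  · simp only [Complex.mul_re, Complex.add_re, Complex.sub_re, Complex.add_im, Complex.sub_im,
      Complex.mul_im, Complex.ofReal_re, Complex.ofReal_im, Complex.I_re, Complex.I_im,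
      Complex.one_re, Complex.one_im, Complex.div_ofNat_re, Complex.div_ofNat_im]
    field_simp
    ring
  · simp only [Complex.mul_re, Complex.add_re, Complex.sub_re, Complex.add_im, Complex.sub_im,
      Complex.mul_im, Complex.ofReal_re, Complex.ofReal_im, Complex.I_re, Complex.I_im,
      Complex.one_re, Complex.one_im, Complex.div_ofNat_re, Complex.div_ofNat_im]
    field_simp
    have h3 : c ^ 3 = c * (1 - s ^ 2) := by rw [← hc]; ring
    ring_nf
    simp only [h3]
    ring

lemma cot_sub_nonneg {x y : ℝ} (hx : 0 < Real.sin (π * x)) (hy : 0 < Real.sin (π * y))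
    (hxy : x ≤ y) (hyx : y ≤ x + 1) :
    0 ≤ Real.cos (π * x) / Real.sin (π * x) - Real.cos (π * y) / Real.sin (π * y) := by
  rw [div_sub_div _ _ hx.ne' hy.ne']
  have : Real.cos (π * x) * Real.sin (π * y) - Real.sin (π * x) * Real.cos (π * y) =
      Real.sin (π * y - π * x) := by rw [Real.sin_sub]; ring
  rw [this]
  have h := pi_pos
  refine div_nonneg (Real.sin_nonneg_of_nonneg_of_le_pi ?_ ?_) (by positivity) <;> nlinarith

lemma norm_invOneSubE_sub {x y : ℝ} (hx : 0 < Real.sin (π * x)) (hy : 0 < Real.sin (π * y))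
    (hxy : x ≤ y) (hyx : y ≤ x + 1) :
    ‖invOneSubE y - invOneSubE x‖ =
      (Real.cos (π * x) / Real.sin (π * x) - Real.cos (π * y) / Real.sin (π * y)) / 2 := by
  have : invOneSubE y - invOneSubE x = ((-((Real.cos (π * x) / Real.sin (π * x) -
      Real.cos (π * y) / Real.sin (π * y)) / 2) : ℝ) : ℂ) * Complex.I := by
    simp only [invOneSubE]; push_cast; ring
  rw [this, norm_mul, Complex.norm_I, mul_one, Complex.norm_real, norm_neg,
    Real.norm_of_nonneg (div_nonneg (cot_sub_nonneg hx hy hxy hyx) (by norm_num))]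

lemma two_mul_le_sin {θ x : ℝ} (hθ : 0 < θ) (h1 : θ ≤ x) (h2 : x ≤ 1 - θ) :
    2 * θ ≤ Real.sin (π * x) := by
  have hp := pi_pos
  rcases le_total x (1 / 2) with h | h
  · have := Real.mul_le_sin (x := π * x) (by nlinarith) (by nlinarith)
    calc 2 * θ ≤ 2 * x := by linarith
      _ = 2 / π * (π * x) := by field_simp
      _ ≤ _ := this
  · have := Real.mul_le_sin (x := π - π * x) (by nlinarith) (by nlinarith)
    rw [Real.sin_pi_sub] at this
    calc 2 * θ ≤ 2 * (1 - x) := by linarith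
      _ = 2 / π * (π - π * x) := by field_simp
      _ ≤ _ := this

lemma abs_cot_le {θ x : ℝ} (hθ : 0 < θ) (h1 : θ ≤ x) (h2 : x ≤ 1 - θ) :
    |Real.cos (π * x) / Real.sin (π * x)| ≤ 1 / (2 * θ) := by
  have h := two_mul_le_sin hθ h1 h2
  rw [abs_div, abs_of_pos (by linarith : 0 < Real.sin (π * x))]
  exact div_le_div₀ zero_le_one (Real.abs_cos_le_one _) (by positivity) h

lemma norm_invOneSubE_le {θ x : ℝ} (hθ : 0 < θ) (h1 : θ ≤ x) (h2 : x ≤ 1 - θ) :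
    ‖invOneSubE x‖ ≤ 1 / (2 * θ) := by
  have h := abs_cot_le hθ h1 h2
  have h3 : (1 : ℝ) ≤ 1 / (2 * θ) := by
    rw [le_div_iff₀ (by positivity)]; linarith
  calc ‖invOneSubE x‖ ≤ ‖(1 / 2 : ℂ)‖ +
        ‖((Real.cos (π * x) / Real.sin (π * x) / 2 : ℝ) : ℂ) * Complex.I‖ := norm_add_le _ _
    _ = 1 / 2 + |Real.cos (π * x) / Real.sin (π * x)| / 2 := by
        rw [norm_mul, Complex.norm_I, mul_one, Complex.norm_real, Real.norm_eq_abs, abs_div]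
        norm_num
    _ ≤ 1 / (2 * θ) := by linarith

/-- The Kusmin–Landau inequality, with phase differences in `[θ, 1 - θ]`. -/
lemma kusmin_landau_aux (u : ℕ → ℂ) (δ : ℕ → ℝ) (hu : ∀ n, ‖u n‖ = 1)
    (huδ : ∀ n, u (n + 1) = u n * eChar (δ n)) {θ : ℝ} (hθ : 0 < θ) {a b : ℕ} (hab : a < b)
    (hmono : ∀ n, a ≤ n → n + 1 < b → δ n ≤ δ (n + 1))
    (hδ : ∀ n, a ≤ n → n < b → θ ≤ δ n ∧ δ n ≤ 1 - θ) :
    ‖∑ n ∈ Finset.Ico a b, u n + invOneSubE (δ (b - 1)) * u b‖ ≤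
      1 / (2 * θ) + (Real.cos (π * δ a) / Real.sin (π * δ a) -
        Real.cos (π * δ (b - 1)) / Real.sin (π * δ (b - 1))) / 2 := by
  have hpos : ∀ n, a ≤ n → n < b → 0 < Real.sin (π * δ n) := fun n h1 h2 => by
    have := two_mul_le_sin hθ (hδ n h1 h2).1 (hδ n h1 h2).2
    linarith
  have key : ∀ n, a ≤ n → n < b → u n + invOneSubE (δ n) * u (n + 1) = invOneSubE (δ n) * u n := by
    intro n h1 h2
    have h := invOneSubE_mul (hpos n h1 h2).ne'
    rw [huδ n]
    linear_combination (-u n) * h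
  induction b, hab using Nat.le_induction with
  | base =>
    simp only [Nat.succ_eq_add_one, Nat.Ico_succ_singleton, Finset.sum_singleton,
      add_tsub_cancel_right, sub_self, zero_div, add_zero]
    rw [key a le_rfl (by lia), norm_mul, hu, mul_one]
    exact norm_invOneSubE_le hθ (hδ a le_rfl (by lia)).1 (hδ a le_rfl (by lia)).2
  | succ b hb ih =>
    have ih' := ih (fun n h1 h2 => hmono n h1 (by lia)) (fun n h1 h2 => hδ n h1 (by lia))
      (fun n h1 h2 => hpos n h1 (by lia)) (fun n h1 h2 => key n h1 (by lia))
    have hb' : a < b := hb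
    rw [Finset.sum_Ico_succ_top (by lia), add_tsub_cancel_right]
    have e : ∑ n ∈ Finset.Ico a b, u n + u b + invOneSubE (δ b) * u (b + 1) =
        (∑ n ∈ Finset.Ico a b, u n + invOneSubE (δ (b - 1)) * u b) +
          (invOneSubE (δ b) - invOneSubE (δ (b - 1))) * u b := by
      have := key b (by lia) (by lia)
      linear_combination this
    rw [e]
    refine (norm_add_le _ _).trans ?_
    have hm : δ (b - 1) ≤ δ b := by
      have := hmono (b - 1) (by lia) (by lia)
      rwa [show b - 1 + 1 = b by lia] at this
    have h1 := hδ (b - 1) (by lia) (by lia)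
    have h2 := hδ b (by lia) (by lia)
    rw [norm_mul, hu, mul_one, norm_invOneSubE_sub (hpos (b - 1) (by lia) (by lia))
      (hpos b (by lia) (by lia)) hm (by linarith)]
    linarith

/-- The Kusmin–Landau inequality. -/
lemma kusmin_landau (g : ℕ → ℝ) (k : ℤ) {θ : ℝ} (hθ : 0 < θ) {a b : ℕ}
    (hmono : ∀ n, a ≤ n → n + 1 < b → g (n + 1) - g n ≤ g (n + 2) - g (n + 1))
    (hδ : ∀ n, a ≤ n → n < b → k + θ ≤ g (n + 1) - g n ∧ g (n + 1) - g n ≤ k + 1 - θ) :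
    ‖∑ n ∈ Finset.Ico a b, eChar (g n)‖ ≤ 2 / θ := by
  rcases le_or_gt b a with h | hab
  · rw [Finset.Ico_eq_empty (by lia), Finset.sum_empty, norm_zero]; positivity
  have hk : eChar (k : ℝ) = 1 := by
    rw [eChar, Complex.exp_eq_one_iff]
    exact ⟨k, by push_cast; ring⟩
  have h := kusmin_landau_aux (fun n => eChar (g n)) (fun n => g (n + 1) - g n - k)
    (fun n => norm_eChar _) (fun n => by
      have : g (n + 1) = g n + ((g (n + 1) - g n - k) + k) := by ring
      conv_lhs => rw [this, eChar_add, eChar_add, hk, mul_one]) hθ hab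
    (fun n h1 h2 => by have := hmono n h1 h2; linarith)
    (fun n h1 h2 => by have := hδ n h1 h2; constructor <;> linarith)
  have ha := hδ a le_rfl hab
  have hb := hδ (b - 1) (by lia) (by lia)
  have c1 := abs_cot_le hθ (x := g (a + 1) - g a - k) (by linarith) (by linarith)
  have c2 := abs_cot_le hθ (x := g (b - 1 + 1) - g (b - 1) - k) (by linarith) (by linarith)
  have c3 := norm_invOneSubE_le hθ (x := g (b - 1 + 1) - g (b - 1) - k) (by linarith) (by linarith)
  have h4 : ‖∑ n ∈ Finset.Ico a b, eChar (g n)‖ ≤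
      ‖∑ n ∈ Finset.Ico a b, eChar (g n) +
        invOneSubE (g (b - 1 + 1) - g (b - 1) - k) * eChar (g b)‖ +
      ‖invOneSubE (g (b - 1 + 1) - g (b - 1) - k) * eChar (g b)‖ := by
    refine le_trans (le_of_eq ?_) (norm_sub_le _ _)
    rw [add_sub_cancel_right]
  rw [norm_mul, norm_eChar, mul_one] at h4
  have e : 2 / θ = 4 * (1 / (2 * θ)) := by field_simp; norm_num
  have := abs_le.1 c1
  have := abs_le.1 c2
  have h5 : 0 ≤ 1 / (2 * θ) := by positivity
  rw [e]
  linarith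

end ExponentialSums

section SecondDerivative

lemma exists_eq_Ico_of_convex (S : Finset ℕ)
    (h : ∀ x ∈ S, ∀ y ∈ S, ∀ z, x ≤ z → z ≤ y → z ∈ S) : ∃ c d, S = Finset.Ico c d := by
  rcases S.eq_empty_or_nonempty with rfl | hS
  · exact ⟨0, 0, by simp⟩
  · refine ⟨S.min' hS, S.max' hS + 1, ?_⟩
    ext z
    rw [Finset.mem_Ico, Nat.lt_succ_iff]
    exact ⟨fun hz => ⟨S.min'_le z hz, S.le_max' z hz⟩,
      fun hz => h _ (S.min'_mem hS) _ (S.max'_mem hS) z hz.1 hz.2⟩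

lemma card_le_of_spacing (S : Finset ℕ) (δ : ℕ → ℝ) {lam w x : ℝ} (hlam : 0 < lam) (hw : 0 ≤ w)
    (h1 : ∀ m ∈ S, ∀ n ∈ S, m ≤ n → lam * ((n : ℝ) - m) ≤ δ n - δ m)
    (h2 : ∀ n ∈ S, x ≤ δ n ∧ δ n ≤ x + w) : (S.card : ℝ) ≤ w / lam + 1 := by
  rcases S.eq_empty_or_nonempty with rfl | hS
  · simp; positivity
  · have hsub : S ⊆ Finset.Icc (S.min' hS) (S.max' hS) := fun z hz =>
      Finset.mem_Icc.2 ⟨S.min'_le z hz, S.le_max' z hz⟩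
    have hc := Finset.card_le_card hsub
    rw [Nat.card_Icc] at hc
    have hm := S.min'_le _ (S.max'_mem hS)
    have h3 := h1 _ (S.min'_mem hS) _ (S.max'_mem hS) hm
    have h4 := h2 _ (S.min'_mem hS)
    have h5 := h2 _ (S.max'_mem hS)
    have hc' : (S.card : ℝ) ≤ (S.max' hS : ℝ) + 1 - (S.min' hS : ℝ) := by
      rw [le_sub_iff_add_le]
      have : S.card + S.min' hS ≤ S.max' hS + 1 := by lia
      exact_mod_cast this
    have h6 : (S.max' hS : ℝ) - (S.min' hS : ℝ) ≤ w / lam := by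
      rw [le_div_iff₀ hlam]; linarith
    linarith

lemma differences_bounds (δ : ℕ → ℝ) {lam Λ : ℝ} {a b : ℕ}
    (hδ : ∀ n, a ≤ n → n + 1 < b → lam ≤ δ (n + 1) - δ n ∧ δ (n + 1) - δ n ≤ Λ)
    {m n : ℕ} (hm : a ≤ m) (hmn : m ≤ n) (hn : n < b) :
    lam * ((n : ℝ) - m) ≤ δ n - δ m ∧ δ n - δ m ≤ Λ * ((n : ℝ) - m) := by
  induction n, hmn using Nat.le_induction with
  | base => simp
  | succ n hmn ih =>
    have h1 := ih (by lia)
    have h2 := hδ n (by lia) hn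
    push_cast
    constructor <;> linarith

lemma second_derivative_test_fiber (g : ℕ → ℝ) {lam : ℝ} (hlam : 0 < lam) (hlam' : lam ≤ 1 / 4)
    {a b : ℕ} (hg : ∀ n, a ≤ n → n + 1 < b →
      lam ≤ (g (n + 2) - g (n + 1)) - (g (n + 1) - g n)) (k : ℤ) :
    ‖∑ n ∈ (Finset.Ico a b).filter (fun n => ⌊g (n + 1) - g n⌋ = k), eChar (g n)‖ ≤
      5 / √lam := by
  set θ := √lam with hθdef
  have hθ : 0 < θ := Real.sqrt_pos.2 hlam
  have hθ2 : θ * θ = lam := Real.mul_self_sqrt hlam.le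
  have hθ' : θ ≤ 1 / 2 := by nlinarith
  set δ : ℕ → ℝ := fun n => g (n + 1) - g n with hδdef
  have hd : ∀ m n, a ≤ m → m ≤ n → n < b → lam * ((n : ℝ) - m) ≤ δ n - δ m := by
    intro m n hm hmn hn
    induction n, hmn using Nat.le_induction with
    | base => simp
    | succ n hmn ih =>
      have h1 := ih (by lia)
      have h2 := hg n (by lia) hn
      simp only [hδdef] at h1 ⊢
      push_cast
      have e : n + 1 + 1 = n + 2 := rfl
      rw [e]
      linarith
  have hmono : ∀ m n, a ≤ m → m ≤ n → n < b → δ m ≤ δ n := fun m n hm hmn hn => by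
    have h1 := hd m n hm hmn hn
    have h2 : (m : ℝ) ≤ n := by exact_mod_cast hmn
    nlinarith
  set S := (Finset.Ico a b).filter (fun n => ⌊δ n⌋ = k) with hSdef
  have hS : ∀ n ∈ S, (a ≤ n ∧ n < b) ∧ (k : ℝ) ≤ δ n ∧ δ n < k + 1 := by
    intro n hn
    rw [hSdef, Finset.mem_filter, Finset.mem_Ico, Int.floor_eq_iff] at hn
    exact hn
  clear_value S
  have hsplit : ∑ n ∈ S, eChar (g n) =
      ∑ n ∈ S.filter (fun n => k + θ ≤ δ n ∧ δ n ≤ k + 1 - θ), eChar (g n) +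
      (∑ n ∈ S.filter (fun n => δ n < k + θ), eChar (g n) +
       ∑ n ∈ S.filter (fun n => k + 1 - θ < δ n ∧ k + θ ≤ δ n), eChar (g n)) := by
    rw [Finset.sum_filter, Finset.sum_filter, Finset.sum_filter, ← Finset.sum_add_distrib,
      ← Finset.sum_add_distrib]
    refine Finset.sum_congr rfl fun n _ => ?_
    by_cases h1 : δ n < k + θ
    · simp [h1, not_le.2 h1]
    · by_cases h2 : k + 1 - θ < δ n
      · simp [h1, h2, not_lt.1 h1, not_le.2 h2]
      · simp [h1, h2, not_lt.1 h1, not_lt.1 h2]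
  have htriv : ∀ U : Finset ℕ, ‖∑ n ∈ U, eChar (g n)‖ ≤ U.card := fun U => by
    refine (norm_sum_le _ _).trans ?_
    simp [norm_eChar]
  have hcount : ∀ U : Finset ℕ, U ⊆ S → ∀ x : ℝ, (∀ n ∈ U, x ≤ δ n ∧ δ n ≤ x + θ) →
      ‖∑ n ∈ U, eChar (g n)‖ ≤ 1 / θ + 1 := fun U hU x hx => by
    refine (htriv U).trans ?_
    have := card_le_of_spacing U δ hlam hθ.le
      (fun m hm n hn hmn => hd m n (hS m (hU hm)).1.1 hmn (hS n (hU hn)).1.2) hx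
    rwa [show θ / lam = 1 / θ by rw [← hθ2]; field_simp] at this
  have hmid : ‖∑ n ∈ S.filter (fun n => k + θ ≤ δ n ∧ δ n ≤ k + 1 - θ), eChar (g n)‖ ≤ 2 / θ := by
    obtain ⟨c, d, hcd⟩ := exists_eq_Ico_of_convex
      (S.filter (fun n => k + θ ≤ δ n ∧ δ n ≤ k + 1 - θ)) (by
        intro x hx y hy z hxz hzy
        rw [Finset.mem_filter] at hx hy ⊢
        have hx' := hS x hx.1
        have hy' := hS y hy.1
        have h1 := hmono x z hx'.1.1 hxz (by lia)
        have h2 := hmono z y (by lia) hzy hy'.1.2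
        refine ⟨?_, by linarith, by linarith⟩
        rw [hSdef, Finset.mem_filter, Finset.mem_Ico, Int.floor_eq_iff]
        exact ⟨⟨by lia, by lia⟩, by linarith, by linarith⟩)
    rw [hcd]
    have hmem : ∀ n, c ≤ n → n < d → n ∈ S ∧ k + θ ≤ δ n ∧ δ n ≤ k + 1 - θ := fun n h1 h2 => by
      have : n ∈ Finset.Ico c d := Finset.mem_Ico.2 ⟨h1, h2⟩
      rwa [← hcd, Finset.mem_filter] at this
    refine kusmin_landau g k hθ (fun n h1 h2 => ?_) (fun n h1 h2 => (hmem n h1 h2).2)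
    have h3 := hS n (hmem n h1 (by lia)).1
    have h4 := hS (n + 1) (hmem (n + 1) (by lia) h2).1
    exact hmono n (n + 1) h3.1.1 (by lia) h4.1.2
  rw [hsplit]
  have h1 := hcount (S.filter (fun n => δ n < k + θ)) (Finset.filter_subset _ _) k
    (fun n hn => by
      rw [Finset.mem_filter] at hn
      exact ⟨(hS n hn.1).2.1, hn.2.le⟩)
  have h2 := hcount (S.filter (fun n => k + 1 - θ < δ n ∧ k + θ ≤ δ n)) (Finset.filter_subset _ _)
    (k + 1 - θ) (fun n hn => by
      rw [Finset.mem_filter] at hn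
      exact ⟨hn.2.1.le, by linarith [(hS n hn.1).2.2]⟩)
  refine (norm_add_le _ _).trans ((add_le_add hmid (norm_add_le _ _)).trans ?_)
  have h3 : 2 ≤ 1 / θ := by rw [le_div_iff₀ hθ]; linarith
  have e2 : 2 / θ = 2 * (1 / θ) := by ring
  have e5 : 5 / θ = 5 * (1 / θ) := by ring
  rw [e2, e5]
  linarith

/-- A discrete form of van der Corput's second derivative test. -/
lemma second_derivative_test (g : ℕ → ℝ) {lam C : ℝ} (hlam : 0 < lam) (hC : 1 ≤ C) {a b : ℕ}
    (hab : a ≤ b) (hg : ∀ n, a ≤ n → n + 1 < b →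
      lam ≤ (g (n + 2) - g (n + 1)) - (g (n + 1) - g n) ∧
      (g (n + 2) - g (n + 1)) - (g (n + 1) - g n) ≤ C * lam) :
    ‖∑ n ∈ Finset.Ico a b, eChar (g n)‖ ≤ 5 * (C * (b - a) * lam + 2) / √lam := by
  have hs := Real.sqrt_pos.2 hlam
  have hsq : √lam * √lam = lam := Real.mul_self_sqrt hlam.le
  have hba : (0 : ℝ) ≤ b - a := by rw [sub_nonneg]; exact_mod_cast hab
  rcases le_or_gt lam (1 / 4) with hl | hl
  · rcases hab.eq_or_lt with rfl | hab'
    · simp; positivity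
    set δ : ℕ → ℝ := fun n => g (n + 1) - g n with hδdef
    have hb := fun n (h1 : a ≤ n) (h2 : n < b) => differences_bounds δ (lam := lam) (Λ := C * lam)
      (a := a) (b := b) (fun n h1 h2 => hg n h1 h2) le_rfl h1 h2
    have hmaps : ∀ n ∈ Finset.Ico a b, ⌊δ n⌋ ∈ Finset.Icc ⌊δ a⌋ ⌊δ a + C * lam * (b - a)⌋ := by
      intro n hn
      rw [Finset.mem_Ico] at hn
      have h := hb n hn.1 hn.2
      have h1 : (a : ℝ) ≤ n := by exact_mod_cast hn.1
      have h2 : (n : ℝ) ≤ b := by exact_mod_cast hn.2.le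
      rw [Finset.mem_Icc]
      refine ⟨Int.floor_le_floor (by nlinarith), Int.floor_le_floor ?_⟩
      have : C * lam * ((n : ℝ) - a) ≤ C * lam * (b - a) := by gcongr
      linarith
    rw [← Finset.sum_fiberwise_of_maps_to hmaps]
    refine (norm_sum_le _ _).trans ((Finset.sum_le_sum (fun k _ =>
      second_derivative_test_fiber g hlam hl (fun n h1 h2 => (hg n h1 h2).1) k)).trans ?_)
    rw [Finset.sum_const, nsmul_eq_mul, mul_div_assoc', mul_comm]
    gcongr
    have hle : ⌊δ a⌋ ≤ ⌊δ a + C * lam * (b - a)⌋ :=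
      Int.floor_le_floor (le_add_of_nonneg_right (by positivity))
    have hcard : ((Finset.Icc ⌊δ a⌋ ⌊δ a + C * lam * (b - a)⌋).card : ℝ) =
        (⌊δ a + C * lam * (b - a)⌋ : ℝ) + 1 - ⌊δ a⌋ := by
      rw [Int.card_Icc]
      have : ((⌊δ a + C * lam * (b - a)⌋ + 1 - ⌊δ a⌋).toNat : ℤ) =
        ⌊δ a + C * lam * (b - a)⌋ + 1 - ⌊δ a⌋ := Int.toNat_of_nonneg (by lia)
      exact_mod_cast this
    rw [hcard]
    have h1 := Int.floor_le (δ a + C * lam * (b - a))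
    have h2 := Int.lt_floor_add_one (δ a)
    linarith
  · refine (norm_sum_le _ _).trans ?_
    simp only [norm_eChar, Finset.sum_const, Nat.card_Ico, nsmul_eq_mul, mul_one]
    rw [Nat.cast_sub hab, le_div_iff₀ hs]
    have h1 : 1 / 2 ≤ √lam := by
      rw [Real.le_sqrt (by norm_num) hlam.le]; linarith
    have h2 : √lam ≤ 2 * lam := by nlinarith
    nlinarith [mul_nonneg hba hlam.le]

end SecondDerivative

section Differencing

/-- The sequence `z` cut off to `[a, b)` and shifted by `h`. -/
noncomputable def shiftCut (z : ℕ → ℂ) (a b h m : ℕ) : ℂ :=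
  if a + h ≤ m ∧ m < b + h then z (m - h) else 0

lemma sum_shiftCut_mul (z : ℕ → ℂ) (a b : ℕ) {h H : ℕ} (hH : h < H) (w : ℕ → ℂ) :
    ∑ m ∈ Finset.range (b + H), shiftCut z a b h m * w m =
      ∑ n ∈ Finset.Ico a b, z n * w (n + h) := by
  have h1 : ∑ n ∈ Finset.Ico a b, z n * w (n + h) =
      ∑ n ∈ Finset.Ico a b, (fun m => z (m - h) * w m) (n + h) := by
    simp
  rw [h1, Finset.sum_Ico_add' (fun m => z (m - h) * w m) a b h]
  have hsub : Finset.Ico (a + h) (b + h) ⊆ Finset.range (b + H) := fun m hm => by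
    rw [Finset.mem_Ico] at hm; rw [Finset.mem_range]; lia
  rw [← Finset.sum_subset hsub]
  · refine Finset.sum_congr rfl fun m hm => ?_
    rw [Finset.mem_Ico] at hm
    rw [shiftCut, if_pos hm]
  · intro m _ hm
    rw [Finset.mem_Ico] at hm
    rw [shiftCut, if_neg hm, zero_mul]

lemma correlation_shiftCut (z : ℕ → ℂ) (a b : ℕ) {h h' H : ℕ} (hH : h < H) (hh : h' ≤ h) :
    ∑ m ∈ Finset.range (b + H), shiftCut z a b h m * (starRingEnd ℂ) (shiftCut z a b h' m) =
      ∑ n ∈ Finset.Ico a (b - (h - h')), z n * (starRingEnd ℂ) (z (n + (h - h'))) := by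
  rw [sum_shiftCut_mul z a b hH (fun m => (starRingEnd ℂ) (shiftCut z a b h' m))]
  have hsub : Finset.Ico a (b - (h - h')) ⊆ Finset.Ico a b :=
    Finset.Ico_subset_Ico_right (by lia)
  rw [← Finset.sum_subset hsub]
  · refine Finset.sum_congr rfl fun m hm => ?_
    rw [Finset.mem_Ico] at hm
    rw [shiftCut, if_pos (by lia), show m + h - h' = m + (h - h') by lia]
  · intro m hm hm'
    rw [Finset.mem_Ico] at hm hm'
    rw [shiftCut, if_neg (by lia), map_zero, mul_zero]

lemma sum_dist_le (f : ℕ → ℝ) (hf : ∀ k, 0 ≤ f k) {h H : ℕ} (hH : h < H) :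
    ∑ h' ∈ Finset.range H, f (if h' ≤ h then h - h' else h' - h) ≤
      f 0 + 2 * ∑ k ∈ Finset.Ico 1 H, f k := by
  rw [Finset.range_eq_Ico, ← Finset.sum_Ico_consecutive _ (Nat.zero_le (h + 1)) (by lia)]
  have h1 : ∑ h' ∈ Finset.Ico 0 (h + 1), f (if h' ≤ h then h - h' else h' - h) ≤
      f 0 + ∑ k ∈ Finset.Ico 1 H, f k := by
    have e : ∑ h' ∈ Finset.Ico 0 (h + 1), f (if h' ≤ h then h - h' else h' - h) =
        ∑ k ∈ Finset.range (h + 1), f k := by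
      rw [← Finset.sum_range_reflect f (h + 1), Finset.range_eq_Ico]
      refine Finset.sum_congr rfl fun m hm => ?_
      rw [Finset.mem_Ico] at hm
      rw [if_pos (by lia)]
      congr 1
    rw [e, Finset.range_eq_Ico, Finset.sum_eq_sum_Ico_succ_bot (Nat.succ_pos h)]
    exact add_le_add_right (Finset.sum_le_sum_of_subset_of_nonneg
      (Finset.Ico_subset_Ico_right (show h + 1 ≤ H by lia)) (fun _ _ _ => hf _)) _
  have h2 : ∑ h' ∈ Finset.Ico (h + 1) H, f (if h' ≤ h then h - h' else h' - h) ≤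
      ∑ k ∈ Finset.Ico 1 H, f k := by
    have e : ∑ h' ∈ Finset.Ico (h + 1) H, f (if h' ≤ h then h - h' else h' - h) =
        ∑ k ∈ Finset.Ico 1 (H - h), f k := by
      have := Finset.sum_Ico_add' (fun m => f (m - h)) 1 (H - h) h
      rw [show 1 + h = h + 1 by lia, show H - h + h = H by lia] at this
      simp only [Nat.add_sub_cancel] at this
      rw [this]
      refine Finset.sum_congr rfl fun m hm => ?_
      rw [Finset.mem_Ico] at hm
      rw [if_neg (by lia)]
    rw [e]
    exact Finset.sum_le_sum_of_subset_of_nonneg (Finset.Ico_subset_Ico_right (by lia))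
      (fun _ _ _ => hf _)
  linarith

/-- The Weyl–van der Corput inequality. -/
lemma van_der_corput_inequality (z : ℕ → ℂ) (hz : ∀ n, ‖z n‖ ≤ 1) (a b : ℕ) (H : ℕ) :
    H * ‖∑ n ∈ Finset.Ico a b, z n‖ ^ 2 ≤ (b + H) * (b + 2 * ∑ k ∈ Finset.Ico 1 H,
      ‖∑ n ∈ Finset.Ico a (b - k), z n * (starRingEnd ℂ) (z (n + k))‖) := by
  set S := ∑ n ∈ Finset.Ico a b, z n with hS
  set f : ℕ → ℝ := fun k => ‖∑ n ∈ Finset.Ico a (b - k), z n * (starRingEnd ℂ) (z (n + k))‖ with hf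
  rcases Nat.eq_zero_or_pos H with rfl | hpos
  · simp; positivity
  have hHS : (H : ℂ) * S =
      ∑ m ∈ Finset.range (b + H), ∑ h ∈ Finset.range H, shiftCut z a b h m := by
    rw [Finset.sum_comm, Finset.sum_congr rfl (g := fun _ => S)]
    · simp
    · intro h hh
      have := sum_shiftCut_mul z a b (Finset.mem_range.1 hh) (fun _ => 1)
      simpa using this
  have hf0 : f 0 ≤ b := by
    simp only [hf]
    refine (norm_sum_le _ _).trans
      ((Finset.sum_le_sum (g := fun _ => (1 : ℝ)) fun n _ => ?_).trans ?_)
    · rw [norm_mul, RCLike.norm_conj, Nat.add_zero]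
      exact mul_le_one₀ (hz n) (norm_nonneg _) (hz n)
    · simp
  have hcorr : ∀ h ∈ Finset.range H, ∀ h' ∈ Finset.range H,
      ‖∑ m ∈ Finset.range (b + H), shiftCut z a b h m * (starRingEnd ℂ) (shiftCut z a b h' m)‖ =
        f (if h' ≤ h then h - h' else h' - h) := by
    intro h hh h' hh'
    rw [Finset.mem_range] at hh hh'
    split_ifs with hc
    · rw [correlation_shiftCut z a b hh hc]
    · change _ = ‖∑ n ∈ Finset.Ico a (b - (h' - h)), z n * (starRingEnd ℂ) (z (n + (h' - h)))‖
      rw [← correlation_shiftCut z a b hh' (not_le.1 hc).le, ← RCLike.norm_conj, map_sum]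
      congr 1
      refine Finset.sum_congr rfl fun m _ => ?_
      rw [map_mul, Complex.conj_conj, mul_comm]
  have hCS : ‖(H : ℂ) * S‖ ^ 2 ≤ (b + H) * ∑ m ∈ Finset.range (b + H),
      ‖∑ h ∈ Finset.range H, shiftCut z a b h m‖ ^ 2 := by
    rw [hHS]
    refine (pow_le_pow_left₀ (norm_nonneg _) (norm_sum_le _ _) 2).trans ?_
    have := sq_sum_le_card_mul_sum_sq (s := Finset.range (b + H))
      (f := fun m => ‖∑ h ∈ Finset.range H, shiftCut z a b h m‖)
    simpa using this
  have hexp : ∑ m ∈ Finset.range (b + H), ‖∑ h ∈ Finset.range H, shiftCut z a b h m‖ ^ 2 ≤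
      ∑ h ∈ Finset.range H, ∑ h' ∈ Finset.range H, f (if h' ≤ h then h - h' else h' - h) := by
    have e : ((∑ m ∈ Finset.range (b + H),
        ‖∑ h ∈ Finset.range H, shiftCut z a b h m‖ ^ 2 : ℝ) : ℂ) =
        ∑ h ∈ Finset.range H, ∑ h' ∈ Finset.range H, ∑ m ∈ Finset.range (b + H),
          shiftCut z a b h m * (starRingEnd ℂ) (shiftCut z a b h' m) := by
      push_cast
      refine Eq.trans ?_ (Finset.sum_congr rfl fun h _ => Finset.sum_comm)
      refine Eq.trans ?_ Finset.sum_comm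
      refine Finset.sum_congr rfl fun m _ => ?_
      rw [← Complex.mul_conj', map_sum, Finset.sum_mul_sum]
    have h0 : 0 ≤ ∑ m ∈ Finset.range (b + H), ‖∑ h ∈ Finset.range H, shiftCut z a b h m‖ ^ 2 :=
      Finset.sum_nonneg fun _ _ => by positivity
    rw [← abs_of_nonneg h0, ← Real.norm_eq_abs, ← Complex.norm_real, e]
    refine (norm_sum_le _ _).trans (Finset.sum_le_sum fun h hh => ?_)
    refine (norm_sum_le _ _).trans (Finset.sum_le_sum fun h' hh' => ?_)
    exact (hcorr h hh h' hh').le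
  have hfin : ∑ h ∈ Finset.range H, ∑ h' ∈ Finset.range H, f (if h' ≤ h then h - h' else h' - h) ≤
      H * (b + 2 * ∑ k ∈ Finset.Ico 1 H, f k) := by
    refine (Finset.sum_le_sum fun h hh => (sum_dist_le f (fun k => norm_nonneg _)
      (Finset.mem_range.1 hh)).trans (add_le_add_left hf0 _)).trans ?_
    rw [Finset.sum_const, Finset.card_range, nsmul_eq_mul]
  rw [norm_mul, Complex.norm_natCast, mul_pow] at hCS
  have hH' : (0 : ℝ) < H := by exact_mod_cast hpos
  have : (H : ℝ) * (H * ‖S‖ ^ 2) ≤ H * ((b + H) * (b + 2 * ∑ k ∈ Finset.Ico 1 H, f k)) := by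
    calc (H : ℝ) * (H * ‖S‖ ^ 2) = H ^ 2 * ‖S‖ ^ 2 := by ring
      _ ≤ (b + H) * (H * (b + 2 * ∑ k ∈ Finset.Ico 1 H, f k)) :=
        hCS.trans (by gcongr; exact hexp.trans hfin)
      _ = _ := by ring
  exact le_of_mul_le_mul_left this hH'

end Differencing

section ZetaSums

lemma eChar_log {n : ℕ} (hn : n ≠ 0) (t : ℝ) :
    eChar (-(t / (2 * π)) * Real.log n) = (n : ℂ) ^ (-(t : ℂ) * Complex.I) := by
  rw [eChar, Complex.cpow_def_of_ne_zero (by exact_mod_cast hn), ← Complex.natCast_log]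
  congr 1
  have h := pi_ne_zero
  have : 2 * π * (-(t / (2 * π)) * Real.log n) = -t * Real.log n := by field_simp
  rw [this]
  push_cast
  ring

lemma log_sub_log_bounds {x y : ℝ} (hx : 0 < x) (hy : 0 < y) :
    (y - x) / y ≤ Real.log y - Real.log x ∧ Real.log y - Real.log x ≤ (y - x) / x := by
  rw [← Real.log_div hy.ne' hx.ne']
  have h1 := Real.one_sub_inv_le_log_of_pos (div_pos hy hx)
  have h2 := Real.log_le_sub_one_of_pos (div_pos hy hx)
  constructor
  · refine le_trans (le_of_eq ?_) h1
    field_simp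
  · refine h2.trans (le_of_eq ?_)
    field_simp

lemma second_difference_log_bounds {n N : ℕ} (hN : 1 ≤ N) (h1 : N ≤ n) (h2 : n + 1 ≤ 2 * N) :
    1 / (4 * (N : ℝ) ^ 2) ≤ 2 * Real.log (n + 1) - Real.log n - Real.log (n + 2) ∧
    2 * Real.log (n + 1) - Real.log n - Real.log (n + 2) ≤ 1 / (N : ℝ) ^ 2 := by
  have hN' : (0 : ℝ) < N := by exact_mod_cast hN
  have h1' : (N : ℝ) ≤ n := by exact_mod_cast h1
  have h2' : (n : ℝ) + 1 ≤ 2 * N := by exact_mod_cast h2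
  have hn : (0 : ℝ) < n := hN'.trans_le h1'
  have e : 2 * Real.log (n + 1) - Real.log n - Real.log (n + 2) =
      Real.log (((n : ℝ) + 1) ^ 2) - Real.log (n * (n + 2)) := by
    rw [Real.log_pow, Real.log_mul (by positivity) (by positivity)]; push_cast; ring
  have h := log_sub_log_bounds (x := (n : ℝ) * (n + 2)) (y := ((n : ℝ) + 1) ^ 2) (by positivity)
    (by positivity)
  have e2 : ((n : ℝ) + 1) ^ 2 - n * (n + 2) = 1 := by ring
  rw [e2] at h
  rw [e]
  constructor
  · refine le_trans ?_ h.1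
    apply one_div_le_one_div_of_le (by positivity)
    nlinarith
  · refine h.2.trans ?_
    apply one_div_le_one_div_of_le (by positivity)
    nlinarith

lemma third_difference_log_bounds {n N : ℕ} (hN : 1 ≤ N) (h1 : N ≤ n) (h2 : n + 1 ≤ 2 * N) :
    1 / (8 * (N : ℝ) ^ 3) ≤ (2 * Real.log (n + 1) - Real.log n - Real.log (n + 2)) -
      (2 * Real.log (n + 1 + 1) - Real.log (n + 1) - Real.log (n + 1 + 2)) ∧
    (2 * Real.log (n + 1) - Real.log n - Real.log (n + 2)) -
      (2 * Real.log (n + 1 + 1) - Real.log (n + 1) - Real.log (n + 1 + 2)) ≤ 2 / (N : ℝ) ^ 3 := by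
  have hN' : (0 : ℝ) < N := by exact_mod_cast hN
  have h1' : (N : ℝ) ≤ n := by exact_mod_cast h1
  have h2' : (n : ℝ) + 1 ≤ 2 * N := by exact_mod_cast h2
  have hn : (0 : ℝ) < n := hN'.trans_le h1'
  have e : (2 * Real.log (n + 1) - Real.log n - Real.log (n + 2)) -
      (2 * Real.log (n + 1 + 1) - Real.log (n + 1) - Real.log (n + 1 + 2)) =
      Real.log (((n : ℝ) + 1) ^ 3 * (n + 3)) - Real.log (n * (n + 2) ^ 3) := by
    rw [Real.log_mul (by positivity) (by positivity), Real.log_mul (by positivity) (by positivity),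
      Real.log_pow, Real.log_pow, show (n : ℝ) + 1 + 1 = n + 2 by ring,
      show (n : ℝ) + 1 + 2 = n + 3 by ring]; push_cast; ring
  have h := log_sub_log_bounds (x := (n : ℝ) * (n + 2) ^ 3) (y := ((n : ℝ) + 1) ^ 3 * (n + 3))
    (by positivity) (by positivity)
  have e2 : ((n : ℝ) + 1) ^ 3 * (n + 3) - n * (n + 2) ^ 3 = 2 * n + 3 := by ring
  rw [e2] at h
  rw [e]
  constructor
  · refine le_trans ?_ h.1
    rw [div_le_div_iff₀ (by positivity) (by positivity), one_mul]
    have : ((n : ℝ) + 1) ^ 3 ≤ 8 * N ^ 3 := by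
      calc ((n : ℝ) + 1) ^ 3 ≤ (2 * N) ^ 3 := by gcongr
        _ = _ := by ring
    calc ((n : ℝ) + 1) ^ 3 * (n + 3) ≤ (8 * N ^ 3) * (2 * n + 3) := by gcongr; linarith
      _ = _ := by ring
  · refine h.2.trans ?_
    rw [div_le_div_iff₀ (by positivity) (by positivity)]
    have : (N : ℝ) ^ 3 ≤ n * (n + 2) ^ 2 := by
      calc (N : ℝ) ^ 3 = (N : ℝ) * (N : ℝ) ^ 2 := by ring
        _ ≤ (n : ℝ) * ((n : ℝ) + 2) ^ 2 := by gcongr; linarith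
    calc (2 * (n : ℝ) + 3) * N ^ 3 ≤ (2 * (n + 2)) * (n * (n + 2) ^ 2) := by gcongr; linarith
      _ = _ := by ring

lemma sum_cpow_eq_sum_eChar {N a b : ℕ} (hN : 1 ≤ N) (ha : N ≤ a) (t : ℝ) :
    ∑ n ∈ Finset.Ico a b, (n : ℂ) ^ (-(t : ℂ) * Complex.I) =
      ∑ n ∈ Finset.Ico a b, eChar (-(t / (2 * π)) * Real.log n) :=
  Finset.sum_congr rfl fun n hn => (eChar_log (by rw [Finset.mem_Ico] at hn; lia) t).symm

lemma norm_sum_cpow_le_of_le {N a b : ℕ} (hN : 1 ≤ N) (ha : N ≤ a) (hb : b ≤ 2 * N) {t : ℝ}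
    (ht : 0 < t) (htN : t ≤ N) :
    ‖∑ n ∈ Finset.Ico a b, (n : ℂ) ^ (-(t : ℂ) * Complex.I)‖ ≤ 32 * (N / t) := by
  have hN' : (0 : ℝ) < N := by exact_mod_cast hN
  have hpi := pi_pos
  have hpi3 := pi_gt_three
  rw [sum_cpow_eq_sum_eChar hN ha]
  have hθ : 0 < t / (4 * π * N) := by positivity
  have := kusmin_landau (fun n : ℕ => -(t / (2 * π)) * Real.log n) (-1) hθ (a := a) (b := b) ?_ ?_
  · refine this.trans ?_
    rw [div_div_eq_mul_div, mul_div_assoc', div_le_div_iff_of_pos_right ht]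
    have := pi_le_four
    nlinarith
  · intro n h1 h2
    have h := (second_difference_log_bounds hN (ha.trans h1) (by lia)).1
    have h' : 0 ≤ 2 * Real.log (n + 1) - Real.log n - Real.log (n + 2) :=
      le_trans (by positivity) h
    push_cast
    have : 0 ≤ t / (2 * π) * (2 * Real.log (n + 1) - Real.log n - Real.log (n + 2)) := by positivity
    linarith
  · intro n h1 h2
    have hn : (N : ℝ) ≤ n := by exact_mod_cast ha.trans h1
    have hn2 : (n : ℝ) + 1 ≤ 2 * N := by exact_mod_cast (show n + 1 ≤ 2 * N by lia)
    have h := log_sub_log_bounds (x := (n : ℝ)) (y := n + 1) (by linarith) (by linarith)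
    rw [add_sub_cancel_left] at h
    have hl : 1 / (2 * (N : ℝ)) ≤ Real.log (n + 1) - Real.log n :=
      le_trans (one_div_le_one_div_of_le (by linarith) hn2) h.1
    have hu : Real.log (n + 1) - Real.log n ≤ 1 / N :=
      h.2.trans (one_div_le_one_div_of_le hN' hn)
    have e1 : t / (2 * π) * (1 / (2 * (N : ℝ))) = t / (4 * π * N) := by field_simp; norm_num
    have e2 : t / (2 * π) * (1 / (N : ℝ)) = 2 * (t / (4 * π * N)) := by field_simp; norm_num
    have h3 : t / (4 * π * N) ≤ 1 / 4 := by
      rw [div_le_div_iff₀ (by positivity) (by norm_num)]; nlinarith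
    have hp : 0 ≤ t / (2 * π) := by positivity
    have h4 := mul_le_mul_of_nonneg_left hl hp
    have h5 := mul_le_mul_of_nonneg_left hu hp
    push_cast
    constructor <;> linarith

lemma norm_sum_cpow_le {N a b : ℕ} (hN : 1 ≤ N) (ha : N ≤ a) (hb : b ≤ 2 * N) {t : ℝ}
    (ht : 0 < t) :
    ‖∑ n ∈ Finset.Ico a b, (n : ℂ) ^ (-(t : ℂ) * Complex.I)‖ ≤ 60 * (√t + N / √t) := by
  have hN' : (0 : ℝ) < N := by exact_mod_cast hN
  have hpi := pi_pos
  have hpi3 := pi_gt_three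
  have hpi4 := pi_lt_d2
  have hst := Real.sqrt_pos.2 ht
  rcases lt_or_ge b a with hba | hab
  · rw [Finset.Ico_eq_empty (by lia), Finset.sum_empty, norm_zero]; positivity
  rw [sum_cpow_eq_sum_eChar hN ha]
  have hlam : 0 < t / (8 * π * N ^ 2) := by positivity
  have := second_derivative_test (fun n : ℕ => -(t / (2 * π)) * Real.log n) (C := 4) hlam
    (by norm_num) hab ?_
  · refine this.trans ?_
    set m := √(t / (8 * π * N ^ 2)) with hm
    have hm0 : 0 < m := Real.sqrt_pos.2 hlam
    have hm2 : m * m = t / (8 * π * N ^ 2) := Real.mul_self_sqrt hlam.le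
    have hmu : m ≤ √t / (4 * N) := by
      rw [hm, Real.sqrt_le_left (by positivity), div_pow, Real.sq_sqrt ht.le]
      apply div_le_div_of_nonneg_left ht.le (by positivity)
      nlinarith [sq_nonneg (N : ℝ)]
    have hml : √t / (6 * N) ≤ m := by
      rw [hm]
      apply Real.le_sqrt_of_sq_le
      rw [div_pow, Real.sq_sqrt ht.le]
      apply div_le_div_of_nonneg_left ht.le (by positivity)
      nlinarith [sq_nonneg (N : ℝ)]
    rw [← hm2]
    have hbN : (b : ℝ) - a ≤ N := by
      rw [sub_le_iff_le_add]
      exact_mod_cast (show b ≤ N + a by lia)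
    have e : 5 * (4 * ((b : ℝ) - a) * (m * m) + 2) / m = 20 * (b - a) * m + 10 * (1 / m) := by
      field_simp; ring
    rw [e]
    have h1 : 20 * ((b : ℝ) - a) * m ≤ 20 * N * (√t / (4 * N)) := by gcongr
    have h2 : 1 / m ≤ 6 * (N / √t) := by
      refine (one_div_le_one_div_of_le (by positivity) hml).trans (le_of_eq ?_)
      field_simp
    have h3 : 20 * N * (√t / (4 * N)) = 5 * √t := by field_simp; norm_num
    have h4 : 0 ≤ N / √t := by positivity
    linarith
  · intro n h1 h2
    have h := second_difference_log_bounds hN (ha.trans h1) (show n + 1 ≤ 2 * N by lia)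
    have hp : 0 ≤ t / (2 * π) := by positivity
    have h4 := mul_le_mul_of_nonneg_left h.1 hp
    have h5 := mul_le_mul_of_nonneg_left h.2 hp
    have e1 : t / (2 * π) * (1 / (4 * (N : ℝ) ^ 2)) = t / (8 * π * N ^ 2) := by
      field_simp; norm_num
    have e2 : t / (2 * π) * (1 / (N : ℝ) ^ 2) = 4 * (t / (8 * π * N ^ 2)) := by
      field_simp; norm_num
    push_cast
    constructor <;> linarith

end ZetaSums

section ThirdDerivative

lemma sum_one_div_sqrt_le (m : ℕ) : ∑ k ∈ Finset.Ico 1 (m + 1), 1 / √(k : ℝ) ≤ 2 * √m := by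
  induction m with
  | zero => simp
  | succ m ih =>
    rw [Finset.sum_Ico_succ_top (by lia)]
    have h0 : 0 < √((m + 1 : ℕ) : ℝ) := Real.sqrt_pos.2 (by positivity)
    have h1 : √((m + 1 : ℕ) : ℝ) * √((m + 1 : ℕ) : ℝ) = m + 1 := by
      rw [Real.mul_self_sqrt (by positivity)]; push_cast; ring
    have h2 : √(m : ℝ) * √(m : ℝ) = m := Real.mul_self_sqrt (by positivity)
    have h3 : 1 / √((m + 1 : ℕ) : ℝ) ≤ 2 * √((m + 1 : ℕ) : ℝ) - 2 * √m := by
      rw [div_le_iff₀ h0]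
      nlinarith [sq_nonneg (√((m + 1 : ℕ) : ℝ) - √m)]
    linarith

/-- Second differences of the differenced phase. -/
lemma differenced_phase_bounds {n N k : ℕ} (hN : 1 ≤ N) (h1 : N ≤ n) (h2 : n + k + 1 ≤ 2 * N) :
    k * (1 / (8 * (N : ℝ) ^ 3)) ≤ (2 * Real.log (n + 1) - Real.log n - Real.log (n + 2)) -
      (2 * Real.log (n + k + 1) - Real.log (n + k) - Real.log (n + k + 2)) ∧
    (2 * Real.log (n + 1) - Real.log n - Real.log (n + 2)) -
      (2 * Real.log (n + k + 1) - Real.log (n + k) - Real.log (n + k + 2)) ≤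
        k * (2 / (N : ℝ) ^ 3) := by
  induction k with
  | zero => simp
  | succ k ih =>
    have h3 := ih (by lia)
    have h4 := third_difference_log_bounds (n := n + k) hN (by lia) (by lia)
    push_cast at h4 ⊢
    rw [show (n : ℝ) + (k + 1) = n + k + 1 by ring]
    constructor <;> linarith

lemma norm_correlation_le {N a b k : ℕ} (hN : 1 ≤ N) (ha : N ≤ a) (hb : b ≤ 2 * N) (hk : 1 ≤ k)
    {t : ℝ} (ht : 0 < t) :
    ‖∑ n ∈ Finset.Ico a (b - k), (n : ℂ) ^ (-(t : ℂ) * Complex.I) *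
      (starRingEnd ℂ) (((n + k : ℕ) : ℂ) ^ (-(t : ℂ) * Complex.I))‖ ≤
      80 * N * (√k * √(t / (16 * π * N ^ 3))) + 10 * (1 / √k) * (1 / √(t / (16 * π * N ^ 3))) := by
  have hN' : (0 : ℝ) < N := by exact_mod_cast hN
  have hpi := pi_pos
  have hk' : (0 : ℝ) < k := by exact_mod_cast hk
  rcases lt_or_ge (b - k) a with hba | hab
  · rw [Finset.Ico_eq_empty (by lia), Finset.sum_empty, norm_zero]; positivity
  have e : ∀ n ∈ Finset.Ico a (b - k), (n : ℂ) ^ (-(t : ℂ) * Complex.I) *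
      (starRingEnd ℂ) (((n + k : ℕ) : ℂ) ^ (-(t : ℂ) * Complex.I)) =
      eChar (t / (2 * π) * (Real.log (n + k) - Real.log n)) := by
    intro n hn
    rw [Finset.mem_Ico] at hn
    rw [← eChar_log (by lia), ← eChar_log (by lia), ← eChar_neg, ← eChar_add]
    congr 1
    push_cast
    ring
  rw [Finset.sum_congr rfl e]
  have hlam : 0 < t / (16 * π * N ^ 3) := by positivity
  have := second_derivative_test (fun n : ℕ => t / (2 * π) * (Real.log (n + k) - Real.log n))
    (C := 16) (lam := k * (t / (16 * π * N ^ 3))) (by positivity) (by norm_num) hab ?_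
  · refine this.trans ?_
    rw [Real.sqrt_mul hk'.le]
    set m := √(t / (16 * π * N ^ 3)) with hm
    have hm0 : 0 < m := Real.sqrt_pos.2 hlam
    have hm2 : m * m = t / (16 * π * N ^ 3) := Real.mul_self_sqrt hlam.le
    set r := √(k : ℝ) with hr
    have hr0 : 0 < r := Real.sqrt_pos.2 hk'
    have hr2 : r * r = k := Real.mul_self_sqrt hk'.le
    rw [← hm2, ← hr2]
    have hbN : ((b - k : ℕ) : ℝ) - a ≤ N := by
      rw [sub_le_iff_le_add]
      exact_mod_cast (show b - k ≤ N + a by lia)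
    have e : 5 * (16 * (((b - k : ℕ) : ℝ) - a) * (r * r * (m * m)) + 2) / (r * m) =
        80 * (((b - k : ℕ) : ℝ) - a) * (r * m) + 10 * (1 / r) * (1 / m) := by
      field_simp; ring
    rw [e]
    gcongr
  · intro n h1 h2
    have h := differenced_phase_bounds (k := k) hN (ha.trans h1) (show n + k + 1 ≤ 2 * N by lia)
    have hp : 0 ≤ t / (2 * π) := by positivity
    have h4 := mul_le_mul_of_nonneg_left h.1 hp
    have h5 := mul_le_mul_of_nonneg_left h.2 hp
    have e1 : t / (2 * π) * (k * (1 / (8 * (N : ℝ) ^ 3))) = k * (t / (16 * π * N ^ 3)) := by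
      field_simp; norm_num
    have e2 : t / (2 * π) * (k * (2 / (N : ℝ) ^ 3)) = 16 * (k * (t / (16 * π * N ^ 3))) := by
      field_simp
    push_cast
    rw [show (n : ℝ) + 1 + k = n + k + 1 by ring, show (n : ℝ) + 2 + k = n + k + 2 by ring]
    constructor <;> linarith

/-- The third derivative estimate for `∑ n^{-it}`, with `t = w ^ 6`. -/
lemma norm_sum_cpow_le_sqrt {N a b : ℕ} (hN : 1 ≤ N) (ha : N ≤ a) (hb : b ≤ 2 * N) {w : ℝ}
    (hw : 1 ≤ w) (hNw : (N : ℝ) ≤ w ^ 4) :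
    ‖∑ n ∈ Finset.Ico a b, (n : ℂ) ^ (-((w ^ 6 : ℝ) : ℂ) * Complex.I)‖ ≤ 38 * (√N * w) := by
  have hN' : (1 : ℝ) ≤ N := by exact_mod_cast hN
  have hN0 : (0 : ℝ) < N := by linarith
  have hw0 : 0 < w := by linarith
  have hpi := pi_pos
  have hpi3 := pi_gt_d2
  have hpi4 := pi_lt_d2
  have hz : ∀ n : ℕ, n ≠ 0 → ‖(n : ℂ) ^ (-((w ^ 6 : ℝ) : ℂ) * Complex.I)‖ = 1 := fun n hn => by
    rw [← eChar_log hn, norm_eChar]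
  set S := ∑ n ∈ Finset.Ico a b, (n : ℂ) ^ (-((w ^ 6 : ℝ) : ℂ) * Complex.I) with hS
  suffices hmain : ‖S‖ ^ 2 ≤ 1416 * N * w ^ 2 by
    refine le_of_sq_le_sq ?_ (by positivity)
    rw [mul_pow, mul_pow, Real.sq_sqrt hN0.le]
    nlinarith [mul_pos hN0 (pow_pos hw0 2)]
  rcases le_or_gt (N : ℝ) (w ^ 2) with hsmall | hlarge
  · have h1 : ‖S‖ ≤ N := by
      refine (norm_sum_le _ _).trans ?_
      rw [Finset.sum_congr rfl (g := fun _ => (1 : ℝ)) (fun n hn => hz n (by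
        rw [Finset.mem_Ico] at hn; lia))]
      simp only [Finset.sum_const, Nat.card_Ico, nsmul_eq_mul, mul_one]
      exact_mod_cast (show b - a ≤ N by lia)
    calc ‖S‖ ^ 2 ≤ N ^ 2 := by gcongr
      _ ≤ N * w ^ 2 := by rw [sq]; gcongr
      _ ≤ _ := by nlinarith [mul_pos hN0 (pow_pos hw0 2)]
  · set H := ⌈N / w ^ 2⌉₊ with hH
    have hx1 : 1 < N / w ^ 2 := by rwa [one_lt_div (by positivity)]
    have hH1 : N / w ^ 2 ≤ H := Nat.le_ceil _
    have hH2 : (H : ℝ) ≤ 2 * (N / w ^ 2) := by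
      have := Nat.ceil_lt_add_one (show 0 ≤ N / w ^ 2 by positivity)
      linarith
    have hHpos : (1 : ℝ) < H := lt_of_lt_of_le hx1 hH1
    have hH0 : (0 : ℝ) < H := by linarith
    have hH1' : 1 ≤ H := by
      have : 1 < H := by exact_mod_cast hHpos
      lia
    set m := √(w ^ 6 / (16 * π * N ^ 3)) with hm
    have hlam : 0 < w ^ 6 / (16 * π * N ^ 3) := by positivity
    have hm0 : 0 < m := Real.sqrt_pos.2 hlam
    set s := √(H : ℝ) with hs
    have hs0 : 0 < s := Real.sqrt_pos.2 hH0
    have hs2 : s ^ 2 = H := Real.sq_sqrt hH0.le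
    have hvdc := van_der_corput_inequality
      (fun n : ℕ => if n = 0 then 0 else (n : ℂ) ^ (-((w ^ 6 : ℝ) : ℂ) * Complex.I))
      (fun n => by
        split_ifs with h
        · simp
        · exact (hz n h).le) a b H
    have hS' : ∑ n ∈ Finset.Ico a b,
        (if n = 0 then 0 else (n : ℂ) ^ (-((w ^ 6 : ℝ) : ℂ) * Complex.I)) = S :=
      Finset.sum_congr rfl fun n hn => if_neg (by rw [Finset.mem_Ico] at hn; lia)
    have hR : ∀ k ∈ Finset.Ico 1 H, ‖∑ n ∈ Finset.Ico a (b - k),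
        (if n = 0 then 0 else (n : ℂ) ^ (-((w ^ 6 : ℝ) : ℂ) * Complex.I)) * (starRingEnd ℂ)
        (if n + k = 0 then 0 else ((n + k : ℕ) : ℂ) ^ (-((w ^ 6 : ℝ) : ℂ) * Complex.I))‖ ≤
        80 * N * (s * m) + 10 * (1 / √k) * (1 / m) := by
      intro k hk
      rw [Finset.mem_Ico] at hk
      rw [Finset.sum_congr rfl (g := fun n : ℕ => (n : ℂ) ^ (-((w ^ 6 : ℝ) : ℂ) * Complex.I) *
        (starRingEnd ℂ) (((n + k : ℕ) : ℂ) ^ (-((w ^ 6 : ℝ) : ℂ) * Complex.I))) (fun n hn => by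
          rw [Finset.mem_Ico] at hn
          rw [if_neg (by lia), if_neg (by lia)])]
      refine (norm_correlation_le hN ha hb hk.1 (by positivity)).trans ?_
      gcongr
      exact Real.sqrt_le_sqrt (by exact_mod_cast hk.2.le)
    rw [hS'] at hvdc
    have hsum : ∑ k ∈ Finset.Ico 1 H, (80 * N * (s * m) + 10 * (1 / √(k : ℝ)) * (1 / m)) ≤
        80 * N * (s * m) * H + 20 * s * (1 / m) := by
      rw [Finset.sum_add_distrib, Finset.sum_const, Nat.card_Ico, nsmul_eq_mul, ← Finset.sum_mul,
        ← Finset.mul_sum]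
      have h1 : ∑ k ∈ Finset.Ico 1 H, 1 / √(k : ℝ) ≤ 2 * s := by
        refine le_trans (Finset.sum_le_sum_of_subset_of_nonneg
          (Finset.Ico_subset_Ico_right (Nat.le_succ H)) fun _ _ _ => by positivity)
          (sum_one_div_sqrt_le H)
      have h2 : ((H - 1 : ℕ) : ℝ) ≤ H := by exact_mod_cast Nat.sub_le H 1
      have h3 : ((H - 1 : ℕ) : ℝ) * (80 * N * (s * m)) ≤ H * (80 * N * (s * m)) := by gcongr
      have h4 : 10 * (∑ k ∈ Finset.Ico 1 H, 1 / √(k : ℝ)) * (1 / m) ≤ 10 * (2 * s) * (1 / m) := by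
        gcongr
      linarith
    have hb' : (b : ℝ) ≤ 2 * N := by exact_mod_cast hb
    have hHN : (H : ℝ) ≤ 2 * N := by
      refine hH2.trans ?_
      gcongr
      exact div_le_self hN0.le (one_le_pow₀ hw)
    have hms : m * s ≤ w ^ 2 / (5 * N) := by
      rw [hm, hs, ← Real.sqrt_mul hlam.le, Real.sqrt_le_left (by positivity)]
      calc w ^ 6 / (16 * π * N ^ 3) * H ≤ w ^ 6 / (16 * π * N ^ 3) * (2 * (N / w ^ 2)) := by gcongr
        _ = w ^ 4 / (8 * π * N ^ 2) := by field_simp; norm_num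
        _ ≤ w ^ 4 / (25 * N ^ 2) := by
          apply div_le_div_of_nonneg_left (by positivity) (by positivity)
          nlinarith [pow_pos hN0 2]
        _ = _ := by field_simp; norm_num
    have hms' : w ^ 2 / (8 * N) ≤ m * s := by
      rw [hm, hs, ← Real.sqrt_mul hlam.le]
      apply Real.le_sqrt_of_sq_le
      calc (w ^ 2 / (8 * N)) ^ 2 = w ^ 4 / (64 * N ^ 2) := by field_simp; norm_num
        _ ≤ w ^ 4 / (16 * π * N ^ 2) := by
          apply div_le_div_of_nonneg_left (by positivity) (by positivity)
          nlinarith [pow_pos hN0 2]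
        _ = w ^ 6 / (16 * π * N ^ 3) * (N / w ^ 2) := by field_simp
        _ ≤ _ := by gcongr
    have hinv : s * (1 / m) * w ^ 2 ≤ 8 * N * H := by
      rw [div_le_iff₀ (by positivity)] at hms'
      have : s * (1 / m) * (m * s * (8 * N)) = 8 * N * H := by rw [← hs2]; field_simp
      rw [← this]
      gcongr
    have hmain : H * ‖S‖ ^ 2 ≤
        (4 * N) * (2 * N + 2 * (80 * N * (s * m) * H + 20 * s * (1 / m))) := by
      refine hvdc.trans ?_
      refine mul_le_mul (by linarith) ?_ (by positivity) (by positivity)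
      have := (Finset.sum_le_sum hR).trans hsum
      linarith
    have hNH : (N : ℝ) ≤ H * w ^ 2 := by rwa [div_le_iff₀ (by positivity)] at hH1
    have hA : 80 * N * (s * m) * H ≤ 16 * w ^ 2 * H := by
      have : 80 * N * (w ^ 2 / (5 * N)) = 16 * w ^ 2 := by field_simp; norm_num
      rw [← this, mul_comm s m]
      gcongr
    have hB : (4 * N) * (20 * s * (1 / m)) ≤ 640 * N * w ^ 2 * H := by
      have h1 : (4 * N) * (20 * s * (1 / m)) * w ^ 2 ≤ (640 * N * w ^ 2 * H) * w ^ 2 := by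
        calc (4 * N) * (20 * s * (1 / m)) * w ^ 2 = 80 * (N : ℝ) * (s * (1 / m) * w ^ 2) := by
              ring
          _ ≤ 80 * (N : ℝ) * (8 * N * H) := by gcongr
          _ = 640 * (N : ℝ) * H * N := by ring
          _ ≤ 640 * (N : ℝ) * H * w ^ 4 := by gcongr
          _ = _ := by ring
      exact le_of_mul_le_mul_right h1 (by positivity)
    have hfin : H * ‖S‖ ^ 2 ≤ H * (1416 * N * w ^ 2) := by
      have h1 : (4 * N) * (80 * N * (s * m) * H) ≤ 4 * N * (16 * w ^ 2 * H) := by gcongr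
      have h2 : (N : ℝ) * N ≤ N * (H * w ^ 2) := by gcongr
      nlinarith
    exact le_of_mul_le_mul_left hfin hH0

end ThirdDerivative

section ZetaApproximation

/-- `(s - 1)` times the `n`-th Euler–Maclaurin remainder of `∑ n^{-s}`. -/
noncomputable def zetaRem (n : ℕ) (s : ℂ) : ℂ :=
  (s - 1) * (n : ℂ) ^ (-s) + ((n + 1 : ℕ) : ℂ) ^ (1 - s) - (n : ℂ) ^ (1 - s)

lemma hasDerivAt_ofReal_cpow_neg {x : ℝ} (hx : 0 < x) (s : ℂ) :
    HasDerivAt (fun y : ℝ => (y : ℂ) ^ s) (s * (x : ℂ) ^ (s - 1)) x := by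
  have h := (hasDerivAt_id (x : ℂ)).cpow_const (c := s) (Or.inl (by simpa using hx))
  have := h.comp_ofReal
  simpa using this

lemma norm_zetaRem_le {n : ℕ} (hn : 1 ≤ n) {s : ℂ} (hs : 0 < s.re) :
    ‖zetaRem n s‖ ≤ ‖s - 1‖ * ‖s‖ * (n : ℝ) ^ (-s.re - 1) := by
  have hn' : (0 : ℝ) < n := by exact_mod_cast hn
  have h1 : ∀ x ∈ Set.Icc (n : ℝ) (n + 1), ‖(n : ℂ) ^ (-s) - (x : ℂ) ^ (-s)‖ ≤
      ‖s‖ * (n : ℝ) ^ (-s.re - 1) := by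
    intro x hx
    have := norm_image_sub_le_of_norm_deriv_le_segment' (f := fun y : ℝ => (y : ℂ) ^ (-s))
      (f' := fun y : ℝ => -s * (y : ℂ) ^ (-s - 1)) (C := ‖s‖ * (n : ℝ) ^ (-s.re - 1))
      (a := (n : ℝ)) (b := n + 1)
      (fun y hy => (hasDerivAt_ofReal_cpow_neg (hn'.trans_le hy.1) (-s)).hasDerivWithinAt)
      (fun y hy => by
        have hy0 : 0 < y := hn'.trans_le hy.1
        rw [norm_mul, norm_neg, Complex.norm_cpow_eq_rpow_re_of_pos hy0]
        simp only [Complex.sub_re, Complex.neg_re, Complex.one_re]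
        gcongr ‖s‖ * ?_
        exact Real.rpow_le_rpow_of_nonpos hn' hy.1 (by linarith)) x hx
    rw [norm_sub_rev]
    refine this.trans ?_
    have h0 : 0 ≤ ‖s‖ * (n : ℝ) ^ (-s.re - 1) := by positivity
    exact mul_le_of_le_one_right h0 (by linarith [hx.2])
  have := norm_image_sub_le_of_norm_deriv_le_segment'
    (f := fun y : ℝ => (s - 1) * (n : ℂ) ^ (-s) * ((y : ℂ) - n) + (y : ℂ) ^ (1 - s))
    (f' := fun y : ℝ => (s - 1) * ((n : ℂ) ^ (-s) - (y : ℂ) ^ (-s)))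
    (C := ‖s - 1‖ * (‖s‖ * (n : ℝ) ^ (-s.re - 1))) (a := (n : ℝ)) (b := n + 1)
    (fun y hy => by
      have h2 := hasDerivAt_ofReal_cpow_neg (hn'.trans_le hy.1) (1 - s)
      have h3 : HasDerivAt (fun y : ℝ => ((y : ℂ) - n)) 1 y :=
        ((hasDerivAt_id (y : ℂ)).comp_ofReal).sub_const _
      have h4 := ((h3.const_mul ((s - 1) * (n : ℂ) ^ (-s))).add h2).hasDerivWithinAt
        (s := Set.Icc (n : ℝ) (n + 1))
      refine h4.congr_deriv ?_
      rw [show (1 : ℂ) - s - 1 = -s by ring]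
      ring)
    (fun y hy => by
      rw [norm_mul]
      gcongr
      exact h1 y ⟨hy.1, hy.2.le⟩) (n + 1) (by simp)
  rw [add_sub_cancel_left, mul_one, ← mul_assoc] at this
  refine le_trans (le_of_eq ?_) this
  rw [zetaRem]
  congr 1
  push_cast
  ring

lemma rpow_neg_three_halves_le {n : ℕ} (hn : 1 ≤ n) :
    (n : ℝ) ^ (-(3 / 2) : ℝ) ≤ 6 * (1 / √n - 1 / √(n + 1)) := by
  have hn' : (1 : ℝ) ≤ n := by exact_mod_cast hn
  have hn0 : (0 : ℝ) < n := by linarith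
  set u := √(n : ℝ) with hu
  set v := √((n : ℝ) + 1) with hv
  have hu0 : 0 < u := Real.sqrt_pos.2 hn0
  have hv0 : 0 < v := Real.sqrt_pos.2 (by linarith)
  have hu2 : u * u = n := Real.mul_self_sqrt hn0.le
  have hv2 : v * v = n + 1 := Real.mul_self_sqrt (by linarith)
  have huv : u ≤ v := Real.sqrt_le_sqrt (by linarith)
  have hv3 : 2 * v ≤ 3 * u := by nlinarith
  have e : (n : ℝ) ^ (-(3 / 2) : ℝ) = 1 / (u * u * u) := by
    rw [Real.rpow_neg hn0.le, show (3 / 2 : ℝ) = 1 + 1 / 2 by norm_num, Real.rpow_add hn0,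
      Real.rpow_one, ← Real.sqrt_eq_rpow, hu2, one_div]
  have e2 : 1 / u - 1 / v = 1 / (u * v * (u + v)) := by
    rw [div_sub_div _ _ hu0.ne' hv0.ne', div_eq_div_iff (by positivity) (by positivity)]
    linear_combination u * v * hv2 - u * v * hu2
  rw [e, e2, mul_one_div, div_le_div_iff₀ (by positivity) (by positivity), one_mul]
  have h1 : u * v * (u + v) ≤ u * (3 / 2 * u) * (u + 3 / 2 * u) := by gcongr <;> linarith
  nlinarith [pow_pos hu0 3]

lemma hasSum_telescope {N : ℕ} (hN : 1 ≤ N) : HasSum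
    (fun i : ℕ => 6 * (1 / √((i + N : ℕ) : ℝ) - 1 / √(((i + N : ℕ) : ℝ) + 1))) (6 * (1 / √N)) := by
  refine HasSum.mul_left 6 ?_
  rw [hasSum_iff_tendsto_nat_of_nonneg]
  · have e : ∀ M : ℕ, ∑ i ∈ Finset.range M, (1 / √((i + N : ℕ) : ℝ) -
        1 / √(((i + N : ℕ) : ℝ) + 1)) = 1 / √N - 1 / √((M + N : ℕ) : ℝ) := by
      intro M
      have := Finset.sum_range_sub' (fun i : ℕ => 1 / √((i + N : ℕ) : ℝ)) M
      rw [zero_add] at this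
      rw [← this]
      refine Finset.sum_congr rfl fun i _ => ?_
      push_cast
      rw [show (i : ℝ) + 1 + N = i + N + 1 by ring]
    simp only [e]
    have h1 : Filter.Tendsto (fun M : ℕ => 1 / √((M + N : ℕ) : ℝ)) Filter.atTop (nhds 0) := by
      have h2 : Filter.Tendsto (fun M : ℕ => ((M + N : ℕ) : ℝ)) Filter.atTop Filter.atTop :=
        tendsto_natCast_atTop_atTop.comp (Filter.tendsto_add_atTop_nat N)
      exact (tendsto_const_nhds (x := (1 : ℝ))).div_atTop (Real.tendsto_sqrt_atTop.comp h2)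
    simpa using h1.const_sub (1 / √(N : ℝ))
  · intro i
    rw [sub_nonneg]
    have : (0 : ℝ) < (i + N : ℕ) := by exact_mod_cast (by lia : 0 < i + N)
    exact one_div_le_one_div_of_le (Real.sqrt_pos.2 this) (Real.sqrt_le_sqrt (by linarith))

lemma norm_zetaRem_le_telescope {N i : ℕ} (hN : 1 ≤ N) {s : ℂ} (hs : 1 / 2 ≤ s.re) :
    ‖zetaRem (i + N) s‖ ≤ ‖s - 1‖ * ‖s‖ * (N : ℝ) ^ (1 / 2 - s.re) *
      (6 * (1 / √((i + N : ℕ) : ℝ) - 1 / √(((i + N : ℕ) : ℝ) + 1))) := by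
  refine (norm_zetaRem_le (by lia) (by linarith)).trans ?_
  rw [mul_assoc (‖s - 1‖ * ‖s‖)]
  have hN' : (0 : ℝ) < N := by exact_mod_cast hN
  have hi : (0 : ℝ) < (i + N : ℕ) := by exact_mod_cast (by lia : 0 < i + N)
  gcongr
  rw [show -s.re - 1 = (1 / 2 - s.re) + (-(3 / 2)) by ring, Real.rpow_add hi]
  exact mul_le_mul
    (Real.rpow_le_rpow_of_nonpos hN' (by exact_mod_cast Nat.le_add_left N i) (by linarith))
    (rpow_neg_three_halves_le (by lia)) (by positivity) (by positivity)

lemma sum_range_zetaRem (N M : ℕ) (s : ℂ) : ∑ i ∈ Finset.range M, zetaRem (i + N) s =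
    (s - 1) * ∑ i ∈ Finset.range M, ((i + N : ℕ) : ℂ) ^ (-s) + ((M + N : ℕ) : ℂ) ^ (1 - s) -
      (N : ℂ) ^ (1 - s) := by
  induction M with
  | zero => simp
  | succ M ih =>
    rw [Finset.sum_range_succ, Finset.sum_range_succ, ih, zetaRem,
      show M + N + 1 = M + 1 + N by ring]
    ring

lemma differentiable_zetaRem {n : ℕ} (hn : 1 ≤ n) : Differentiable ℂ (zetaRem n) := by
  have h : (n : ℂ) ≠ 0 := by exact_mod_cast (by lia)
  have h' : ((n + 1 : ℕ) : ℂ) ≠ 0 := by exact_mod_cast (by lia)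
  unfold zetaRem
  intro s
  refine ((DifferentiableAt.mul (by fun_prop) ?_).add ?_).sub ?_
  · exact DifferentiableAt.const_cpow (by fun_prop) (Or.inl h)
  · exact DifferentiableAt.const_cpow (by fun_prop) (Or.inl h')
  · exact DifferentiableAt.const_cpow (by fun_prop) (Or.inl h)

lemma riemannZeta₁_eq_of_one_lt {N : ℕ} (hN : 1 ≤ N) {s : ℂ} (hs : 1 < s.re) :
    riemannZeta₁ s = (s - 1) * ∑ n ∈ Finset.Ico 1 N, (n : ℂ) ^ (-s) + (N : ℂ) ^ (1 - s) +
      ∑' i : ℕ, zetaRem (i + N) s := by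
  have hs1 : s ≠ 1 := by rintro rfl; simp at hs
  have hsum : Summable fun i : ℕ => zetaRem (i + N) s :=
    Summable.of_norm_bounded ((hasSum_telescope hN).summable.mul_left _)
      (fun i => norm_zetaRem_le_telescope hN (by linarith))
  have hz : Summable fun n : ℕ => (n : ℂ) ^ (-s) := by
    simpa [Complex.cpow_neg] using Complex.summable_one_div_nat_cpow.2 hs
  have hzN : Summable fun i : ℕ => ((i + N : ℕ) : ℂ) ^ (-s) := (summable_nat_add_iff N).2 hz
  have hlim0 : Filter.Tendsto (fun M : ℕ => ((M + N : ℕ) : ℂ) ^ (1 - s)) Filter.atTop (nhds 0) := by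
    rw [tendsto_zero_iff_norm_tendsto_zero]
    have h2 : Filter.Tendsto (fun M : ℕ => ((M + N : ℕ) : ℝ)) Filter.atTop Filter.atTop :=
      tendsto_natCast_atTop_atTop.comp (Filter.tendsto_add_atTop_nat N)
    refine ((tendsto_rpow_neg_atTop (y := s.re - 1) (by linarith)).comp h2).congr fun M => ?_
    rw [Complex.norm_natCast_cpow_of_pos (by lia)]
    simp
  have hlim : Filter.Tendsto (fun M : ℕ => ∑ i ∈ Finset.range M, zetaRem (i + N) s) Filter.atTop
      (nhds ((s - 1) * ∑' i : ℕ, ((i + N : ℕ) : ℂ) ^ (-s) + 0 - (N : ℂ) ^ (1 - s))) := by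
    simp only [sum_range_zetaRem]
    exact (((hzN.hasSum.tendsto_sum_nat).const_mul _).add hlim0).sub_const _
  rw [tendsto_nhds_unique hsum.hasSum.tendsto_sum_nat hlim]
  have hzeta : riemannZeta s = ∑ n ∈ Finset.Ico 1 N, (n : ℂ) ^ (-s) +
      ∑' i : ℕ, ((i + N : ℕ) : ℂ) ^ (-s) := by
    rw [zeta_eq_tsum_one_div_nat_cpow hs]
    have e : (fun n : ℕ => 1 / (n : ℂ) ^ s) = fun n : ℕ => (n : ℂ) ^ (-s) := by
      ext n; rw [Complex.cpow_neg, one_div]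
    have h0 : s ≠ 0 := by rintro rfl; norm_num at hs
    rw [e, ← hz.sum_add_tsum_nat_add N, Finset.range_eq_Ico,
      Finset.sum_eq_sum_Ico_succ_bot (by lia)]
    simp [Complex.zero_cpow (neg_ne_zero.2 h0)]
  have h1 := riemannZeta_eq_inv_sub_mul hs1
  have h2 : riemannZeta₁ s = (s - 1) * riemannZeta s := by
    rw [h1, mul_inv_cancel_left₀ (sub_ne_zero.2 hs1)]
  rw [h2, hzeta]
  ring

lemma riemannZeta₁_eq {N : ℕ} (hN : 1 ≤ N) {s : ℂ} (hs : 0 < s.re) :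
    riemannZeta₁ s = (s - 1) * ∑ n ∈ Finset.Ico 1 N, (n : ℂ) ^ (-s) + (N : ℂ) ^ (1 - s) +
      ∑' i : ℕ, zetaRem (i + N) s := by
  set δ := min (s.re / 2) 1 with hδ
  have hδ0 : 0 < δ := by positivity
  set U : Set ℂ := {z | δ < z.re} ∩ Metric.ball 0 (‖s‖ + 3) with hU
  have hUo : IsOpen U := (isOpen_lt continuous_const Complex.continuous_re).inter Metric.isOpen_ball
  have hUc : Convex ℝ U := (convex_halfSpace_re_gt δ).inter (convex_ball _ _)
  have hsU : s ∈ U := by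
    refine ⟨?_, by simp⟩
    have := min_le_left (s.re / 2) 1
    change δ < s.re
    linarith
  have h2U : (2 : ℂ) ∈ U := by
    refine ⟨?_, by simp; linarith [norm_nonneg s]⟩
    have := min_le_right (s.re / 2) 1
    change δ < (2 : ℂ).re
    simp only [Complex.re_ofNat]
    linarith
  have hN0 : (N : ℂ) ≠ 0 := by exact_mod_cast (by lia)
  have hdR : DifferentiableOn ℂ (fun z => (z - 1) * ∑ n ∈ Finset.Ico 1 N, (n : ℂ) ^ (-z) +
      (N : ℂ) ^ (1 - z) + ∑' i : ℕ, zetaRem (i + N) z) U := by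
    refine DifferentiableOn.add (DifferentiableOn.add (DifferentiableOn.mul (by fun_prop) ?_) ?_) ?_
    · refine DifferentiableOn.fun_sum fun n hn z _ => DifferentiableAt.differentiableWithinAt ?_
      rw [Finset.mem_Ico] at hn
      exact DifferentiableAt.const_cpow (by fun_prop) (Or.inl (by exact_mod_cast (by lia)))
    · exact fun z _ =>
        (DifferentiableAt.const_cpow (by fun_prop) (Or.inl hN0)).differentiableWithinAt
    · refine Complex.differentiableOn_tsum_of_summable_norm (u := fun i : ℕ =>
        (‖s‖ + 4) * (‖s‖ + 3) * ((i + N : ℕ) : ℝ) ^ (-δ - 1)) ?_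
        (fun i => (differentiable_zetaRem (by lia)).differentiableOn) hUo ?_
      · refine Summable.mul_left _ ?_
        exact (summable_nat_add_iff N).2 (Real.summable_nat_rpow.2 (by linarith))
      · intro i z hz
        have hz1 : δ < z.re := hz.1
        have hz2 : ‖z‖ < ‖s‖ + 3 := by simpa using hz.2
        refine (norm_zetaRem_le (by lia) (hδ0.trans hz1)).trans ?_
        gcongr
        · refine (norm_sub_le _ _).trans ?_
          simp only [norm_one]; linarith
        · exact_mod_cast (by lia : 1 ≤ i + N)
  have hA := differentiable_riemannZeta₁.differentiableOn (s := U) |>.analyticOnNhd hUo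
  have hB := hdR.analyticOnNhd hUo
  refine hA.eqOn_of_preconnected_of_eventuallyEq hB hUc.isPreconnected h2U ?_ hsU
  have h1 : ∀ᶠ z : ℂ in nhds 2, 1 < z.re :=
    (isOpen_lt continuous_const Complex.continuous_re).mem_nhds (by simp)
  filter_upwards [h1] with z hz
  exact riemannZeta₁_eq_of_one_lt hN hz

/-- The simplest approximation to `ζ`. -/
lemma norm_riemannZeta_sub_le {N : ℕ} (hN : 1 ≤ N) {s : ℂ} (hs : 1 / 2 ≤ s.re) (hs1 : s ≠ 1) :
    ‖riemannZeta s - ∑ n ∈ Finset.Ico 1 N, (n : ℂ) ^ (-s)‖ ≤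
      (N : ℝ) ^ (1 - s.re) / ‖s - 1‖ + 6 * ‖s‖ * (N : ℝ) ^ (-s.re) := by
  have hN' : (0 : ℝ) < N := by exact_mod_cast hN
  have hne : s - 1 ≠ 0 := sub_ne_zero.2 hs1
  have hpos : 0 < ‖s - 1‖ := norm_pos_iff.2 hne
  have h := riemannZeta₁_eq hN (s := s) (by linarith)
  have e : riemannZeta s - ∑ n ∈ Finset.Ico 1 N, (n : ℂ) ^ (-s) =
      (N : ℂ) ^ (1 - s) / (s - 1) + (∑' i : ℕ, zetaRem (i + N) s) / (s - 1) := by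
    rw [riemannZeta_eq_inv_sub_mul hs1, h]
    field_simp
    ring
  rw [e]
  refine (norm_add_le _ _).trans (add_le_add (le_of_eq ?_) ?_)
  · rw [norm_div, Complex.norm_natCast_cpow_of_pos (by lia)]
    simp
  · rw [norm_div, div_le_iff₀ hpos]
    have := tsum_of_norm_bounded ((hasSum_telescope hN).mul_left _)
      (fun i => norm_zetaRem_le_telescope (i := i) hN hs)
    refine this.trans (le_of_eq ?_)
    have e2 : (N : ℝ) ^ (-s.re) = (N : ℝ) ^ (1 / 2 - s.re) * (1 / √N) := by
      rw [Real.sqrt_eq_rpow, one_div (_ ^ _), ← Real.rpow_neg hN'.le, ← Real.rpow_add hN']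
      congr 1; ring
    rw [e2]
    ring

end ZetaApproximation

section DyadicBlocks

lemma norm_sum_antitone_mul_le (w : ℕ → ℝ) (z : ℕ → ℂ) {a b : ℕ} {M : ℝ} (hab : a ≤ b)
    (hw : ∀ n, a ≤ n → w (n + 1) ≤ w n) (h0 : ∀ n, a ≤ n → 0 ≤ w n)
    (hM : ∀ m, m ≤ b → ‖∑ n ∈ Finset.Ico a m, z n‖ ≤ M) :
    ‖∑ n ∈ Finset.Ico a b, (w n : ℂ) * z n‖ ≤ w a * M := by
  have key : ∀ m, a ≤ m → ∑ n ∈ Finset.Ico a m, (w n : ℂ) * z n =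
      (w m : ℂ) * ∑ n ∈ Finset.Ico a m, z n +
        ∑ n ∈ Finset.Ico a m, ((w n - w (n + 1) : ℝ) : ℂ) * ∑ k ∈ Finset.Ico a (n + 1), z k := by
    intro m hm
    induction m, hm using Nat.le_induction with
    | base => simp
    | succ m hm ih =>
      rw [Finset.sum_Ico_succ_top hm, Finset.sum_Ico_succ_top hm, Finset.sum_Ico_succ_top hm, ih,
        Finset.sum_Ico_succ_top hm]
      push_cast
      ring
  have tel : ∀ m, a ≤ m → ∑ n ∈ Finset.Ico a m, (w n - w (n + 1)) = w a - w m := by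
    intro m hm
    induction m, hm using Nat.le_induction with
    | base => simp
    | succ m hm ih => rw [Finset.sum_Ico_succ_top hm, ih]; ring
  rw [key b hab]
  have h1 : ‖(w b : ℂ) * ∑ n ∈ Finset.Ico a b, z n‖ ≤ w b * M := by
    rw [norm_mul, Complex.norm_real, Real.norm_of_nonneg (h0 b hab)]
    exact mul_le_mul_of_nonneg_left (hM b le_rfl) (h0 b hab)
  have h2 : ‖∑ n ∈ Finset.Ico a b, ((w n - w (n + 1) : ℝ) : ℂ) *
      ∑ k ∈ Finset.Ico a (n + 1), z k‖ ≤ (w a - w b) * M := by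
    rw [← tel b hab, Finset.sum_mul]
    refine (norm_sum_le _ _).trans (Finset.sum_le_sum fun n hn => ?_)
    rw [Finset.mem_Ico] at hn
    have h3 := sub_nonneg.2 (hw n hn.1)
    rw [norm_mul, Complex.norm_real, Real.norm_of_nonneg h3]
    exact mul_le_mul_of_nonneg_left (hM _ hn.2) h3
  refine (norm_add_le _ _).trans ((add_le_add h1 h2).trans (le_of_eq ?_))
  ring

/-- The part of `∑ n^{-σ-it}` with `2 ^ j ≤ n < 2 ^ (j + 1)`. -/
noncomputable def dyadicBlock (σ t : ℝ) (j : ℕ) : ℂ :=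
  ∑ n ∈ Finset.Ico ((2 : ℕ) ^ j) (2 ^ (j + 1)),
    (((n : ℝ) ^ (-σ) : ℝ) : ℂ) * (n : ℂ) ^ (-(t : ℂ) * Complex.I)

lemma sum_dyadicBlock (σ t : ℝ) (J : ℕ) : ∑ j ∈ Finset.range J, dyadicBlock σ t j =
    ∑ n ∈ Finset.Ico 1 ((2 : ℕ) ^ J), (n : ℂ) ^ (-((σ : ℂ) + t * Complex.I)) := by
  have h : ∑ j ∈ Finset.range J, dyadicBlock σ t j = ∑ n ∈ Finset.Ico 1 ((2 : ℕ) ^ J),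
      (((n : ℝ) ^ (-σ) : ℝ) : ℂ) * (n : ℂ) ^ (-(t : ℂ) * Complex.I) := by
    induction J with
    | zero => simp
    | succ J ih =>
      rw [Finset.sum_range_succ, ih, dyadicBlock, Finset.sum_Ico_consecutive _ Nat.one_le_two_pow
        (Nat.pow_le_pow_right (by lia) (by lia))]
  rw [h]
  refine Finset.sum_congr rfl fun n hn => ?_
  rw [Finset.mem_Ico] at hn
  have hn0 : (n : ℂ) ≠ 0 := by exact_mod_cast (by lia : n ≠ 0)
  rw [neg_add, Complex.cpow_add _ _ hn0, Complex.ofReal_cpow (by positivity)]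
  push_cast
  rw [neg_mul]

lemma norm_dyadicBlock_le {σ t M : ℝ} {j : ℕ} (hσ : 0 ≤ σ)
    (hM : ∀ b : ℕ, b ≤ 2 * 2 ^ j →
      ‖∑ n ∈ Finset.Ico ((2 : ℕ) ^ j) b, (n : ℂ) ^ (-(t : ℂ) * Complex.I)‖ ≤ M) :
    ‖dyadicBlock σ t j‖ ≤ ((2 : ℝ) ^ j) ^ (-σ) * M := by
  have := norm_sum_antitone_mul_le (fun n : ℕ => (n : ℝ) ^ (-σ))
    (fun n => (n : ℂ) ^ (-(t : ℂ) * Complex.I)) (a := 2 ^ j) (b := 2 ^ (j + 1)) (M := M)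
    (Nat.pow_le_pow_right (by lia) (by lia)) (fun n hn => ?_) (fun n _ => by positivity)
    (fun m hm => hM m (by rw [pow_succ] at hm; lia))
  · simpa [dyadicBlock] using this
  · have : 1 ≤ 2 ^ j := Nat.one_le_two_pow
    exact Real.rpow_le_rpow_of_nonpos (by exact_mod_cast (by lia : 0 < n))
      (by exact_mod_cast Nat.le_succ n) (by linarith)

/-- The zeta function is a sum of dyadic blocks, up to a bounded error. -/
lemma norm_riemannZeta_le_sum_dyadicBlock {σ t : ℝ} {J : ℕ} (hσ : 1 / 2 ≤ σ) (hσ' : σ ≤ 3)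
    (ht : 1 ≤ t) (hJ : t ^ 2 ≤ (2 : ℝ) ^ J) (hJ' : (2 : ℝ) ^ J ≤ 8 * t ^ 2) :
    ‖riemannZeta ((σ : ℂ) + t * Complex.I)‖ ≤
      ∑ j ∈ Finset.range J, ‖dyadicBlock σ t j‖ + 27 := by
  set s : ℂ := (σ : ℂ) + t * Complex.I with hs
  have hre : s.re = σ := by simp [hs]
  have him : s.im = t := by simp [hs]
  have hs1 : s ≠ 1 := by
    intro h
    rw [h] at him
    simp at him
    linarith
  have h := norm_riemannZeta_sub_le (N := 2 ^ J) Nat.one_le_two_pow (s := s) (by rw [hre]; exact hσ)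
    hs1
  rw [← sum_dyadicBlock, hre] at h
  push_cast at h
  have h1 : t ≤ ‖s - 1‖ := by
    have := Complex.abs_im_le_norm (s - 1)
    rw [Complex.sub_im, him, Complex.one_im, sub_zero, abs_of_nonneg (by linarith)] at this
    exact this
  have h2 : ‖s‖ ≤ 4 * t := by
    refine (norm_add_le _ _).trans ?_
    rw [norm_mul, Complex.norm_I, Complex.norm_real, Complex.norm_real, Real.norm_of_nonneg
      (by linarith), Real.norm_of_nonneg (by linarith)]
    linarith
  have h2J : (1 : ℝ) ≤ 2 ^ J := one_le_pow₀ (by norm_num)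
  have h3 : ((2 : ℝ) ^ J) ^ (1 - σ) ≤ 3 * t := by
    calc ((2 : ℝ) ^ J) ^ (1 - σ) ≤ ((2 : ℝ) ^ J) ^ (1 / 2 : ℝ) :=
          Real.rpow_le_rpow_of_exponent_le h2J (by linarith)
      _ ≤ (9 * t ^ 2) ^ (1 / 2 : ℝ) := by gcongr; nlinarith
      _ = 3 * t := by
          rw [← Real.sqrt_eq_rpow, show 9 * t ^ 2 = (3 * t) ^ 2 by ring,
            Real.sqrt_sq (by linarith)]
  have h4 : ((2 : ℝ) ^ J) ^ (-σ) ≤ 1 / t := by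
    calc ((2 : ℝ) ^ J) ^ (-σ) ≤ ((2 : ℝ) ^ J) ^ (-(1 / 2) : ℝ) :=
          Real.rpow_le_rpow_of_exponent_le h2J (by linarith)
      _ ≤ (t ^ 2) ^ (-(1 / 2) : ℝ) :=
          Real.rpow_le_rpow_of_nonpos (by positivity) hJ (by norm_num)
      _ = 1 / t := by
          rw [Real.rpow_neg (by positivity), ← Real.sqrt_eq_rpow, Real.sqrt_sq (by linarith),
            one_div]
  have h5 : ((2 : ℝ) ^ J) ^ (1 - σ) / ‖s - 1‖ ≤ 3 := by
    rw [div_le_iff₀ (by linarith)]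
    linarith
  have h6 : 6 * ‖s‖ * ((2 : ℝ) ^ J) ^ (-σ) ≤ 24 := by
    calc 6 * ‖s‖ * ((2 : ℝ) ^ J) ^ (-σ) ≤ 6 * (4 * t) * (1 / t) := by gcongr
      _ = 24 := by field_simp; norm_num
  have h7 := norm_sum_le (Finset.range J) (dyadicBlock σ t)
  have h8 : ‖riemannZeta s‖ ≤ ‖riemannZeta s - ∑ j ∈ Finset.range J, dyadicBlock σ t j‖ +
      ‖∑ j ∈ Finset.range J, dyadicBlock σ t j‖ := by
    refine le_trans (le_of_eq ?_) (norm_add_le _ _)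
    rw [sub_add_cancel]
  linarith

lemma norm_dyadicBlock_le_of_large {σ t : ℝ} {j : ℕ} (hσ : 0 ≤ σ) (ht : 0 < t)
    (hj : t ≤ (2 : ℝ) ^ j) :
    ‖dyadicBlock σ t j‖ ≤ ((2 : ℝ) ^ j) ^ (-σ) * (32 * ((2 : ℝ) ^ j / t)) := by
  refine norm_dyadicBlock_le hσ fun b hb => ?_
  have := norm_sum_cpow_le_of_le (N := 2 ^ j) (a := 2 ^ j) (b := b) Nat.one_le_two_pow le_rfl hb ht
    (by exact_mod_cast hj)
  exact_mod_cast this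

lemma norm_dyadicBlock_le_sqrt {σ t : ℝ} {j : ℕ} (hσ : 0 ≤ σ) (ht : 0 < t) :
    ‖dyadicBlock σ t j‖ ≤ ((2 : ℝ) ^ j) ^ (-σ) * (60 * (√t + (2 : ℝ) ^ j / √t)) := by
  refine norm_dyadicBlock_le hσ fun b hb => ?_
  have := norm_sum_cpow_le (N := 2 ^ j) (a := 2 ^ j) (b := b) Nat.one_le_two_pow le_rfl hb ht
  exact_mod_cast this

lemma norm_dyadicBlock_le_of_small {σ w : ℝ} {j : ℕ} (hσ : 0 ≤ σ) (hw : 1 ≤ w)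
    (hj : (2 : ℝ) ^ j ≤ w ^ 4) :
    ‖dyadicBlock σ (w ^ 6) j‖ ≤ ((2 : ℝ) ^ j) ^ (-σ) * (38 * (√((2 : ℝ) ^ j) * w)) := by
  refine norm_dyadicBlock_le hσ fun b hb => ?_
  have := norm_sum_cpow_le_sqrt (N := 2 ^ j) (a := 2 ^ j) (b := b) Nat.one_le_two_pow le_rfl hb hw
    (by exact_mod_cast hj)
  exact_mod_cast this

lemma exists_dyadic_length {x : ℝ} (hx : 1 ≤ x) :
    ∃ J : ℕ, x ≤ (2 : ℝ) ^ J ∧ (2 : ℝ) ^ J ≤ 2 * x ∧ (J : ℝ) ≤ 2 * Real.log x + 1 := by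
  obtain ⟨n, h1, h2⟩ := exists_nat_pow_near hx (y := (2 : ℝ)) (by norm_num)
  refine ⟨n + 1, h2.le, by rw [pow_succ]; linarith, ?_⟩
  have h3 := Real.log_le_log (by positivity) h1
  rw [Real.log_pow] at h3
  have h4 := Real.log_two_gt_d9
  push_cast
  nlinarith [(Nat.cast_nonneg n : (0 : ℝ) ≤ n)]

/-- All dyadic blocks at `t = w ^ 6` are `O(w)` on and to the right of the critical line. -/
lemma norm_dyadicBlock_le_sixth_root {σ w : ℝ} {j : ℕ} (hσ : 1 / 2 ≤ σ) (hw : 1 ≤ w)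
    (hj : (2 : ℝ) ^ j ≤ 2 * (w ^ 6) ^ 2) : ‖dyadicBlock σ (w ^ 6) j‖ ≤ 120 * w := by
  have hw0 : 0 < w := by linarith
  have h2j : (1 : ℝ) ≤ 2 ^ j := one_le_pow₀ (by norm_num)
  set N : ℝ := (2 : ℝ) ^ j with hN
  have hN0 : 0 < N := by linarith
  set r := √N with hr
  have hr0 : 0 < r := Real.sqrt_pos.2 hN0
  have hr2 : r ^ 2 = N := Real.sq_sqrt hN0.le
  have hNσ : N ^ (-σ) ≤ 1 / r := by
    refine (Real.rpow_le_rpow_of_exponent_le h2j (neg_le_neg hσ)).trans (le_of_eq ?_)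
    rw [Real.rpow_neg hN0.le, ← Real.sqrt_eq_rpow, one_div]
  rcases le_or_gt N (w ^ 4) with h1 | h1
  · refine (norm_dyadicBlock_le_of_small (by linarith) hw h1).trans ?_
    calc N ^ (-σ) * (38 * (r * w)) ≤ (1 / r) * (38 * (r * w)) := by gcongr
      _ = 38 * w := by field_simp
      _ ≤ 120 * w := by linarith
  · have hrw : w ^ 2 ≤ r := Real.le_sqrt_of_sq_le (by rw [← pow_mul]; exact h1.le)
    rcases le_or_gt N (w ^ 6) with h2 | h2
    · refine (norm_dyadicBlock_le_sqrt (by linarith) (by positivity)).trans ?_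
      have e : √(w ^ 6) = w ^ 3 := by
        rw [show w ^ 6 = (w ^ 3) ^ 2 by ring, Real.sqrt_sq (by positivity)]
      rw [e]
      have hrw3 : r ≤ w ^ 3 := by
        rw [hr, Real.sqrt_le_left (by positivity)]
        linarith [show (w ^ 3) ^ 2 = w ^ 6 by ring]
      calc N ^ (-σ) * (60 * (w ^ 3 + N / w ^ 3)) ≤ (1 / r) * (60 * (w ^ 3 + N / w ^ 3)) := by gcongr
        _ = 60 * (w ^ 3 / r + r / w ^ 3) := by rw [← hr2]; field_simp
        _ ≤ 60 * (w ^ 3 / w ^ 2 + w ^ 3 / w ^ 3) := by gcongr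
        _ = 60 * (w + 1) := by field_simp
        _ ≤ 120 * w := by linarith
    · refine (norm_dyadicBlock_le_of_large (by linarith) (by positivity) h2.le).trans ?_
      have hr3 : r ≤ 2 * w ^ 6 := by
        rw [hr, Real.sqrt_le_left (by positivity)]
        nlinarith [pow_pos hw0 6]
      calc N ^ (-σ) * (32 * (N / w ^ 6)) ≤ (1 / r) * (32 * (N / w ^ 6)) := by gcongr
        _ = 32 * (r / w ^ 6) := by rw [← hr2]; field_simp
        _ ≤ 32 * (2 * w ^ 6 / w ^ 6) := by gcongr
        _ = 64 := by field_simp; norm_num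
        _ ≤ 120 * w := by linarith

lemma log_le_const_mul_rpow {ε : ℝ} (hε : 0 < ε) {x : ℝ} (hx : 1 ≤ x) :
    1 + Real.log x ≤ (1 + 1 / ε) * x ^ ε := by
  have h1 := Real.log_le_rpow_div (by linarith : (0 : ℝ) ≤ x) hε
  have h2 := Real.one_le_rpow hx hε.le
  have e : (1 + 1 / ε) * x ^ ε = x ^ ε + x ^ ε / ε := by ring
  rw [e]
  linarith

/-- A subconvex bound for `ζ` in the right half of the critical strip. -/
lemma norm_riemannZeta_le_rpow : ∃ K : ℝ, 0 < K ∧ ∀ σ t : ℝ, 1 / 2 ≤ σ → σ ≤ 3 → 1 ≤ t →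
    ‖riemannZeta ((σ : ℂ) + t * Complex.I)‖ ≤ K * t ^ (17 / 100 : ℝ) := by
  refine ⟨(120 * 4 * (1 + 1 / (1 / 300)) + 27), by norm_num, fun σ t hσ hσ' ht => ?_⟩
  have ht0 : 0 < t := by linarith
  set w := t ^ (1 / 6 : ℝ) with hw
  have hw1 : 1 ≤ w := Real.one_le_rpow ht (by norm_num)
  have hw6 : w ^ 6 = t := by
    rw [hw, ← Real.rpow_natCast, ← Real.rpow_mul ht0.le]
    norm_num
  obtain ⟨J, hJ1, hJ2, hJ3⟩ := exists_dyadic_length (x := t ^ 2) (one_le_pow₀ ht)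
  have h := norm_riemannZeta_le_sum_dyadicBlock hσ hσ' ht hJ1 (by nlinarith)
  have h2 : ∑ j ∈ Finset.range J, ‖dyadicBlock σ t j‖ ≤ J * (120 * w) := by
    refine (Finset.sum_le_card_nsmul _ _ (120 * w) fun j hj => ?_).trans (by simp)
    rw [← hw6]
    refine norm_dyadicBlock_le_sixth_root hσ hw1 ?_
    rw [hw6]
    exact (pow_le_pow_right₀ (by norm_num) (Finset.mem_range.1 hj).le).trans hJ2
  rw [Real.log_pow] at hJ3
  have hJ4 : (J : ℝ) ≤ 4 * (1 + Real.log t) := by push_cast at hJ3; linarith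
  have hlog := log_le_const_mul_rpow (ε := 1 / 300) (by norm_num) ht
  have hpow : t ^ (1 / 300 : ℝ) * w = t ^ (17 / 100 : ℝ) := by
    rw [hw, ← Real.rpow_add ht0]; norm_num
  have h1 : 1 ≤ t ^ (17 / 100 : ℝ) := Real.one_le_rpow ht (by norm_num)
  calc ‖riemannZeta ((σ : ℂ) + t * Complex.I)‖ ≤ J * (120 * w) + 27 := by linarith
    _ ≤ (4 * ((1 + 1 / (1 / 300)) * t ^ (1 / 300 : ℝ))) * (120 * w) + 27 * t ^ (17 / 100 : ℝ) := by
        gcongr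
        · linarith
        · linarith
    _ = _ := by rw [← hpow]; ring

end DyadicBlocks

section ContourShift

open Filter Topology

/-- Moving a vertical line of integration across a strip of holomorphy. -/
lemma tendsto_integral_vertical_sub {f : ℂ → ℂ} {a b : ℝ} (hab : a ≤ b)
    (hd : DifferentiableOn ℂ f {z | a ≤ z.re ∧ z.re ≤ b})
    (hh : ∀ ε > 0, ∃ R₀ : ℝ, ∀ v : ℝ, R₀ ≤ |v| → ∀ x ∈ Set.Icc a b,
      ‖f ((x : ℂ) + v * Complex.I)‖ ≤ ε) :
    Tendsto (fun R : ℝ => ∫ v in -R..R, (f ((b : ℂ) + v * Complex.I) - f ((a : ℂ) + v * Complex.I)))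
      atTop (𝓝 0) := by
  have hcont : ∀ x ∈ Set.Icc a b, Continuous fun v : ℝ => f ((x : ℂ) + v * Complex.I) := by
    intro x hx
    exact hd.continuousOn.comp_continuous (by fun_prop) fun v => by simpa using hx
  have ha : a ∈ Set.Icc a b := Set.left_mem_Icc.2 hab
  have hb : b ∈ Set.Icc a b := Set.right_mem_Icc.2 hab
  rw [Metric.tendsto_atTop]
  intro ε hε
  obtain ⟨R₀, hR₀⟩ := hh (ε / (4 * (b - a + 1))) (by have := sub_nonneg.2 hab; positivity)
  refine ⟨max R₀ 0, fun R hR => ?_⟩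
  have hR1 : R₀ ≤ R := (le_max_left _ _).trans hR
  have hR2 : 0 ≤ R := (le_max_right _ _).trans hR
  have key := Complex.integral_boundary_rect_eq_zero_of_differentiableOn f
    ((a : ℂ) + (-R : ℝ) * Complex.I) ((b : ℂ) + (R : ℝ) * Complex.I) (hd.mono ?_)
  · simp only [Complex.add_re, Complex.ofReal_re, Complex.mul_re, Complex.I_re, mul_zero,
      Complex.ofReal_im, Complex.I_im, mul_one, sub_self, add_zero, Complex.add_im, Complex.mul_im,
      zero_add] at key
    rw [intervalIntegral.integral_sub ((hcont b hb).intervalIntegrable _ _)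
      ((hcont a ha).intervalIntegrable _ _)]
    set V := (∫ v in -R..R, f ((b : ℂ) + v * Complex.I)) -
      ∫ v in -R..R, f ((a : ℂ) + v * Complex.I) with hV
    have h1 : Complex.I * V = (∫ x in a..b, f ((x : ℂ) + R * Complex.I)) -
        ∫ x in a..b, f ((x : ℂ) + (-R : ℝ) * Complex.I) := by
      simp only [smul_eq_mul] at key
      rw [hV]
      linear_combination key
    have h2 : ∀ v : ℝ, |v| = R → ‖∫ x in a..b, f ((x : ℂ) + v * Complex.I)‖ ≤
        ε / (4 * (b - a + 1)) * |b - a| := by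
      intro v hv
      refine intervalIntegral.norm_integral_le_of_norm_le_const fun x hx => ?_
      rw [Set.uIoc_of_le hab] at hx
      exact hR₀ v (by rw [hv]; exact hR1) x ⟨hx.1.le, hx.2⟩
    have h3 : ‖V‖ ≤ 2 * (ε / (4 * (b - a + 1)) * |b - a|) := by
      have : ‖V‖ = ‖Complex.I * V‖ := by rw [norm_mul, Complex.norm_I, one_mul]
      rw [this, h1]
      refine (norm_sub_le _ _).trans ?_
      have := h2 R (abs_of_nonneg hR2)
      have := h2 (-R) (by rw [abs_neg, abs_of_nonneg hR2])
      linarith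
    rw [dist_zero_right]
    have hba := sub_nonneg.2 hab
    rw [abs_of_nonneg hba] at h3
    refine h3.trans_lt ?_
    rw [← mul_assoc, mul_div_assoc', div_mul_eq_mul_div, div_lt_iff₀ (by positivity)]
    nlinarith
  · intro z hz
    rw [Complex.mem_reProdIm] at hz
    have := hz.1
    simp only [Complex.add_re, Complex.ofReal_re, Complex.mul_re, Complex.I_re, mul_zero,
      Complex.ofReal_im, Complex.I_im, mul_one, sub_self, add_zero] at this
    rwa [Set.uIcc_of_le hab] at this

/-- The Cauchy integral formula for a strip. -/
lemma integral_vertical_div_sub {h : ℂ → ℂ} {C : ℝ} (hd : DifferentiableOn ℂ h {w | w.re < 3 / 2})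
    (hb : ∀ v : ℝ, 1 ≤ |v| → ∀ x ∈ Set.Icc (-1 : ℝ) 1, ‖h ((x : ℂ) + v * Complex.I)‖ ≤ C)
    (h1 : MeasureTheory.Integrable fun v : ℝ => h (1 + v * Complex.I) / (1 + v * Complex.I))
    (h2 : MeasureTheory.Integrable fun v : ℝ => h (-1 + v * Complex.I) / (-1 + v * Complex.I)) :
    (∫ v : ℝ, h (1 + v * Complex.I) / (1 + v * Complex.I)) -
      ∫ v : ℝ, h (-1 + v * Complex.I) / (-1 + v * Complex.I) = 2 * π * h 0 := by
  have hopen : IsOpen {w : ℂ | w.re < 3 / 2} := isOpen_lt Complex.continuous_re continuous_const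
  have hd' : DifferentiableOn ℂ (dslope h 0) {w | w.re < 3 / 2} := by
    rw [Complex.differentiableOn_dslope (hopen.mem_nhds (by simp))]
    exact hd
  have hval : ∀ w : ℂ, w ≠ 0 → dslope h 0 w = h w / w - h 0 / w := by
    intro w hw
    rw [dslope_of_ne _ hw, slope_def_field, sub_zero, sub_div]
  have hne : ∀ x v : ℝ, x ≠ 0 → (x : ℂ) + v * Complex.I ≠ 0 := by
    intro x v hx h0
    have := congrArg Complex.re h0
    simp at this
    exact hx this
  have lim1 := tendsto_integral_vertical_sub (f := dslope h 0) (a := -1) (b := 1) (by norm_num)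
    (hd'.mono fun z hz => by simp only [Set.mem_ofPred_eq] at hz ⊢; linarith [hz.2]) (by
      intro ε hε
      refine ⟨max 1 ((C + ‖h 0‖) / ε), fun v hv x hx => ?_⟩
      have hv1 : 1 ≤ |v| := (le_max_left _ _).trans hv
      have hv2 : (C + ‖h 0‖) / ε ≤ |v| := (le_max_right _ _).trans hv
      have hw : (x : ℂ) + v * Complex.I ≠ 0 := by
        intro h0
        have := congrArg Complex.im h0
        simp at this
        rw [this, abs_zero] at hv1
        linarith
      have hn : |v| ≤ ‖(x : ℂ) + v * Complex.I‖ := by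
        have := Complex.abs_im_le_norm ((x : ℂ) + v * Complex.I)
        simpa using this
      rw [hval _ hw, ← sub_div, norm_div, div_le_iff₀ (by positivity)]
      have e1 := norm_sub_le (h ((x : ℂ) + v * Complex.I)) (h 0)
      have e2 := hb v hv1 x hx
      rw [div_le_iff₀ hε] at hv2
      nlinarith)
  have hk : MeasureTheory.Integrable fun v : ℝ => h 0 * (2 * (((1 + v ^ 2)⁻¹ : ℝ) : ℂ)) :=
    (integrable_inv_one_add_sq.ofReal.const_mul 2).const_mul (h 0)
  have hint : MeasureTheory.Integrable fun v : ℝ =>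
      (h (1 + v * Complex.I) / (1 + v * Complex.I) -
        h (-1 + v * Complex.I) / (-1 + v * Complex.I)) - h 0 * (2 * ((1 + v ^ 2)⁻¹ : ℝ)) :=
    (h1.sub h2).sub hk
  have lim2 := MeasureTheory.intervalIntegral_tendsto_integral hint
    (tendsto_neg_atTop_atBot (G := ℝ)) tendsto_id
  have heq : ∀ v : ℝ, dslope h 0 (((1 : ℝ) : ℂ) + v * Complex.I) -
      dslope h 0 (((-1 : ℝ) : ℂ) + v * Complex.I) =
      (h (1 + v * Complex.I) / (1 + v * Complex.I) -
        h (-1 + v * Complex.I) / (-1 + v * Complex.I)) - h 0 * (2 * ((1 + v ^ 2)⁻¹ : ℝ)) := by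
    intro v
    have n1 := hne 1 v one_ne_zero
    have n2 := hne (-1) v (by norm_num)
    rw [hval _ n1, hval _ n2]
    push_cast at n1 n2 ⊢
    have n3 : (1 + (v : ℂ) ^ 2) ≠ 0 := by
      have : (1 + (v : ℂ) ^ 2) = ((1 + v ^ 2 : ℝ) : ℂ) := by push_cast; ring
      rw [this]
      exact_mod_cast (by positivity : (1 + v ^ 2 : ℝ) ≠ 0)
    have n4 : h 0 / (1 + v * Complex.I) - h 0 / (-1 + v * Complex.I) =
        h 0 * (2 * (1 + (v : ℂ) ^ 2)⁻¹) := by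
      field_simp
      linear_combination (-2 * h 0 * (v : ℂ) ^ 2) * Complex.I_sq
    rw [← n4]
    ring
  simp only [heq] at lim1
  have e := tendsto_nhds_unique lim1 lim2
  have h12 : MeasureTheory.Integrable fun v : ℝ => h (1 + v * Complex.I) / (1 + v * Complex.I) -
      h (-1 + v * Complex.I) / (-1 + v * Complex.I) := h1.sub h2
  rw [MeasureTheory.integral_sub h12 hk,
    MeasureTheory.integral_sub h1 h2, MeasureTheory.integral_const_mul,
    MeasureTheory.integral_const_mul] at e
  have e3 : ∫ v : ℝ, (((1 + v ^ 2)⁻¹ : ℝ) : ℂ) = π := by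
    rw [integral_complex_ofReal, integral_univ_inv_one_add_sq]
  rw [e3] at e
  linear_combination -e

end ContourShift

section FunctionalEquationFactor

/-- A holomorphic function with Gaussian decay in a strip is bounded by its boundary values. -/
lemma norm_le_integral_vertical {h : ℂ → ℂ} {K : ℝ}
    (hd : DifferentiableOn ℂ h {w | w.re < 3 / 2})
    (hb : ∀ v : ℝ, ∀ x ∈ Set.Icc (-1 : ℝ) 1,
      ‖h ((x : ℂ) + v * Complex.I)‖ ≤ K * Real.exp (-(1 / 2) * v ^ 2)) :
    MeasureTheory.Integrable (fun v : ℝ => ‖h (1 + v * Complex.I)‖) ∧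
    MeasureTheory.Integrable (fun v : ℝ => ‖h (-1 + v * Complex.I)‖) ∧
    ‖h 0‖ ≤ (∫ v : ℝ, ‖h (1 + v * Complex.I)‖) + ∫ v : ℝ, ‖h (-1 + v * Complex.I)‖ := by
  have hK : 0 ≤ K := by
    have := (norm_nonneg _).trans (hb 0 0 (by norm_num))
    simpa using this
  have hcont : ∀ x ∈ Set.Icc (-1 : ℝ) 1, Continuous fun v : ℝ => h ((x : ℂ) + v * Complex.I) := by
    intro x hx
    refine hd.continuousOn.comp_continuous (by fun_prop) fun v => ?_
    simp only [Set.mem_ofPred_eq, Complex.add_re, Complex.ofReal_re, Complex.mul_re, Complex.I_re,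
      mul_zero, Complex.ofReal_im, Complex.I_im, mul_one, sub_self, add_zero]
    linarith [hx.2]
  have hgauss : MeasureTheory.Integrable fun v : ℝ => K * Real.exp (-(1 / 2) * v ^ 2) :=
    (integrable_exp_neg_mul_sq (by norm_num)).const_mul K
  have hone : ∀ x v : ℝ, |x| = 1 → 1 ≤ ‖(x : ℂ) + v * Complex.I‖ := by
    intro x v hx
    have := Complex.abs_re_le_norm ((x : ℂ) + v * Complex.I)
    simpa [hx] using this
  have hint : ∀ x : ℝ, |x| = 1 →
      MeasureTheory.Integrable (fun v : ℝ => ‖h ((x : ℂ) + v * Complex.I)‖) ∧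
      MeasureTheory.Integrable
        (fun v : ℝ => h ((x : ℂ) + v * Complex.I) / ((x : ℂ) + v * Complex.I)) ∧
      ‖∫ v : ℝ, h ((x : ℂ) + v * Complex.I) / ((x : ℂ) + v * Complex.I)‖ ≤
        ∫ v : ℝ, ‖h ((x : ℂ) + v * Complex.I)‖ := by
    intro x hx
    have hx' : x ∈ Set.Icc (-1 : ℝ) 1 := abs_le.1 hx.le
    have i1 : MeasureTheory.Integrable (fun v : ℝ => ‖h ((x : ℂ) + v * Complex.I)‖) :=
      hgauss.mono' (hcont x hx').norm.aestronglyMeasurable (by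
        filter_upwards with v
        rw [norm_norm]
        exact hb v x hx')
    have le : ∀ v : ℝ, ‖h ((x : ℂ) + v * Complex.I) / ((x : ℂ) + v * Complex.I)‖ ≤
        ‖h ((x : ℂ) + v * Complex.I)‖ := by
      intro v
      rw [norm_div]
      exact div_le_self (norm_nonneg _) (hone x v hx)
    have hne : ∀ v : ℝ, (x : ℂ) + v * Complex.I ≠ 0 := fun v h0 => by
      have := hone x v hx
      rw [h0, norm_zero] at this
      linarith
    refine ⟨i1, i1.mono' ?_ (Filter.Eventually.of_forall le),
      MeasureTheory.norm_integral_le_of_norm_le i1 (Filter.Eventually.of_forall le)⟩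
    exact ((hcont x hx').div (by fun_prop) hne).aestronglyMeasurable
  obtain ⟨p1, p2, p3⟩ := hint 1 (by norm_num)
  obtain ⟨m1, m2, m3⟩ := hint (-1) (by norm_num)
  push_cast at p1 p2 p3 m1 m2 m3
  refine ⟨p1, m1, ?_⟩
  have key := integral_vertical_div_sub (C := K) hd (fun v _ x hx => (hb v x hx).trans
    (mul_le_of_le_one_right hK (Real.exp_le_one_iff.2 (by nlinarith [sq_nonneg v])))) p2 m2
  have h1 : ‖(2 * π * h 0 : ℂ)‖ = 2 * π * ‖h 0‖ := by
    rw [norm_mul, norm_mul, Complex.norm_real, Real.norm_of_nonneg Real.pi_pos.le]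
    norm_num
  have h2 := norm_sub_le (∫ v : ℝ, h (1 + v * Complex.I) / (1 + v * Complex.I))
    (∫ v : ℝ, h (-1 + v * Complex.I) / (-1 + v * Complex.I))
  rw [key, h1] at h2
  nlinarith [Real.pi_gt_three, norm_nonneg (h 0)]

/-- The factor in the functional equation `ζ(z) = χ(z) ζ(1 - z)`. -/
noncomputable def zetaChi (z : ℂ) : ℂ :=
  2 * (2 * π : ℂ) ^ (z - 1) * Complex.sin (π * z / 2) * Complex.Gamma (1 - z)

/-- The function `(z - 1) χ(z)`, which has no pole at `1`. -/
noncomputable def zetaChi₁ (z : ℂ) : ℂ :=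
  -(2 * (2 * π : ℂ) ^ (z - 1) * Complex.sin (π * z / 2) * Complex.Gamma (2 - z))

lemma zetaChi₁_eq {z : ℂ} (hz : z ≠ 1) : zetaChi₁ z = (z - 1) * zetaChi z := by
  have : Complex.Gamma (2 - z) = (1 - z) * Complex.Gamma (1 - z) := by
    rw [← Complex.Gamma_add_one _ (sub_ne_zero.2 hz.symm)]
    congr 1
    ring
  rw [zetaChi₁, zetaChi, this]
  ring

lemma two_pi_ne_zero' : (2 * π : ℂ) ≠ 0 := by
  exact_mod_cast (by positivity : (2 * π : ℝ) ≠ 0)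

lemma differentiableOn_zetaChi₁ : DifferentiableOn ℂ zetaChi₁ {z | z.re < 2} := by
  intro z hz
  refine DifferentiableAt.differentiableWithinAt ?_
  unfold zetaChi₁
  have h1 : DifferentiableAt ℂ (fun z : ℂ => Complex.Gamma (2 - z)) z := by
    refine DifferentiableAt.comp (g := Complex.Gamma) z
      (Complex.differentiableAt_Gamma _ fun m hm => ?_) (by fun_prop)
    have := congrArg Complex.re hm
    simp only [Complex.sub_re, Complex.re_ofNat, Complex.neg_re, Complex.natCast_re] at this
    simp only [Set.mem_ofPred_eq] at hz
    have : (0 : ℝ) ≤ m := Nat.cast_nonneg m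
    linarith
  have h2 : DifferentiableAt ℂ (fun z : ℂ => (2 * π : ℂ) ^ (z - 1)) z :=
    DifferentiableAt.const_cpow (by fun_prop) (Or.inl two_pi_ne_zero')
  have h3 : DifferentiableAt ℂ (fun z : ℂ => Complex.sin (π * z / 2)) z := by fun_prop
  exact (((h2.const_mul 2).mul h3).mul h1).neg

lemma riemannZeta_eq_zetaChi_mul {z : ℂ} (hz : z.re < 1) (hz0 : z ≠ 0) :
    riemannZeta z = zetaChi z * riemannZeta (1 - z) := by
  have h := riemannZeta_one_sub (s := 1 - z) (fun n hn => by
    have := congrArg Complex.re hn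
    simp only [Complex.sub_re, Complex.one_re, Complex.neg_re, Complex.natCast_re] at this
    have : (0 : ℝ) ≤ n := Nat.cast_nonneg n
    linarith) (by simpa using hz0)
  have e : Complex.cos (π * (1 - z) / 2) = Complex.sin (π * z / 2) := by
    rw [← Complex.cos_pi_div_two_sub]
    congr 1
    ring
  rw [sub_sub_cancel, e] at h
  rw [h, zetaChi, neg_sub]
  ring

lemma norm_sin_sq {a b : ℝ} (ha : Real.cos (2 * a) = 0) :
    ‖Complex.sin (a + b * Complex.I)‖ ^ 2 = Real.cosh (2 * b) / 2 := by
  have h1 : (2 * (‖Complex.sin (a + b * Complex.I)‖ ^ 2 : ℝ) : ℂ) = Real.cosh (2 * b) := by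
    rw [← Complex.normSq_eq_norm_sq, ← Complex.mul_conj, ← Complex.sin_conj]
    have e1 : (starRingEnd ℂ) ((a : ℂ) + b * Complex.I) = a - b * Complex.I := by
      simp [sub_eq_add_neg]
    have e2 := Complex.cos_sub (a + b * Complex.I) (a - b * Complex.I)
    have e3 := Complex.cos_add (a + b * Complex.I) (a - b * Complex.I)
    rw [show (a : ℂ) + b * Complex.I + (a - b * Complex.I) = ((2 * a : ℝ) : ℂ) by push_cast; ring,
      ← Complex.ofReal_cos, ha, Complex.ofReal_zero] at e3
    rw [show (a : ℂ) + b * Complex.I - (a - b * Complex.I) = ((2 * b : ℝ) : ℂ) * Complex.I by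
      push_cast; ring, Complex.cos_mul_I, ← Complex.ofReal_cosh] at e2
    rw [e1]
    linear_combination -e2 + e3
  have h2 : 2 * ‖Complex.sin (a + b * Complex.I)‖ ^ 2 = Real.cosh (2 * b) := by exact_mod_cast h1
  linarith

lemma norm_Gamma_one_half_sq (y : ℝ) :
    ‖Complex.Gamma (1 / 2 - y * Complex.I)‖ ^ 2 = π / Real.cosh (π * y) := by
  have h1 : ((‖Complex.Gamma (1 / 2 - y * Complex.I)‖ ^ 2 : ℝ) : ℂ) =
      ((π / Real.cosh (π * y) : ℝ) : ℂ) := by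
    rw [← Complex.normSq_eq_norm_sq, ← Complex.mul_conj, ← Complex.Gamma_conj]
    have e1 : (starRingEnd ℂ) (1 / 2 - (y : ℂ) * Complex.I) = 1 - (1 / 2 - y * Complex.I) := by
      simp only [map_sub, map_div₀, map_one, map_ofNat, map_mul, Complex.conj_ofReal,
        Complex.conj_I]
      ring
    rw [e1, Complex.Gamma_mul_Gamma_one_sub]
    have e2 : Complex.sin (π * (1 / 2 - y * Complex.I)) = Real.cosh (π * y) := by
      rw [show (π : ℂ) * (1 / 2 - y * Complex.I) = π / 2 - ((π * y : ℝ) : ℂ) * Complex.I by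
        push_cast; ring, Complex.sin_pi_div_two_sub, Complex.cos_mul_I, Complex.ofReal_cosh]
    rw [e2]
    push_cast
    rfl
  exact_mod_cast h1

lemma norm_two_pi_cpow (z : ℂ) : ‖(2 * π : ℂ) ^ z‖ = (2 * π) ^ z.re := by
  rw [show (2 * π : ℂ) = ((2 * π : ℝ) : ℂ) by push_cast; rfl,
    Complex.norm_cpow_eq_rpow_re_of_pos (by positivity)]

lemma norm_zetaChi_critical (y : ℝ) : ‖zetaChi (1 / 2 + y * Complex.I)‖ = 1 := by
  have h1 := norm_sin_sq (a := π / 4) (b := π * y / 2) (by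
    rw [show 2 * (π / 4) = π / 2 by ring, Real.cos_pi_div_two])
  have h2 := norm_Gamma_one_half_sq y
  have hc := Real.cosh_pos (π * y)
  rw [show 2 * (π * y / 2) = π * y by ring] at h1
  have h3 : ‖zetaChi (1 / 2 + y * Complex.I)‖ ^ 2 = 1 := by
    rw [zetaChi, norm_mul, norm_mul, norm_mul, norm_two_pi_cpow,
      show (π : ℂ) * (1 / 2 + y * Complex.I) / 2 =
        ((π / 4 : ℝ) : ℂ) + ((π * y / 2 : ℝ) : ℂ) * Complex.I by push_cast; ring,
      show (1 : ℂ) - (1 / 2 + y * Complex.I) = 1 / 2 - y * Complex.I by ring, mul_pow, mul_pow,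
      mul_pow, h1, h2]
    have e : ((2 * π) ^ (1 / 2 + (y : ℂ) * Complex.I - 1).re) ^ 2 = (2 * π)⁻¹ := by
      rw [← Real.rpow_natCast, ← Real.rpow_mul (by positivity), ← Real.rpow_neg_one]
      congr 1
      simp
      norm_num
    rw [e]
    simp only [Complex.norm_ofNat]
    field_simp
  exact (pow_eq_one_iff_of_nonneg (norm_nonneg _) two_ne_zero).1 h3

lemma norm_zetaChi_left (y : ℝ) :
    ‖zetaChi (-1 / 2 + y * Complex.I)‖ ≤ ‖(1 / 2 - y * Complex.I : ℂ)‖ := by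
  have h1 := norm_sin_sq (a := -(π / 4)) (b := π * y / 2) (by
    rw [show 2 * -(π / 4) = -(π / 2) by ring, Real.cos_neg, Real.cos_pi_div_two])
  have h2 := norm_Gamma_one_half_sq y
  have hc := Real.cosh_pos (π * y)
  rw [show 2 * (π * y / 2) = π * y by ring] at h1
  have hne : (1 / 2 - y * Complex.I : ℂ) ≠ 0 := fun h0 => by
    have := congrArg Complex.re h0
    norm_num at this
  have h3 : ‖zetaChi (-1 / 2 + y * Complex.I)‖ ^ 2 =
      ‖(1 / 2 - y * Complex.I : ℂ)‖ ^ 2 / (4 * π ^ 2) := by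
    rw [zetaChi, norm_mul, norm_mul, norm_mul, norm_two_pi_cpow,
      show (π : ℂ) * (-1 / 2 + y * Complex.I) / 2 =
        ((-(π / 4) : ℝ) : ℂ) + ((π * y / 2 : ℝ) : ℂ) * Complex.I by push_cast; ring,
      show (1 : ℂ) - (-1 / 2 + y * Complex.I) = (1 / 2 - y * Complex.I) + 1 by ring,
      Complex.Gamma_add_one _ hne, norm_mul, mul_pow, mul_pow, mul_pow, mul_pow, h1, h2]
    have e : ((2 * π) ^ (-1 / 2 + (y : ℂ) * Complex.I - 1).re) ^ 2 = ((2 * π) ^ 3)⁻¹ := by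
      rw [← Real.rpow_natCast, ← Real.rpow_mul (by positivity), ← Real.rpow_natCast,
        ← Real.rpow_neg (by positivity)]
      congr 1
      simp
      norm_num
    rw [e]
    simp only [Complex.norm_ofNat]
    field_simp
    ring
  rw [← sq_le_sq₀ (norm_nonneg _) (norm_nonneg _), h3]
  exact div_le_self (by positivity) (by nlinarith [Real.pi_gt_three])

lemma norm_zetaChi_right (y : ℝ) :
    ‖zetaChi (3 / 2 + y * Complex.I)‖ ≤ 7 / ‖(1 / 2 - y * Complex.I : ℂ)‖ := by
  have h1 := norm_sin_sq (a := 3 * (π / 4)) (b := π * y / 2) (by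
    rw [show 2 * (3 * (π / 4)) = π / 2 + π by ring, Real.cos_add_pi, Real.cos_pi_div_two, neg_zero])
  have h2 := norm_Gamma_one_half_sq y
  have hc := Real.cosh_pos (π * y)
  rw [show 2 * (π * y / 2) = π * y by ring] at h1
  have hne : (-1 / 2 - y * Complex.I : ℂ) ≠ 0 := fun h0 => by
    have := congrArg Complex.re h0
    norm_num at this
  have hn : ‖(-1 / 2 - y * Complex.I : ℂ)‖ = ‖(1 / 2 - y * Complex.I : ℂ)‖ := by
    rw [← Complex.norm_conj, ← norm_neg]
    congr 1
    simp only [map_sub, map_div₀, map_one, map_ofNat, map_mul, Complex.conj_ofReal,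
        Complex.conj_I, map_neg]
    ring
  have hN : 0 < ‖(1 / 2 - y * Complex.I : ℂ)‖ := by rw [← hn]; exact norm_pos_iff.2 hne
  have hG : ‖Complex.Gamma (1 / 2 - y * Complex.I)‖ = ‖(1 / 2 - y * Complex.I : ℂ)‖ *
      ‖Complex.Gamma (-1 / 2 - y * Complex.I)‖ := by
    rw [← hn, ← norm_mul, ← Complex.Gamma_add_one _ hne]
    congr 2
    ring
  rw [hG, mul_pow] at h2
  have h3 : (‖zetaChi (3 / 2 + y * Complex.I)‖ * ‖(1 / 2 - y * Complex.I : ℂ)‖) ^ 2 =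
      4 * π ^ 2 := by
    rw [zetaChi, norm_mul, norm_mul, norm_mul, norm_two_pi_cpow,
      show (π : ℂ) * (3 / 2 + y * Complex.I) / 2 =
        ((3 * (π / 4) : ℝ) : ℂ) + ((π * y / 2 : ℝ) : ℂ) * Complex.I by push_cast; ring,
      show (1 : ℂ) - (3 / 2 + y * Complex.I) = -1 / 2 - y * Complex.I by ring, mul_pow, mul_pow,
      mul_pow, mul_pow, h1]
    have e : ((2 * π) ^ (3 / 2 + (y : ℂ) * Complex.I - 1).re) ^ 2 = 2 * π := by
      rw [← Real.rpow_natCast, ← Real.rpow_mul (by positivity)]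
      conv_rhs => rw [← Real.rpow_one (2 * π)]
      congr 1
      simp
      norm_num
    rw [e, mul_assoc, mul_comm (‖Complex.Gamma _‖ ^ 2), h2]
    simp only [Complex.norm_ofNat]
    field_simp
    norm_num
  rw [le_div_iff₀ hN, ← sq_le_sq₀ (by positivity) (by norm_num), h3]
  nlinarith [Real.pi_lt_d2, Real.pi_pos]

end FunctionalEquationFactor

section StripBounds

lemma norm_Gamma_le {s : ℂ} (hs : 0 < s.re) : ‖Complex.Gamma s‖ ≤ Real.Gamma s.re := by
  rw [Complex.Gamma_eq_integral hs, Real.Gamma_eq_integral hs, Complex.GammaIntegral]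
  refine MeasureTheory.norm_integral_le_of_norm_le (Real.GammaIntegral_convergent hs) ?_
  rw [MeasureTheory.ae_restrict_iff' measurableSet_Ioi]
  refine Filter.Eventually.of_forall fun x hx => ?_
  rw [norm_mul, Complex.norm_cpow_eq_rpow_re_of_pos hx, Complex.norm_real,
    Real.norm_of_nonneg (Real.exp_pos _).le, Complex.sub_re, Complex.one_re]

lemma exists_norm_zetaChi₁_le : ∃ C : ℝ, 0 ≤ C ∧ ∀ z : ℂ, -1 / 2 ≤ z.re → z.re ≤ 3 / 2 →
    ‖zetaChi₁ z‖ ≤ C * Real.exp (2 * |z.im|) := by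
  obtain ⟨G, hG⟩ := (isCompact_Icc (a := (1 / 2 : ℝ)) (b := 5 / 2)).exists_bound_of_continuousOn
    (f := Real.Gamma) (fun x hx => (Real.differentiableAt_Gamma fun m hm => by
      have : (0 : ℝ) ≤ m := Nat.cast_nonneg m
      linarith [hx.1]).continuousAt.continuousWithinAt)
  have hG0 : 0 ≤ G := (norm_nonneg _).trans (hG 1 (by norm_num))
  refine ⟨2 * (2 * π) * G, by positivity, fun z h1 h2 => ?_⟩
  have e1 : ‖(2 * π : ℂ) ^ (z - 1)‖ ≤ 2 * π := by
    rw [norm_two_pi_cpow]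
    calc (2 * π) ^ (z - 1).re ≤ (2 * π) ^ (1 : ℝ) :=
          Real.rpow_le_rpow_of_exponent_le (by linarith [Real.pi_gt_three])
            (by rw [Complex.sub_re, Complex.one_re]; linarith)
      _ = 2 * π := Real.rpow_one _
  have e2 : ‖Complex.Gamma (2 - z)‖ ≤ G := by
    have hre : (2 - z).re = 2 - z.re := by simp
    refine (norm_Gamma_le (by rw [hre]; linarith)).trans ((le_abs_self _).trans ?_)
    exact hG _ (by rw [hre]; constructor <;> linarith)
  have e3 : ‖Complex.sin (π * z / 2)‖ ≤ Real.exp (2 * |z.im|) := by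
    have h4 : ∀ w : ℂ, ‖w‖ = 1 → ‖Complex.exp (w * (π * z / 2) * Complex.I)‖ =
        Real.exp ((w * (π * z / 2) * Complex.I).re) := fun w _ => Complex.norm_exp _
    have b1 : (-(π * z / 2) * Complex.I).re ≤ 2 * |z.im| := by
      have : (-(π * z / 2) * Complex.I).re = π / 2 * z.im := by simp; ring
      rw [this]
      nlinarith [le_abs_self z.im, abs_nonneg z.im, Real.pi_lt_four, Real.pi_pos]
    have b2 : ((π * z / 2) * Complex.I).re ≤ 2 * |z.im| := by
      have : ((π * z / 2) * Complex.I).re = π / 2 * -z.im := by simp; ring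
      rw [this]
      nlinarith [neg_le_abs z.im, abs_nonneg z.im, Real.pi_lt_four, Real.pi_pos]
    have hs : Complex.sin (π * z / 2) = (Complex.exp (-(π * z / 2) * Complex.I) -
        Complex.exp ((π * z / 2) * Complex.I)) * Complex.I / 2 := rfl
    rw [hs, norm_div, norm_mul, Complex.norm_I, mul_one, Complex.norm_ofNat,
      div_le_iff₀ (by norm_num)]
    refine (norm_sub_le _ _).trans ?_
    rw [Complex.norm_exp, Complex.norm_exp]
    linarith [Real.exp_le_exp.2 b1, Real.exp_le_exp.2 b2]
  rw [zetaChi₁, norm_neg, norm_mul, norm_mul, norm_mul, Complex.norm_ofNat]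
  calc 2 * ‖(2 * π : ℂ) ^ (z - 1)‖ * ‖Complex.sin (π * z / 2)‖ * ‖Complex.Gamma (2 - z)‖ ≤
      2 * (2 * π) * Real.exp (2 * |z.im|) * G := by gcongr
    _ = _ := by ring

lemma norm_le_mul_exp_abs_im {z : ℂ} (h1 : -3 / 2 ≤ z.re) (h2 : z.re ≤ 3 / 2) :
    ‖z‖ ≤ 2 * Real.exp |z.im| := by
  have h3 := Complex.norm_le_abs_re_add_abs_im z
  have h4 : |z.re| ≤ 3 / 2 := abs_le.2 ⟨by linarith, h2⟩
  have := Real.add_one_le_exp |z.im|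
  linarith [Real.exp_pos |z.im|, Real.one_le_exp (abs_nonneg z.im)]

lemma norm_riemannZeta_le_inv_add {s : ℂ} (hs : 1 / 2 ≤ s.re) (hs1 : s ≠ 1) :
    ‖riemannZeta s‖ ≤ 1 / ‖s - 1‖ + 6 * ‖s‖ := by
  have := norm_riemannZeta_sub_le le_rfl hs hs1
  simpa using this

lemma exists_norm_riemannZeta₁_le : ∃ C : ℝ, 0 ≤ C ∧ ∀ z : ℂ, -1 / 2 ≤ z.re → z.re ≤ 3 / 2 →
    ‖riemannZeta₁ z‖ ≤ C * Real.exp (4 * |z.im|) := by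
  obtain ⟨D, hD0, hD⟩ := exists_norm_zetaChi₁_le
  obtain ⟨B, hB⟩ := ((isCompact_Icc (a := (-1 / 2 : ℝ)) (b := 3 / 2)).reProdIm
    (isCompact_Icc (a := (-1 : ℝ)) (b := 1))).exists_bound_of_continuousOn
    (f := riemannZeta₁) differentiable_riemannZeta₁.continuous.continuousOn
  have hB0 : 0 ≤ B := (norm_nonneg _).trans (hB 0 (by rw [Complex.mem_reProdIm]; norm_num))
  refine ⟨B + 25 + 13 * D, by positivity, fun z h1 h2 => ?_⟩
  set E := Real.exp |z.im| with hE
  have hE1 : 1 ≤ E := Real.one_le_exp (abs_nonneg _)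
  have e4 : Real.exp (4 * |z.im|) = E ^ 4 := by rw [hE, ← Real.exp_nat_mul]; norm_num
  have e2 : Real.exp (2 * |z.im|) = E ^ 2 := by rw [hE, ← Real.exp_nat_mul]; norm_num
  have p2 : 1 ≤ E ^ 2 := one_le_pow₀ hE1
  have p3 : E ^ 2 ≤ E ^ 4 := pow_le_pow_right₀ hE1 (by norm_num)
  have p4 : E ^ 3 ≤ E ^ 4 := pow_le_pow_right₀ hE1 (by norm_num)
  rw [e4]
  have hD4 := mul_nonneg hD0 (sub_nonneg.2 p3)
  have hD5 := mul_nonneg hD0 (sub_nonneg.2 p4)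
  have hD6 : 0 ≤ D * E ^ 4 := by positivity
  have hBE : B ≤ B * E ^ 4 := le_mul_of_one_le_right hB0 (p2.trans p3)
  rcases le_or_gt |z.im| 1 with h3 | h3
  · have := hB z (by rw [Complex.mem_reProdIm]; exact ⟨⟨h1, h2⟩, abs_le.1 h3⟩)
    nlinarith
  · have hz1 : z ≠ 1 := fun h => by rw [h] at h3; norm_num at h3
    have hz0 : z ≠ 0 := fun h => by rw [h] at h3; norm_num at h3
    have hsub : z - 1 ≠ 0 := sub_ne_zero.2 hz1
    have hmul : riemannZeta₁ z = (z - 1) * riemannZeta z := by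
      rw [riemannZeta_eq_inv_sub_mul hz1, mul_inv_cancel_left₀ hsub]
    have n1 : ‖z‖ ≤ 2 * E := norm_le_mul_exp_abs_im (by linarith) h2
    have n2 : ‖z - 1‖ ≤ 2 * E := by
      have := norm_le_mul_exp_abs_im (z := z - 1) (by simp; linarith) (by simp; linarith)
      simpa using this
    rcases le_or_gt (1 / 2) z.re with h4 | h4
    · rw [hmul, norm_mul]
      have := norm_riemannZeta_le_inv_add h4 hz1
      have hpos : 0 < ‖z - 1‖ := norm_pos_iff.2 hsub
      calc ‖z - 1‖ * ‖riemannZeta z‖ ≤ ‖z - 1‖ * (1 / ‖z - 1‖ + 6 * ‖z‖) := by gcongr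
        _ = 1 + 6 * (‖z - 1‖ * ‖z‖) := by field_simp
        _ ≤ 1 + 6 * ((2 * E) * (2 * E)) := by gcongr
        _ ≤ _ := by nlinarith
    · rw [hmul, riemannZeta_eq_zetaChi_mul (by linarith) hz0, ← mul_assoc, ← zetaChi₁_eq hz1,
        norm_mul]
      have h5 := norm_riemannZeta_le_inv_add (s := 1 - z) (by simp; linarith) (by simpa using hz0)
      have h6 : 1 ≤ ‖(1 - z - 1 : ℂ)‖ := by
        have := Complex.abs_im_le_norm (1 - z - 1)
        simp only [Complex.sub_im, Complex.one_im, zero_sub, sub_zero, abs_neg] at this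
        linarith
      rw [norm_sub_rev z 1] at n2
      have h7 : 1 / ‖(1 - z - 1 : ℂ)‖ ≤ 1 := div_le_one_of_le₀ h6 (norm_nonneg _)
      have h8 := hD z h1 h2
      rw [e2] at h8
      calc ‖zetaChi₁ z‖ * ‖riemannZeta (1 - z)‖ ≤ (D * E ^ 2) * (1 + 6 * (2 * E)) := by
            gcongr; linarith
        _ = D * E ^ 2 + 12 * (D * E ^ 3) := by ring
        _ ≤ _ := by nlinarith

end StripBounds

section DirichletSeries

lemma LSeriesHasSum_dk (k : ℕ) {s : ℂ} (hs : 1 < s.re) :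
    LSeriesHasSum (fun n => (dk k n : ℂ)) s (riemannZeta s ^ k) := by
  induction k with
  | zero =>
    have h : (fun n => (dk 0 n : ℂ)) = LSeries.delta := by
      funext n
      simp [dk, LSeries.delta, ArithmeticFunction.one_apply]
    rw [h, pow_zero]
    rw [LSeriesHasSum, funext (LSeries.term_delta s)]
    exact hasSum_ite_eq 1 1
  | succ k ih =>
    have h := ih.convolution (LSeriesHasSum_one hs)
    rw [pow_succ]
    refine (LSeriesHasSum_congr _ _ fun {n} hn => ?_).1 h
    rw [dk_succ, LSeries.convolution_def]
    push_cast
    simp [Nat.sum_divisorsAntidiagonal (fun i _ => (dk k i : ℂ))]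

lemma LSeriesHasSum_dWeighted (ℓ : ℕ) {a : ℝ} (ha : 0 ≤ a) {s : ℂ} (hs : 1 < s.re) :
    LSeriesHasSum (fun n => (dWeighted ℓ a n : ℂ)) s
      (riemannZeta s ^ 4 * riemannZeta (s + a) ^ ℓ) := by
  have h1 : LSeriesHasSum (fun n => (dk ℓ n : ℂ) * (n : ℂ) ^ (-(a : ℂ))) s
      (riemannZeta (s + a) ^ ℓ) := by
    have h := LSeriesHasSum_dk ℓ (s := s + a) (by simp; linarith)
    have e : LSeries.term (fun n => (dk ℓ n : ℂ) * (n : ℂ) ^ (-(a : ℂ))) s =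
        LSeries.term (fun n => (dk ℓ n : ℂ)) (s + a) := by
      funext n
      rcases eq_or_ne n 0 with rfl | hn
      · simp
      · have hn' : (n : ℂ) ≠ 0 := by exact_mod_cast hn
        rw [LSeries.term_of_ne_zero hn, LSeries.term_of_ne_zero hn, Complex.cpow_add _ _ hn',
          Complex.cpow_neg]
        field_simp
    rw [LSeriesHasSum, e]
    exact h
  have h := (LSeriesHasSum_dk 4 hs).convolution h1
  refine (LSeriesHasSum_congr _ _ fun {n} hn => ?_).1 h
  rw [LSeries.convolution_def, dWeighted]
  push_cast
  refine Finset.sum_congr rfl fun p hp => ?_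
  rw [Complex.ofReal_cpow (by positivity)]
  push_cast
  ring

lemma LSeriesHasSum.hasSum_mul_cpow {f : ℕ → ℂ} {s z : ℂ} (h0 : f 0 = 0)
    (h : LSeriesHasSum f s z) : HasSum (fun n : ℕ => f n * (n : ℂ) ^ (-s)) z := by
  refine HasSum.congr_fun h fun n => ?_
  rcases eq_or_ne n 0 with rfl | hn
  · simp [h0]
  · rw [LSeries.term_of_ne_zero hn, Complex.cpow_neg, div_eq_mul_inv]

end DirichletSeries

section ApproximateFunctionalEquation

/-- The Dirichlet series `∑ c(n) n^{-it}`. -/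
noncomputable def dirichletSeries (c : ℕ → ℝ) (t : ℝ) : ℂ :=
  ∑' n : ℕ, (c n : ℂ) * (n : ℂ) ^ (-(t : ℂ) * Complex.I)

/-- The coefficients `d(n) n^{-σ}` for `n ≤ N`. -/
noncomputable def divisorHead (N : ℕ) (σ : ℝ) (n : ℕ) : ℝ :=
  if n ≤ N then (dk 2 n : ℝ) * (n : ℝ) ^ (-σ) else 0

/-- The coefficients `d(n) n^{-3/2}` for `n > N`. -/
noncomputable def divisorTail (N : ℕ) (n : ℕ) : ℝ :=
  if n ≤ N then 0 else (dk 2 n : ℝ) * (n : ℝ) ^ (-(3 / 2) : ℝ)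

/-- The Dirichlet polynomial `∑_{n ≤ N} d(n) n^{-z}`. -/
noncomputable def divisorPoly (N : ℕ) (z : ℂ) : ℂ :=
  ∑ n ∈ Finset.range (N + 1), (dk 2 n : ℂ) * (n : ℂ) ^ (-z)

lemma dk_zero_right (k : ℕ) : dk k 0 = 0 := by simp [dk]

lemma norm_natCast_cpow_mul_I_le_one (n : ℕ) (t : ℝ) :
    ‖(n : ℂ) ^ (-(t : ℂ) * Complex.I)‖ ≤ 1 := by
  rcases Nat.eq_zero_or_pos n with rfl | hn
  · rcases eq_or_ne (-(t : ℂ) * Complex.I) 0 with h | h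
    · simp [h]
    · rw [Nat.cast_zero, Complex.zero_cpow h, norm_zero]
      exact zero_le_one
  · rw [Complex.norm_natCast_cpow_of_pos hn]
    simp

lemma norm_dirichletSeries_le {c : ℕ → ℝ} (hc : Summable fun n => ‖c n‖) (t : ℝ) :
    ‖dirichletSeries c t‖ ≤ ∑' n, ‖c n‖ := by
  refine tsum_of_norm_bounded hc.hasSum fun n => ?_
  rw [norm_mul, Complex.norm_real]
  exact mul_le_of_le_one_right (norm_nonneg _) (norm_natCast_cpow_mul_I_le_one n t)

lemma continuous_natCast_cpow_mul_I (n : ℕ) (hn : n ≠ 0) :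
    Continuous fun t : ℝ => (n : ℂ) ^ (-(t : ℂ) * Complex.I) := by
  refine Continuous.const_cpow (by fun_prop) (Or.inl (by exact_mod_cast hn))

lemma continuous_dirichletSeries {c : ℕ → ℝ} (h0 : c 0 = 0) (hc : Summable fun n => ‖c n‖) :
    Continuous (dirichletSeries c) := by
  refine continuous_tsum (fun n => ?_) hc fun n t => ?_
  · rcases eq_or_ne n 0 with rfl | hn
    · simpa [h0] using continuous_const
    · exact continuous_const.mul (continuous_natCast_cpow_mul_I n hn)
  · rw [norm_mul, Complex.norm_real]
    exact mul_le_of_le_one_right (norm_nonneg _) (norm_natCast_cpow_mul_I_le_one n t)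

lemma norm_dirichletSeries_neg (c : ℕ → ℝ) (t : ℝ) :
    ‖dirichletSeries c (-t)‖ = ‖dirichletSeries c t‖ := by
  rw [← Complex.norm_conj, dirichletSeries, dirichletSeries, Complex.conj_tsum]
  congr 1
  refine tsum_congr fun n => ?_
  rw [map_mul, Complex.conj_ofReal]
  congr 1
  have h := Complex.cpow_conj (n : ℂ) (-((-t : ℝ) : ℂ) * Complex.I)
    (by rw [Complex.natCast_arg]; exact Real.pi_pos.ne)
  rw [Complex.conj_natCast] at h
  rw [← h]
  simp

lemma natCast_cpow_neg_add (n : ℕ) (hn : n ≠ 0) (σ t : ℝ) :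
    (n : ℂ) ^ (-((σ : ℂ) + t * Complex.I)) =
      (((n : ℝ) ^ (-σ) : ℝ) : ℂ) * (n : ℂ) ^ (-(t : ℂ) * Complex.I) := by
  have hn0 : (n : ℂ) ≠ 0 := by exact_mod_cast hn
  rw [neg_add, Complex.cpow_add _ _ hn0, Complex.ofReal_cpow (by positivity)]
  push_cast
  rw [neg_mul]

lemma divisorPoly_eq (N : ℕ) (σ t : ℝ) :
    divisorPoly N ((σ : ℂ) + t * Complex.I) = dirichletSeries (divisorHead N σ) t := by
  rw [dirichletSeries, tsum_eq_sum (s := Finset.range (N + 1)), divisorPoly]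
  · refine Finset.sum_congr rfl fun n hn => ?_
    rw [divisorHead, if_pos (by simpa [Nat.lt_succ_iff] using hn)]
    rcases eq_or_ne n 0 with rfl | h
    · simp [dk_zero_right]
    · rw [natCast_cpow_neg_add n h]
      push_cast
      ring
  · intro n hn
    rw [divisorHead, if_neg (by simpa [Nat.lt_succ_iff] using hn)]
    simp

lemma summable_divisorTail (N : ℕ) : Summable fun n => ‖divisorTail N n‖ := by
  obtain ⟨C, hC, h⟩ := dk_le_rpow 2 (ε := 1 / 4) (by norm_num)
  refine Summable.of_nonneg_of_le (fun n => norm_nonneg _) (fun n => ?_)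
    ((Real.summable_nat_rpow.2 (by norm_num : (-(5 / 4) : ℝ) < -1)).mul_left C)
  rw [divisorTail]
  split_ifs with hn
  · rw [norm_zero]
    positivity
  · have hn0 : n ≠ 0 := by lia
    have hpos : (0 : ℝ) < n := by exact_mod_cast (by lia : 0 < n)
    rw [Real.norm_of_nonneg (by positivity)]
    calc (dk 2 n : ℝ) * (n : ℝ) ^ (-(3 / 2) : ℝ) ≤
        (C * (n : ℝ) ^ (1 / 4 : ℝ)) * (n : ℝ) ^ (-(3 / 2) : ℝ) := by gcongr; exact h n hn0
      _ = C * (n : ℝ) ^ (-(5 / 4) : ℝ) := by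
        rw [mul_assoc, ← Real.rpow_add hpos]
        norm_num

lemma summable_divisorHead (N : ℕ) (σ : ℝ) : Summable fun n => ‖divisorHead N σ n‖ := by
  refine summable_of_ne_finset_zero (s := Finset.range (N + 1)) fun n hn => ?_
  rw [divisorHead, if_neg (by simpa [Nat.lt_succ_iff] using hn), norm_zero]

lemma riemannZeta_sq_sub_divisorPoly (N : ℕ) (y : ℝ) :
    riemannZeta (3 / 2 + y * Complex.I) ^ 2 - divisorPoly N (3 / 2 + y * Complex.I) =
      dirichletSeries (divisorTail N) y := by
  have h := (LSeriesHasSum_dk 2 (s := 3 / 2 + y * Complex.I) (by norm_num)).hasSum_mul_cpow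
    (by simp [dk_zero_right])
  rw [← h.tsum_eq, ← h.summable.sum_add_tsum_compl (s := Finset.range (N + 1)), divisorPoly,
    add_sub_cancel_left, dirichletSeries, ← tsum_subtype_eq_of_support_subset
      (s := (↑(Finset.range (N + 1)) : Set ℕ)ᶜ)]
  · refine tsum_congr fun n => ?_
    have hn : ¬ (n : ℕ) ≤ N := by simpa [Nat.lt_succ_iff] using n.2
    rw [divisorTail, if_neg hn]
    have := natCast_cpow_neg_add n (by lia) (3 / 2) y
    push_cast at this ⊢
    rw [this]
    ring
  · intro n hn
    simp only [Function.mem_support] at hn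
    simp only [Set.mem_compl_iff, Finset.mem_coe, Finset.mem_range, Nat.lt_succ_iff]
    intro hle
    rw [divisorTail, if_pos hle] at hn
    simp at hn

end ApproximateFunctionalEquation

section ApproximateFunctionalEquationBound

/-- The defect `(z - 1)² (ζ(z)² - ∑ d(n) n^{-z} - χ(z)² ∑ d(n) n^{z-1})` of the approximate
functional equation for `ζ²`. -/
noncomputable def zetaSqDefect (N : ℕ) (z : ℂ) : ℂ :=
  riemannZeta₁ z ^ 2 - (z - 1) ^ 2 * divisorPoly N z - zetaChi₁ z ^ 2 * divisorPoly N (1 - z)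

lemma differentiable_divisorPoly (N : ℕ) : Differentiable ℂ (divisorPoly N) := by
  unfold divisorPoly
  refine Differentiable.fun_sum fun n _ => ?_
  rcases eq_or_ne n 0 with rfl | hn
  · simp [dk_zero_right]
  · exact (Differentiable.const_cpow (by fun_prop) (Or.inl (by exact_mod_cast hn))).const_mul _

lemma differentiableOn_zetaSqDefect (N : ℕ) :
    DifferentiableOn ℂ (zetaSqDefect N) {z | z.re < 2} := by
  have h1 : Differentiable ℂ fun z => riemannZeta₁ z ^ 2 - (z - 1) ^ 2 * divisorPoly N z :=
    (differentiable_riemannZeta₁.pow 2).sub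
      ((by fun_prop : Differentiable ℂ fun z : ℂ => (z - 1) ^ 2).mul (differentiable_divisorPoly N))
  have h2 : Differentiable ℂ fun z => divisorPoly N (1 - z) :=
    (differentiable_divisorPoly N).comp (by fun_prop)
  exact h1.differentiableOn.sub ((differentiableOn_zetaChi₁.pow 2).mul h2.differentiableOn)

lemma norm_divisorPoly_le (N : ℕ) {z : ℂ} (hz : -1 / 2 ≤ z.re) :
    ‖divisorPoly N z‖ ≤ ∑ n ∈ Finset.range (N + 1), (dk 2 n : ℝ) * (n : ℝ) ^ (1 / 2 : ℝ) := by
  refine (norm_sum_le _ _).trans (Finset.sum_le_sum fun n _ => ?_)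
  rcases eq_or_ne n 0 with rfl | hn
  · simp [dk_zero_right]
  · rw [norm_mul, Complex.norm_natCast_cpow_of_pos (by lia), Complex.norm_natCast, Complex.neg_re]
    gcongr
    · exact_mod_cast (by lia : 1 ≤ n)
    · linarith

lemma exists_norm_zetaSqDefect_le (N : ℕ) : ∃ C : ℝ, 0 ≤ C ∧ ∀ z : ℂ, -1 / 2 ≤ z.re →
    z.re ≤ 3 / 2 → ‖zetaSqDefect N z‖ ≤ C * Real.exp (8 * |z.im|) := by
  obtain ⟨A, hA0, hA⟩ := exists_norm_riemannZeta₁_le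
  obtain ⟨D, hD0, hD⟩ := exists_norm_zetaChi₁_le
  set S := ∑ n ∈ Finset.range (N + 1), (dk 2 n : ℝ) * (n : ℝ) ^ (1 / 2 : ℝ) with hS
  have hS0 : 0 ≤ S := Finset.sum_nonneg fun n _ => by positivity
  refine ⟨A ^ 2 + 4 * S + D ^ 2 * S, by positivity, fun z h1 h2 => ?_⟩
  set E := Real.exp |z.im| with hE
  have hE1 : 1 ≤ E := Real.one_le_exp (abs_nonneg _)
  have e : ∀ k : ℕ, Real.exp (k * |z.im|) = E ^ k := fun k => by rw [hE, ← Real.exp_nat_mul]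
  have e2 := e 2
  have e4 := e 4
  have e8 := e 8
  push_cast at e2 e4 e8
  have a1 := hA z h1 h2
  have a2 := hD z h1 h2
  rw [e4] at a1
  rw [e2] at a2
  rw [e8]
  have a3 : ‖z - 1‖ ≤ 2 * E := by
    have := norm_le_mul_exp_abs_im (z := z - 1) (by simp; linarith) (by simp; linarith)
    simpa using this
  have a4 := norm_divisorPoly_le N h1
  have a5 := norm_divisorPoly_le N (z := 1 - z) (by simp; linarith)
  have p2 : E ^ 2 ≤ E ^ 8 := pow_le_pow_right₀ hE1 (by norm_num)
  have p4 : E ^ 4 ≤ E ^ 8 := pow_le_pow_right₀ hE1 (by norm_num)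
  calc ‖zetaSqDefect N z‖ ≤ ‖riemannZeta₁ z‖ ^ 2 + ‖z - 1‖ ^ 2 * ‖divisorPoly N z‖ +
        ‖zetaChi₁ z‖ ^ 2 * ‖divisorPoly N (1 - z)‖ := by
        rw [zetaSqDefect, ← norm_pow, ← norm_pow, ← norm_pow, ← norm_mul, ← norm_mul]
        exact (norm_sub_le _ _).trans (add_le_add_left (norm_sub_le _ _) _)
    _ ≤ (A * E ^ 4) ^ 2 + (2 * E) ^ 2 * S + (D * E ^ 2) ^ 2 * S := by gcongr
    _ = A ^ 2 * E ^ 8 + 4 * S * E ^ 2 + D ^ 2 * S * E ^ 4 := by ring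
    _ ≤ A ^ 2 * E ^ 8 + 4 * S * E ^ 8 + D ^ 2 * S * E ^ 8 := by gcongr
    _ = _ := by ring

lemma zetaSqDefect_eq (N : ℕ) {z : ℂ} (hz : z ≠ 1) : zetaSqDefect N z = (z - 1) ^ 2 *
    (riemannZeta z ^ 2 - divisorPoly N z - zetaChi z ^ 2 * divisorPoly N (1 - z)) := by
  rw [zetaSqDefect, zetaChi₁_eq hz, riemannZeta_eq_inv_sub_mul hz]
  have := sub_ne_zero.2 hz
  field_simp

lemma norm_sq_add_mul_I (x y : ℝ) : ‖((x : ℂ) + y * Complex.I)‖ ^ 2 = x ^ 2 + y ^ 2 := by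
  rw [← Complex.normSq_eq_norm_sq, Complex.normSq_add_mul_I]

lemma norm_zetaSqDefect_right (N : ℕ) (y : ℝ) :
    ‖zetaSqDefect N (3 / 2 + y * Complex.I)‖ ≤
      (1 / 4 + y ^ 2) * ‖dirichletSeries (divisorTail N) y‖ +
        49 * ‖dirichletSeries (divisorHead N (-(1 / 2))) y‖ := by
  have hz : (3 / 2 + y * Complex.I : ℂ) ≠ 1 := fun h => by
    have := congrArg Complex.re h
    norm_num at this
  have h1 : ‖(3 / 2 + y * Complex.I - 1 : ℂ)‖ ^ 2 = 1 / 4 + y ^ 2 := by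
    have := norm_sq_add_mul_I (1 / 2) y
    rw [show (3 / 2 + y * Complex.I - 1 : ℂ) = ((1 / 2 : ℝ) : ℂ) + y * Complex.I by
      push_cast; ring, this]
    ring
  have h2 : ‖(1 / 2 - y * Complex.I : ℂ)‖ ^ 2 = 1 / 4 + y ^ 2 := by
    have := norm_sq_add_mul_I (1 / 2) (-y)
    rw [show (1 / 2 - y * Complex.I : ℂ) = ((1 / 2 : ℝ) : ℂ) + (-y : ℝ) * Complex.I by
      push_cast; ring, this]
    ring
  have h3 : (1 / 4 + y ^ 2) * ‖zetaChi (3 / 2 + y * Complex.I)‖ ^ 2 ≤ 49 := by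
    have h4 := norm_zetaChi_right y
    have h5 : ‖zetaChi (3 / 2 + y * Complex.I)‖ ^ 2 ≤
        (7 / ‖(1 / 2 - y * Complex.I : ℂ)‖) ^ 2 := by gcongr
    rw [div_pow, h2, le_div_iff₀ (by positivity)] at h5
    linarith
  have h6 : divisorPoly N (1 - (3 / 2 + y * Complex.I)) =
      dirichletSeries (divisorHead N (-(1 / 2))) (-y) := by
    rw [← divisorPoly_eq]
    congr 1
    push_cast
    ring
  rw [zetaSqDefect_eq N hz, riemannZeta_sq_sub_divisorPoly, norm_mul, norm_pow, h1, h6]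
  calc (1 / 4 + y ^ 2) * ‖dirichletSeries (divisorTail N) y -
        zetaChi (3 / 2 + y * Complex.I) ^ 2 * dirichletSeries (divisorHead N (-(1 / 2))) (-y)‖ ≤
      (1 / 4 + y ^ 2) * (‖dirichletSeries (divisorTail N) y‖ +
        ‖zetaChi (3 / 2 + y * Complex.I)‖ ^ 2 *
          ‖dirichletSeries (divisorHead N (-(1 / 2))) y‖) := by
        gcongr
        refine (norm_sub_le _ _).trans ?_
        rw [norm_mul, norm_pow, norm_dirichletSeries_neg]
    _ = (1 / 4 + y ^ 2) * ‖dirichletSeries (divisorTail N) y‖ +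
        ((1 / 4 + y ^ 2) * ‖zetaChi (3 / 2 + y * Complex.I)‖ ^ 2) *
          ‖dirichletSeries (divisorHead N (-(1 / 2))) y‖ := by ring
    _ ≤ _ := by gcongr

lemma norm_zetaSqDefect_left (N : ℕ) (y : ℝ) :
    ‖zetaSqDefect N (-1 / 2 + y * Complex.I)‖ ≤
      (9 / 4 + y ^ 2) * ((1 / 4 + y ^ 2) * ‖dirichletSeries (divisorTail N) y‖ +
        ‖dirichletSeries (divisorHead N (-(1 / 2))) y‖) := by
  have hre : (-1 / 2 + y * Complex.I : ℂ).re = -1 / 2 := by norm_num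
  have hz : (-1 / 2 + y * Complex.I : ℂ) ≠ 1 := fun h => by
    rw [h] at hre
    norm_num at hre
  have hz0 : (-1 / 2 + y * Complex.I : ℂ) ≠ 0 := fun h => by
    rw [h] at hre
    norm_num at hre
  have h1 : ‖(-1 / 2 + y * Complex.I - 1 : ℂ)‖ ^ 2 = 9 / 4 + y ^ 2 := by
    have := norm_sq_add_mul_I (-3 / 2) y
    rw [show (-1 / 2 + y * Complex.I - 1 : ℂ) = ((-3 / 2 : ℝ) : ℂ) + y * Complex.I by
      push_cast; ring, this]
    ring
  have h2 : ‖(1 / 2 - y * Complex.I : ℂ)‖ ^ 2 = 1 / 4 + y ^ 2 := by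
    have := norm_sq_add_mul_I (1 / 2) (-y)
    rw [show (1 / 2 - y * Complex.I : ℂ) = ((1 / 2 : ℝ) : ℂ) + (-y : ℝ) * Complex.I by
      push_cast; ring, this]
    ring
  have h3 : ‖zetaChi (-1 / 2 + y * Complex.I)‖ ^ 2 ≤ 1 / 4 + y ^ 2 := by
    rw [← h2]
    gcongr
    exact norm_zetaChi_left y
  have h4 : (1 - (-1 / 2 + y * Complex.I) : ℂ) = 3 / 2 + ((-y : ℝ) : ℂ) * Complex.I := by
    push_cast
    ring
  have h5 : divisorPoly N (-1 / 2 + y * Complex.I) =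
      dirichletSeries (divisorHead N (-(1 / 2))) y := by
    rw [← divisorPoly_eq]
    congr 1
    push_cast
    ring
  have h6 : riemannZeta (-1 / 2 + y * Complex.I) ^ 2 - divisorPoly N (-1 / 2 + y * Complex.I) -
      zetaChi (-1 / 2 + y * Complex.I) ^ 2 * divisorPoly N (1 - (-1 / 2 + y * Complex.I)) =
      zetaChi (-1 / 2 + y * Complex.I) ^ 2 * dirichletSeries (divisorTail N) (-y) -
        dirichletSeries (divisorHead N (-(1 / 2))) y := by
    rw [riemannZeta_eq_zetaChi_mul (by rw [hre]; norm_num) hz0, h4,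
      ← riemannZeta_sq_sub_divisorPoly, h5]
    ring
  rw [zetaSqDefect_eq N hz, h6, norm_mul, norm_pow, h1]
  gcongr
  refine (norm_sub_le _ _).trans ?_
  rw [norm_mul, norm_pow, norm_dirichletSeries_neg]
  gcongr

end ApproximateFunctionalEquationBound

section ApproximateFunctionalEquationPointwise

lemma one_add_sq_pow_mul_exp_le (v : ℝ) :
    (1 + v ^ 2) ^ 2 * Real.exp (1 - v ^ 2) ≤ 48 * Real.exp (-(1 / 2) * v ^ 2) := by
  have h1 : 1 + v ^ 2 ≤ 4 * Real.exp (v ^ 2 / 4) := by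
    have := Real.add_one_le_exp (v ^ 2 / 4)
    nlinarith [sq_nonneg v]
  have h2 : (1 + v ^ 2) ^ 2 ≤ 16 * Real.exp (v ^ 2 / 2) := by
    calc (1 + v ^ 2) ^ 2 ≤ (4 * Real.exp (v ^ 2 / 4)) ^ 2 := by gcongr
      _ = 16 * Real.exp (v ^ 2 / 2) := by
        rw [mul_pow, ← Real.exp_nat_mul]
        push_cast
        ring_nf
  have h3 : Real.exp (1 - v ^ 2) = Real.exp 1 * Real.exp (-v ^ 2) := by
    rw [← Real.exp_add]; ring_nf
  calc (1 + v ^ 2) ^ 2 * Real.exp (1 - v ^ 2) ≤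
        (16 * Real.exp (v ^ 2 / 2)) * (3 * Real.exp (-v ^ 2)) := by
        rw [h3]
        gcongr
        exact Real.exp_one_lt_three.le
    _ = 48 * (Real.exp (v ^ 2 / 2) * Real.exp (-v ^ 2)) := by ring
    _ = _ := by rw [← Real.exp_add]; ring_nf

lemma re_add_mul_I_sq (x v : ℝ) : ((((x : ℂ) + v * Complex.I)) ^ 2).re = x ^ 2 - v ^ 2 := by
  rw [sq, Complex.mul_re]
  simp
  ring

lemma shifted_weight_right_le {N T t v A B z : ℝ} (hT : 2 ≤ T) (hN : N ≤ T) (hN0 : 0 ≤ N)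
    (h1 : T ≤ t) (hA : 0 ≤ A) (hB : 0 ≤ B) (hz : z ≤ (1 / 4 + (t + v) ^ 2) * A + 49 * B) :
    z * N * Real.exp (1 - v ^ 2) / (1 / 4 + t ^ 2) ≤
      48 * Real.exp (-(1 / 2) * v ^ 2) * (49 * (T * A + T⁻¹ * B)) := by
  have hT0 : 0 < T := by linarith
  have ht2 : 1 ≤ t ^ 2 := by nlinarith
  have k1 : (1 / 4 + (t + v) ^ 2) * N ≤ 49 * T * ((1 + v ^ 2) ^ 2 * (1 / 4 + t ^ 2)) := by
    have a0 : 1 / 4 + (t + v) ^ 2 ≤ 3 * ((1 + v ^ 2) * (1 / 4 + t ^ 2)) := by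
      nlinarith [sq_nonneg (t - v), sq_nonneg v, sq_nonneg (v * t)]
    have a2 : (1 + v ^ 2) * 1 ≤ (1 + v ^ 2) * (1 + v ^ 2) := by
      gcongr
      linarith [sq_nonneg v]
    have a1 : 1 / 4 + (t + v) ^ 2 ≤ 49 * ((1 + v ^ 2) ^ 2 * (1 / 4 + t ^ 2)) := by
      calc 1 / 4 + (t + v) ^ 2 ≤ 3 * ((1 + v ^ 2) * 1 * (1 / 4 + t ^ 2)) := by rwa [mul_one]
        _ ≤ 49 * ((1 + v ^ 2) * (1 + v ^ 2) * (1 / 4 + t ^ 2)) := by gcongr; norm_num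
        _ = _ := by ring
    calc (1 / 4 + (t + v) ^ 2) * N ≤ (49 * ((1 + v ^ 2) ^ 2 * (1 / 4 + t ^ 2))) * T := by
          gcongr
      _ = _ := by ring
  have k2 : 49 * N ≤ 49 * T⁻¹ * ((1 + v ^ 2) ^ 2 * (1 / 4 + t ^ 2)) := by
    have a1 : 1 ≤ (1 + v ^ 2) ^ 2 := one_le_pow₀ (by linarith [sq_nonneg v])
    have a2 : T * N ≤ 1 * (1 / 4 + t ^ 2) := by nlinarith
    have a3 : T * N ≤ (1 + v ^ 2) ^ 2 * (1 / 4 + t ^ 2) := a2.trans (by gcongr)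
    rw [mul_assoc, inv_mul_eq_div]
    gcongr
    rw [le_div_iff₀ hT0]
    linarith
  rw [div_le_iff₀ (by positivity)]
  calc z * N * Real.exp (1 - v ^ 2) ≤
      ((1 / 4 + (t + v) ^ 2) * A + 49 * B) * N * Real.exp (1 - v ^ 2) := by gcongr
    _ = (((1 / 4 + (t + v) ^ 2) * N) * A + (49 * N) * B) * Real.exp (1 - v ^ 2) := by ring
    _ ≤ ((49 * T * ((1 + v ^ 2) ^ 2 * (1 / 4 + t ^ 2))) * A +
        (49 * T⁻¹ * ((1 + v ^ 2) ^ 2 * (1 / 4 + t ^ 2))) * B) * Real.exp (1 - v ^ 2) := by gcongr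
    _ = ((1 + v ^ 2) ^ 2 * Real.exp (1 - v ^ 2)) *
        (49 * (T * A + T⁻¹ * B) * (1 / 4 + t ^ 2)) := by ring
    _ ≤ (48 * Real.exp (-(1 / 2) * v ^ 2)) * (49 * (T * A + T⁻¹ * B) * (1 / 4 + t ^ 2)) := by
        gcongr ?_ * _
        exact one_add_sq_pow_mul_exp_le v
    _ = _ := by ring

lemma shifted_weight_left_le {N T t v A B z : ℝ} (hT : 2 ≤ T) (hN : T ≤ 2 * N)
    (h1 : T ≤ t) (h2 : t ≤ 2 * T) (hA : 0 ≤ A) (hB : 0 ≤ B)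
    (hz : z ≤ (9 / 4 + (t + v) ^ 2) * ((1 / 4 + (t + v) ^ 2) * A + B)) :
    z * N⁻¹ * Real.exp (1 - v ^ 2) / (1 / 4 + t ^ 2) ≤
      48 * Real.exp (-(1 / 2) * v ^ 2) * (216 * (T * A + T⁻¹ * B)) := by
  have hT0 : 0 < T := by linarith
  have hN0 : 0 < N := by linarith
  have ht2 : 4 ≤ t ^ 2 := by nlinarith
  have hNi : N⁻¹ ≤ 2 * T⁻¹ := by
    rw [inv_le_comm₀ hN0 (by positivity), mul_inv, inv_inv]
    linarith
  have b0 : 9 / 4 + (t + v) ^ 2 ≤ 9 * ((1 + v ^ 2) * (1 / 4 + t ^ 2)) := by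
    nlinarith [sq_nonneg (t - v), sq_nonneg v, sq_nonneg (v * t)]
  have b1 : 1 / 4 + (t + v) ^ 2 ≤ 12 * T ^ 2 * (1 + v ^ 2) := by
    have a1 : t ^ 2 ≤ 4 * T ^ 2 := by nlinarith
    have a2 : 4 ≤ T ^ 2 := by nlinarith
    have a3 : 4 * v ^ 2 ≤ T ^ 2 * v ^ 2 := by gcongr
    nlinarith [sq_nonneg (t - v), sq_nonneg v]
  rw [div_le_iff₀ (by positivity)]
  calc z * N⁻¹ * Real.exp (1 - v ^ 2) ≤
      ((9 / 4 + (t + v) ^ 2) * ((1 / 4 + (t + v) ^ 2) * A + B)) *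
        (2 * T⁻¹) * Real.exp (1 - v ^ 2) := by gcongr
    _ ≤ ((9 * ((1 + v ^ 2) * (1 / 4 + t ^ 2))) * ((12 * T ^ 2 * (1 + v ^ 2)) * A +
        (12 * (1 + v ^ 2)) * B)) * (2 * T⁻¹) * Real.exp (1 - v ^ 2) := by
        gcongr
        exact le_mul_of_one_le_left hB (by linarith [sq_nonneg v])
    _ = ((1 + v ^ 2) ^ 2 * Real.exp (1 - v ^ 2)) *
        (216 * (T * A + T⁻¹ * B) * (1 / 4 + t ^ 2)) := by
        field_simp
        ring
    _ ≤ (48 * Real.exp (-(1 / 2) * v ^ 2)) *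
        (216 * (T * A + T⁻¹ * B) * (1 / 4 + t ^ 2)) := by
        gcongr ?_ * _
        exact one_add_sq_pow_mul_exp_le v
    _ = _ := by ring

set_option maxHeartbeats 800000 in
/-- A smoothed approximate functional equation for `ζ²` on the critical line. -/
lemma norm_riemannZeta_sq_le {N : ℕ} {T t : ℝ} (hT : 2 ≤ T) (hN : (N : ℝ) ≤ T) (hN' : T ≤ 2 * N)
    (h1 : T ≤ t) (h2 : t ≤ 2 * T) :
    ‖riemannZeta (1 / 2 + t * Complex.I)‖ ^ 2 ≤
      2 * ‖dirichletSeries (divisorHead N (1 / 2)) t‖ +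
        ∫ v : ℝ, (18000 * Real.exp (-(1 / 2) * v ^ 2)) *
          (T * ‖dirichletSeries (divisorTail N) (t + v)‖ +
            T⁻¹ * ‖dirichletSeries (divisorHead N (-(1 / 2))) (t + v)‖) := by
  have hT0 : 0 < T := by linarith
  have ht0 : 0 < t := by linarith
  have hN1 : 1 ≤ N := by
    have : (0 : ℝ) < N := by linarith
    exact_mod_cast this
  have hNpos : (1 : ℝ) ≤ N := by exact_mod_cast hN1
  have hNC : (N : ℂ) ≠ 0 := by exact_mod_cast (by lia : N ≠ 0)
  set s : ℂ := 1 / 2 + t * Complex.I with hs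
  have hs1 : s ≠ 1 := fun h => by
    have := congrArg Complex.re h
    norm_num [hs] at this
  have hsn : ‖(s - 1) ^ 2‖ = 1 / 4 + t ^ 2 := by
    have := norm_sq_add_mul_I (-1 / 2) t
    rw [norm_pow, hs, show (1 / 2 + t * Complex.I - 1 : ℂ) = ((-1 / 2 : ℝ) : ℂ) + t * Complex.I by
      push_cast; ring, this]
    ring
  have hs2 : (s - 1) ^ 2 ≠ 0 := pow_ne_zero 2 (sub_ne_zero.2 hs1)
  set h : ℂ → ℂ := fun w => zetaSqDefect N (s + w) * (N : ℂ) ^ w * Complex.exp (w ^ 2) / (s - 1) ^ 2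
    with hh
  have hd : DifferentiableOn ℂ h {w | w.re < 3 / 2} := by
    have d1 : DifferentiableOn ℂ (fun w => zetaSqDefect N (s + w)) {w | w.re < 3 / 2} := by
      refine (differentiableOn_zetaSqDefect N).comp (by fun_prop) fun w hw => ?_
      simp only [Set.mem_ofPred_eq] at hw ⊢
      norm_num [hs]
      linarith
    have d2 : Differentiable ℂ fun w : ℂ => (N : ℂ) ^ w :=
      Differentiable.const_cpow (by fun_prop) (Or.inl hNC)
    have d3 : Differentiable ℂ fun w : ℂ => Complex.exp (w ^ 2) := by fun_prop
    exact ((d1.mul d2.differentiableOn).mul d3.differentiableOn).div_const _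
  have hnorm : ∀ x v : ℝ, ‖h ((x : ℂ) + v * Complex.I)‖ =
      ‖zetaSqDefect N ((1 / 2 + x : ℝ) + (t + v : ℝ) * Complex.I)‖ * (N : ℝ) ^ x *
        Real.exp (x ^ 2 - v ^ 2) / (1 / 4 + t ^ 2) := by
    intro x v
    rw [hh]
    simp only
    rw [norm_div, norm_mul, norm_mul, hsn, Complex.norm_exp, re_add_mul_I_sq,
      Complex.norm_natCast_cpow_of_pos (by lia), show ((x : ℂ) + v * Complex.I).re = x by simp,
      show s + ((x : ℂ) + v * Complex.I) = (1 / 2 + x : ℝ) + (t + v : ℝ) * Complex.I by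
        rw [hs]; push_cast; ring]
  obtain ⟨C, hC0, hC⟩ := exists_norm_zetaSqDefect_le N
  have hb : ∀ v : ℝ, ∀ x ∈ Set.Icc (-1 : ℝ) 1, ‖h ((x : ℂ) + v * Complex.I)‖ ≤
      (C * Real.exp (8 * t + 33) * N) * Real.exp (-(1 / 2) * v ^ 2) := by
    intro v x hx
    rw [hnorm]
    have e1 := hC ((1 / 2 + x : ℝ) + (t + v : ℝ) * Complex.I) (by
      rw [Complex.add_re, Complex.ofReal_re, Complex.re_ofReal_mul, Complex.I_re, mul_zero]
      linarith [hx.1]) (by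
      rw [Complex.add_re, Complex.ofReal_re, Complex.re_ofReal_mul, Complex.I_re, mul_zero]
      linarith [hx.2])
    rw [Complex.add_im, Complex.ofReal_im, Complex.im_ofReal_mul, Complex.I_im, mul_one,
      zero_add] at e1
    have e2 : (N : ℝ) ^ x ≤ N := by
      calc (N : ℝ) ^ x ≤ (N : ℝ) ^ (1 : ℝ) := Real.rpow_le_rpow_of_exponent_le hNpos hx.2
        _ = N := Real.rpow_one _
    have e3 : Real.exp (8 * |t + v|) * Real.exp (x ^ 2 - v ^ 2) ≤
        Real.exp (8 * t + 33) * Real.exp (-(1 / 2) * v ^ 2) := by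
      rw [← Real.exp_add, ← Real.exp_add, Real.exp_le_exp]
      have a1 : |t + v| ≤ t + |v| := (abs_add_le _ _).trans (by rw [abs_of_pos ht0])
      have a2 : x ^ 2 ≤ 1 := by rw [sq_le_one_iff_abs_le_one]; exact abs_le.2 hx
      nlinarith [sq_nonneg (|v| - 8), sq_abs v]
    have e4 : (1 : ℝ) ≤ 1 / 4 + t ^ 2 := by nlinarith
    calc ‖zetaSqDefect N ((1 / 2 + x : ℝ) + (t + v : ℝ) * Complex.I)‖ * (N : ℝ) ^ x *
        Real.exp (x ^ 2 - v ^ 2) / (1 / 4 + t ^ 2) ≤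
        ‖zetaSqDefect N ((1 / 2 + x : ℝ) + (t + v : ℝ) * Complex.I)‖ * (N : ℝ) ^ x *
        Real.exp (x ^ 2 - v ^ 2) := div_le_self (by positivity) e4
      _ ≤ (C * Real.exp (8 * |t + v|)) * N * Real.exp (x ^ 2 - v ^ 2) := by gcongr
      _ = C * N * (Real.exp (8 * |t + v|) * Real.exp (x ^ 2 - v ^ 2)) := by ring
      _ ≤ C * N * (Real.exp (8 * t + 33) * Real.exp (-(1 / 2) * v ^ 2)) := by gcongr
      _ = _ := by ring
  obtain ⟨i1, i2, hle⟩ := norm_le_integral_vertical hd hb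
  set D₁ := fun y : ℝ => ‖dirichletSeries (divisorTail N) y‖ with hD₁
  set D₂ := fun y : ℝ => ‖dirichletSeries (divisorHead N (-(1 / 2))) y‖ with hD₂
  have hc1 : Continuous D₁ :=
    (continuous_dirichletSeries (by simp [divisorTail]) (summable_divisorTail N)).norm
  have hc2 : Continuous D₂ :=
    (continuous_dirichletSeries (by simp [divisorHead, dk_zero_right])
      (summable_divisorHead N _)).norm
  have n1 : ∀ y, 0 ≤ D₁ y := fun y => norm_nonneg _
  have n2 : ∀ y, 0 ≤ D₂ y := fun y => norm_nonneg _
  have right : ∀ v : ℝ, ‖h (1 + v * Complex.I)‖ ≤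
      48 * Real.exp (-(1 / 2) * v ^ 2) * (49 * (T * D₁ (t + v) + T⁻¹ * D₂ (t + v))) := by
    intro v
    have e0 := hnorm 1 v
    rw [Complex.ofReal_one] at e0
    rw [e0]
    have e1 := norm_zetaSqDefect_right N (t + v)
    rw [show ((1 / 2 + 1 : ℝ) : ℂ) = 3 / 2 by norm_num, Real.rpow_one, one_pow]
    exact shifted_weight_right_le hT hN (by linarith) h1 (n1 _) (n2 _) e1
  have left : ∀ v : ℝ, ‖h (-1 + v * Complex.I)‖ ≤
      48 * Real.exp (-(1 / 2) * v ^ 2) * (216 * (T * D₁ (t + v) + T⁻¹ * D₂ (t + v))) := by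
    intro v
    have e0 := hnorm (-1) v
    push_cast at e0
    rw [e0]
    have e1 := norm_zetaSqDefect_left N (t + v)
    push_cast at e1
    rw [show (1 / 2 + -1 : ℂ) = -1 / 2 by norm_num, Real.rpow_neg_one,
      show ((-1 : ℝ)) ^ 2 - v ^ 2 = 1 - v ^ 2 by norm_num]
    exact shifted_weight_left_le hT hN' h1 h2 (n1 _) (n2 _) e1
  have hint : MeasureTheory.Integrable fun v : ℝ => (18000 * Real.exp (-(1 / 2) * v ^ 2)) *
      (T * D₁ (t + v) + T⁻¹ * D₂ (t + v)) := by
    refine MeasureTheory.Integrable.mul_bdd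
      (c := T * (∑' n, ‖divisorTail N n‖) + T⁻¹ * ∑' n, ‖divisorHead N (-(1 / 2)) n‖)
      ((integrable_exp_neg_mul_sq (by norm_num)).const_mul _)
      (by fun_prop : Continuous _).aestronglyMeasurable ?_
    refine Filter.Eventually.of_forall fun v => ?_
    have := n1 (t + v)
    have := n2 (t + v)
    rw [Real.norm_of_nonneg (by positivity)]
    gcongr
    · exact norm_dirichletSeries_le (summable_divisorTail N) _
    · exact norm_dirichletSeries_le (summable_divisorHead N _) _
  have hsum : ‖h 0‖ ≤ ∫ v : ℝ, (18000 * Real.exp (-(1 / 2) * v ^ 2)) *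
      (T * D₁ (t + v) + T⁻¹ * D₂ (t + v)) := by
    refine hle.trans ?_
    rw [← MeasureTheory.integral_add i1 i2]
    refine MeasureTheory.integral_mono (i1.add i2) hint fun v => ?_
    have a1 := right v
    have a2 := left v
    have := n1 (t + v)
    have := n2 (t + v)
    have a3 : 0 ≤ Real.exp (-(1 / 2) * v ^ 2) * (T * D₁ (t + v) + T⁻¹ * D₂ (t + v)) := by
      positivity
    simp only
    nlinarith
  have hh0 : h 0 = riemannZeta s ^ 2 - divisorPoly N s - zetaChi s ^ 2 * divisorPoly N (1 - s) := by
    rw [hh]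
    simp only
    rw [add_zero, Complex.cpow_zero, zetaSqDefect_eq N hs1]
    simp only [ne_eq, OfNat.ofNat_ne_zero, not_false_eq_true, zero_pow, Complex.exp_zero, mul_one]
    field_simp
  have p1 : divisorPoly N s = dirichletSeries (divisorHead N (1 / 2)) t := by
    rw [← divisorPoly_eq, hs]
    push_cast
    rfl
  have p2 : divisorPoly N (1 - s) = dirichletSeries (divisorHead N (1 / 2)) (-t) := by
    rw [← divisorPoly_eq, hs]
    congr 1
    push_cast
    ring
  have hfin : riemannZeta s ^ 2 =
      h 0 + divisorPoly N s + zetaChi s ^ 2 * divisorPoly N (1 - s) := by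
    rw [hh0]
    ring
  rw [← norm_pow, hfin]
  refine (norm_add₃_le).trans ?_
  rw [norm_mul, norm_pow, hs, norm_zetaChi_critical, ← hs, p1, p2, norm_dirichletSeries_neg]
  linarith

end ApproximateFunctionalEquationPointwise

section ConvolutionMeanSquare

open MeasureTheory

variable {k g : ℝ → ℝ} {B : ℝ}

lemma integrable_mul_comp_add (hk : Integrable k) (hg : Continuous g) (hB : ∀ v, ‖g v‖ ≤ B)
    (t : ℝ) : Integrable fun v => k v * g (t + v) :=
  hk.mul_bdd (c := B) (by fun_prop : Continuous fun v => g (t + v)).aestronglyMeasurable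
    (Filter.Eventually.of_forall fun _ => hB _)

lemma continuous_integral_mul_comp_add (hk : Integrable k) (hg : Continuous g)
    (hB : ∀ v, ‖g v‖ ≤ B) : Continuous fun t => ∫ v, k v * g (t + v) := by
  refine continuous_of_dominated (bound := fun v => ‖k v‖ * B)
    (fun t => (integrable_mul_comp_add hk hg hB t).aestronglyMeasurable)
    (fun t => Filter.Eventually.of_forall fun v => ?_) (hk.norm.mul_const _)
    (Filter.Eventually.of_forall fun v => by fun_prop)
  rw [norm_mul]
  exact mul_le_mul_of_nonneg_left (hB _) (norm_nonneg _)

lemma sq_integral_mul_le (hk0 : ∀ v, 0 ≤ k v) (h1 : Integrable k)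
    (h2 : Integrable fun v => k v * g v) (h3 : Integrable fun v => k v * g v ^ 2) :
    (∫ v, k v * g v) ^ 2 ≤ (∫ v, k v) * ∫ v, k v * g v ^ 2 := by
  set K := ∫ v, k v
  set P := ∫ v, k v * g v
  set Q := ∫ v, k v * g v ^ 2
  have key : ∀ x : ℝ, 0 ≤ K * (x * x) + (-2 * P) * x + Q := by
    intro x
    have h4 : Integrable fun v => k v * (x * x) + k v * g v * (-2 * x) :=
      (h1.mul_const _).add (h2.mul_const _)
    have : K * (x * x) + (-2 * P) * x + Q = ∫ v, k v * (g v - x) ^ 2 := by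
      rw [show (fun v => k v * (g v - x) ^ 2) =
        fun v => (k v * (x * x) + k v * g v * (-2 * x)) + k v * g v ^ 2 by ext v; ring,
        integral_add h4 h3,
        integral_add (h1.mul_const _) (h2.mul_const _), integral_mul_const, integral_mul_const]
      ring
    rw [this]
    exact integral_nonneg fun v => mul_nonneg (hk0 v) (sq_nonneg _)
  have := discrim_le_zero key
  rw [discrim] at this
  linarith

/-- The mean square of a convolution with a nonnegative kernel. -/
lemma integral_sq_convolution_le {T M : ℝ} (hT : 0 ≤ T) (hk0 : ∀ v, 0 ≤ k v) (hk : Integrable k)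
    (hg : Continuous g) (hB : ∀ v, ‖g v‖ ≤ B)
    (hM : ∀ v, ∫ t in T..2 * T, g (t + v) ^ 2 ≤ M) :
    ∫ t in T..2 * T, (∫ v, k v * g (t + v)) ^ 2 ≤ (∫ v, k v) ^ 2 * M := by
  have hB2 : ∀ v, ‖g v ^ 2‖ ≤ B ^ 2 := fun v => by
    rw [norm_pow]
    exact pow_le_pow_left₀ (norm_nonneg _) (hB v) 2
  have hg2 : Continuous fun v => g v ^ 2 := hg.pow 2
  have hTT : T ≤ 2 * T := by linarith
  have hK0 : 0 ≤ ∫ v, k v := integral_nonneg hk0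
  have hswap : Integrable (Function.uncurry fun t v => k v * g (t + v) ^ 2)
      ((volume.restrict (Set.uIoc T (2 * T))).prod volume) := by
    have hone : Integrable (fun _ : ℝ => (1 : ℝ)) (volume.restrict (Set.uIoc T (2 * T))) := by
      rw [Set.uIoc_of_le hTT]
      exact integrableOn_const (by simp)
    have h1 := hone.mul_prod hk
    have h2 := h1.mul_bdd (c := B ^ 2) (g := fun z : ℝ × ℝ => g (z.1 + z.2) ^ 2)
      (by fun_prop : Continuous fun z : ℝ × ℝ => g (z.1 + z.2) ^ 2).aestronglyMeasurable
      (Filter.Eventually.of_forall fun _ => hB2 _)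
    refine h2.congr (Filter.Eventually.of_forall fun z => ?_)
    simp [Function.uncurry]
  calc ∫ t in T..2 * T, (∫ v, k v * g (t + v)) ^ 2 ≤
      ∫ t in T..2 * T, (∫ v, k v) * ∫ v, k v * g (t + v) ^ 2 := by
        refine intervalIntegral.integral_mono_on hTT
          (((continuous_integral_mul_comp_add hk hg hB).pow 2).intervalIntegrable _ _)
          ((continuous_const.mul
            (continuous_integral_mul_comp_add hk hg2 hB2)).intervalIntegrable _ _) fun t _ => ?_
        exact sq_integral_mul_le hk0 hk (integrable_mul_comp_add hk hg hB t)
          (integrable_mul_comp_add hk hg2 hB2 t)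
    _ = (∫ v, k v) * ∫ v, k v * ∫ t in T..2 * T, g (t + v) ^ 2 := by
        rw [intervalIntegral.integral_const_mul, intervalIntegral_integral_swap hswap]
        simp_rw [intervalIntegral.integral_const_mul]
    _ ≤ (∫ v, k v) * ∫ v, k v * M := by
        refine mul_le_mul_of_nonneg_left ?_ hK0
        refine integral_mono_of_nonneg (Filter.Eventually.of_forall fun v => ?_)
          (hk.mul_const _) (Filter.Eventually.of_forall fun v => ?_)
        · exact mul_nonneg (hk0 v) (intervalIntegral.integral_nonneg hTT fun t _ => sq_nonneg _)
        · exact mul_le_mul_of_nonneg_left (hM v) (hk0 v)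
    _ = _ := by
        rw [integral_mul_const]
        ring

lemma integral_norm_dirichletSeries_sq_le {T : ℝ} (hT : 2 ≤ T) {c : ℕ → ℝ} (h0 : c 0 = 0)
    (hc : Summable fun n => ‖c n‖) {Q δ : ℝ} (hδ : 0 < δ)
    (hQ : ∀ n : ℕ, n ≠ 0 → c n ^ 2 * (T + n) ≤ Q * (n : ℝ) ^ (-(1 + δ))) (v : ℝ) :
    ∫ t in T..2 * T, ‖dirichletSeries c (t + v)‖ ^ 2 ≤
      mvConst * (Q * ∑' n : ℕ, (n : ℝ) ^ (-(1 + δ))) := by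
  have hs : Summable fun n : ℕ => (n : ℝ) ^ (-(1 + δ)) :=
    Real.summable_nat_rpow.2 (by linarith)
  have hq : ∀ n : ℕ, c n ^ 2 * (T + n) ≤ Q * (n : ℝ) ^ (-(1 + δ)) := fun n => by
    rcases eq_or_ne n 0 with rfl | hn
    · rw [h0, Nat.cast_zero, Real.zero_rpow (by linarith)]
      simp
    · exact hQ n hn
  set a : ℕ → ℂ := fun n => (c n : ℂ) * (n : ℂ) ^ (-(v : ℂ) * Complex.I) with ha
  have hle : ∀ n, ‖a n‖ ≤ ‖c n‖ := fun n => by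
    rw [ha]
    simp only
    rw [norm_mul, Complex.norm_real]
    exact mul_le_of_le_one_right (norm_nonneg _) (norm_natCast_cpow_mul_I_le_one n v)
  have hle2 : ∀ n : ℕ, ‖a n‖ ^ 2 * (T + n) ≤ Q * (n : ℝ) ^ (-(1 + δ)) := fun n => by
    refine le_trans ?_ (hq n)
    have := pow_le_pow_left₀ (norm_nonneg _) (hle n) 2
    rw [← sq_abs (c n)]
    exact mul_le_mul_of_nonneg_right this (by positivity)
  have h1 : ∀ t : ℝ, dirichletSeries c (t + v) =
      ∑' n : ℕ, a n * (n : ℂ) ^ (-(t : ℂ) * Complex.I) := fun t => by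
    refine tsum_congr fun n => ?_
    rcases eq_or_ne n 0 with rfl | hn
    · simp [ha, h0]
    · rw [ha]
      simp only
      rw [mul_assoc, ← Complex.cpow_add _ _ (by exact_mod_cast hn)]
      congr 2
      push_cast
      ring
  simp_rw [h1]
  have hs2 : Summable fun n : ℕ => ‖a n‖ ^ 2 * (T + n) :=
    Summable.of_nonneg_of_le (fun n => by positivity) hle2 (hs.mul_left Q)
  refine (mean_value_tsum hT a (by simp [ha, h0])
    (Summable.of_nonneg_of_le (fun _ => norm_nonneg _) hle hc) hs2).trans ?_
  refine mul_le_mul_of_nonneg_left ?_ mvConst_nonneg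
  rw [← tsum_mul_left]
  exact hs2.tsum_le_tsum hle2 (hs.mul_left Q)

end ConvolutionMeanSquare

section FourthMoment

lemma exists_divisorHead_sq_le {δ : ℝ} (hδ : 0 < δ) :
    ∃ C : ℝ, 0 < C ∧ ∀ (N : ℕ) (T σ : ℝ), 2 ≤ T → (N : ℝ) ≤ T → σ ≤ 1 / 2 → ∀ n : ℕ, n ≠ 0 →
      divisorHead N σ n ^ 2 * (T + n) ≤
        C * T ^ (2 - 2 * σ + 3 * δ) * (n : ℝ) ^ (-(1 + δ)) := by
  obtain ⟨C, hC, h⟩ := dk_le_rpow 2 hδ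
  refine ⟨2 * C ^ 2, by positivity, fun N T σ hT hN hσ n hn => ?_⟩
  have hT0 : 0 < T := by linarith
  rw [divisorHead]
  split_ifs with hnN
  · have hn0 : (0 : ℝ) < n := by positivity
    have hnT : (n : ℝ) ≤ T := le_trans (by exact_mod_cast hnN) hN
    calc ((dk 2 n : ℝ) * (n : ℝ) ^ (-σ)) ^ 2 * (T + n) ≤
        ((C * (n : ℝ) ^ δ) * (n : ℝ) ^ (-σ)) ^ 2 * (T + T) := by
          gcongr
          exact h n hn
      _ = 2 * C ^ 2 * T * ((n : ℝ) ^ δ * (n : ℝ) ^ (-σ) * ((n : ℝ) ^ δ * (n : ℝ) ^ (-σ))) := by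
          ring
      _ = 2 * C ^ 2 * T * ((n : ℝ) ^ (1 - 2 * σ + 3 * δ) * (n : ℝ) ^ (-(1 + δ))) := by
          rw [← Real.rpow_add hn0, ← Real.rpow_add hn0, ← Real.rpow_add hn0]
          ring_nf
      _ ≤ 2 * C ^ 2 * T * (T ^ (1 - 2 * σ + 3 * δ) * (n : ℝ) ^ (-(1 + δ))) := by
          have : (n : ℝ) ^ (1 - 2 * σ + 3 * δ) ≤ T ^ (1 - 2 * σ + 3 * δ) :=
            Real.rpow_le_rpow hn0.le hnT (by linarith)
          gcongr
      _ = 2 * C ^ 2 * (T ^ (1 : ℝ) * T ^ (1 - 2 * σ + 3 * δ)) * (n : ℝ) ^ (-(1 + δ)) := by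
          rw [Real.rpow_one]
          ring
      _ = _ := by
          rw [← Real.rpow_add hT0]
          ring_nf
  · rw [zero_pow two_ne_zero, zero_mul]
    positivity

lemma exists_divisorTail_sq_le {δ : ℝ} (hδ : 0 < δ) (hδ' : 3 * δ ≤ 1) :
    ∃ C : ℝ, 0 < C ∧ ∀ (N : ℕ) (T : ℝ), 2 ≤ T → T ≤ 2 * N → ∀ n : ℕ, n ≠ 0 →
      divisorTail N n ^ 2 * (T + n) ≤ C * T ^ (3 * δ - 1) * (n : ℝ) ^ (-(1 + δ)) := by
  obtain ⟨C, hC, h⟩ := dk_le_rpow 2 hδ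
  refine ⟨6 * C ^ 2, by positivity, fun N T hT hN n hn => ?_⟩
  have hT0 : 0 < T := by linarith
  rw [divisorTail]
  split_ifs with hnN
  · rw [zero_pow two_ne_zero, zero_mul]
    positivity
  · have hn0 : (0 : ℝ) < n := by positivity
    have hnN' : (N : ℝ) ≤ n := by exact_mod_cast (not_le.1 hnN).le
    have hTn : T / 2 ≤ n := by linarith
    calc ((dk 2 n : ℝ) * (n : ℝ) ^ (-(3 / 2) : ℝ)) ^ 2 * (T + n) ≤
        ((C * (n : ℝ) ^ δ) * (n : ℝ) ^ (-(3 / 2) : ℝ)) ^ 2 * (2 * n + n) := by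
          gcongr
          · exact h n hn
          · linarith
      _ = 3 * C ^ 2 * ((n : ℝ) ^ δ * (n : ℝ) ^ (-(3 / 2) : ℝ) *
          ((n : ℝ) ^ δ * (n : ℝ) ^ (-(3 / 2) : ℝ)) * (n : ℝ) ^ (1 : ℝ)) := by
          rw [Real.rpow_one]
          ring
      _ = 3 * C ^ 2 * ((n : ℝ) ^ (3 * δ - 1) * (n : ℝ) ^ (-(1 + δ))) := by
          rw [← Real.rpow_add hn0, ← Real.rpow_add hn0, ← Real.rpow_add hn0, ← Real.rpow_add hn0]
          ring_nf
      _ ≤ 3 * C ^ 2 * ((2 * T ^ (3 * δ - 1)) * (n : ℝ) ^ (-(1 + δ))) := by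
          have h1 : (n : ℝ) ^ (3 * δ - 1) ≤ (T / 2) ^ (3 * δ - 1) :=
            Real.rpow_le_rpow_of_nonpos (by positivity) hTn (by linarith)
          have h2 : (T / 2) ^ (3 * δ - 1) ≤ 2 * T ^ (3 * δ - 1) := by
            rw [Real.div_rpow hT0.le two_pos.le, div_eq_mul_inv, ← Real.rpow_neg two_pos.le,
              mul_comm]
            gcongr
            calc (2 : ℝ) ^ (-(3 * δ - 1)) ≤ 2 ^ (1 : ℝ) :=
                  Real.rpow_le_rpow_of_exponent_le one_le_two (by linarith)
              _ = 2 := Real.rpow_one 2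
          gcongr
          exact h1.trans h2
      _ = _ := by ring

lemma continuousOn_riemannZeta_vertical (σ : ℝ) {s : Set ℝ} (hs : ∀ t ∈ s, t ≠ 0) :
    ContinuousOn (fun t : ℝ => riemannZeta ((σ : ℂ) + t * Complex.I)) s := by
  intro t ht
  have h1 : ((σ : ℂ) + t * Complex.I) ≠ 1 := fun h => by
    have := congrArg Complex.im h
    simp at this
    exact hs t ht this
  have h2 : ContinuousAt (fun t : ℝ => (σ : ℂ) + t * Complex.I) t := by fun_prop
  exact (ContinuousAt.comp (f := fun t : ℝ => (σ : ℂ) + t * Complex.I)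
    (differentiableAt_riemannZeta h1).continuousAt h2).continuousWithinAt

lemma sq_two_mul_add_le (x y : ℝ) : (2 * x + y) ^ 2 ≤ 8 * x ^ 2 + 2 * y ^ 2 := by
  nlinarith [sq_nonneg (2 * x - y)]

/-- The fourth moment of the zeta function on the critical line. -/
theorem exists_integral_norm_riemannZeta_pow_four_le {ε : ℝ} (hε : 0 < ε) :
    ∃ C : ℝ, 0 < C ∧ ∀ T : ℝ, 2 ≤ T →
      ∫ t in T..2 * T, ‖riemannZeta (1 / 2 + t * Complex.I)‖ ^ 4 ≤ C * T ^ (1 + ε) := by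
  set δ := min (ε / 3) (1 / 3) with hδdef
  have hδ : 0 < δ := by positivity
  have hδε : 3 * δ ≤ ε := by linarith [min_le_left (ε / 3) (1 / 3)]
  have hδ1 : 3 * δ ≤ 1 := by linarith [min_le_right (ε / 3) (1 / 3)]
  obtain ⟨C₁, hC₁, hHead⟩ := exists_divisorHead_sq_le hδ
  obtain ⟨C₂, hC₂, hTail⟩ := exists_divisorTail_sq_le hδ hδ1
  set Z := ∑' n : ℕ, (n : ℝ) ^ (-(1 + δ)) with hZ
  have hZ0 : 0 ≤ Z := tsum_nonneg fun n => by positivity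
  set k : ℝ → ℝ := fun v => 18000 * Real.exp (-(1 / 2) * v ^ 2) with hk
  have hk0 : ∀ v, 0 ≤ k v := fun v => by positivity
  have hki : MeasureTheory.Integrable k :=
    (integrable_exp_neg_mul_sq (by norm_num)).const_mul _
  set K := ∫ v, k v with hK
  have hmv := mvConst_pos
  set m := mvConst
  refine ⟨8 * (m * (C₁ * Z)) + 4 * K ^ 2 * (m * (C₂ * Z) + m * (C₁ * Z)) + 1, by positivity,
    fun T hT => ?_⟩
  have hT0 : 0 < T := by linarith
  have hTT : T ≤ 2 * T := by linarith
  set N := ⌊T⌋₊ with hNdef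
  have hN : (N : ℝ) ≤ T := Nat.floor_le hT0.le
  have hN' : T ≤ 2 * N := by
    have := Nat.lt_floor_add_one T
    rw [← hNdef] at this
    linarith
  have z1 : divisorHead N (1 / 2) 0 = 0 := by simp [divisorHead, dk_zero_right]
  have z2 : divisorHead N (-(1 / 2)) 0 = 0 := by simp [divisorHead, dk_zero_right]
  have z3 : divisorTail N 0 = 0 := by simp [divisorTail]
  set A := fun y : ℝ => ‖dirichletSeries (divisorHead N (1 / 2)) y‖ with hA
  set D₁ := fun y : ℝ => ‖dirichletSeries (divisorTail N) y‖ with hD₁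
  set D₂ := fun y : ℝ => ‖dirichletSeries (divisorHead N (-(1 / 2))) y‖ with hD₂
  have cA : Continuous A := (continuous_dirichletSeries z1 (summable_divisorHead N _)).norm
  have c1 : Continuous D₁ := (continuous_dirichletSeries z3 (summable_divisorTail N)).norm
  have c2 : Continuous D₂ := (continuous_dirichletSeries z2 (summable_divisorHead N _)).norm
  set g := fun y : ℝ => T * D₁ y + T⁻¹ * D₂ y with hg
  have cg : Continuous g := by fun_prop
  have n1 : ∀ y, 0 ≤ D₁ y := fun y => norm_nonneg _
  have n2 : ∀ y, 0 ≤ D₂ y := fun y => norm_nonneg _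
  have hgB : ∀ v, ‖g v‖ ≤ T * (∑' n, ‖divisorTail N n‖) +
      T⁻¹ * ∑' n, ‖divisorHead N (-(1 / 2)) n‖ := fun v => by
    have := n1 v
    have := n2 v
    rw [hg, Real.norm_of_nonneg (by positivity)]
    refine add_le_add (mul_le_mul_of_nonneg_left ?_ hT0.le)
      (mul_le_mul_of_nonneg_left ?_ (by positivity))
    · exact norm_dirichletSeries_le (summable_divisorTail N) _
    · exact norm_dirichletSeries_le (summable_divisorHead N _) _
  have mA : ∫ t in T..2 * T, A t ^ 2 ≤ m * (C₁ * Z) * T ^ (1 + 3 * δ) := by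
    have := integral_norm_dirichletSeries_sq_le hT z1 (summable_divisorHead N _) hδ
      (hHead N T (1 / 2) hT hN le_rfl) 0
    simp only [add_zero] at this
    refine this.trans (le_of_eq ?_)
    rw [show (2 - 2 * (1 / 2) + 3 * δ : ℝ) = 1 + 3 * δ by ring]
    ring
  have m1 : ∀ v, ∫ t in T..2 * T, D₁ (t + v) ^ 2 ≤ m * (C₂ * Z) * T ^ (3 * δ - 1) := fun v => by
    refine (integral_norm_dirichletSeries_sq_le hT z3 (summable_divisorTail N) hδ
      (hTail N T hT hN') v).trans (le_of_eq ?_)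
    ring
  have m2 : ∀ v, ∫ t in T..2 * T, D₂ (t + v) ^ 2 ≤ m * (C₁ * Z) * T ^ (3 + 3 * δ) := fun v => by
    refine (integral_norm_dirichletSeries_sq_le hT z2 (summable_divisorHead N _) hδ
      (hHead N T (-(1 / 2)) hT hN (by norm_num)) v).trans (le_of_eq ?_)
    rw [show (2 - 2 * (-(1 / 2)) + 3 * δ : ℝ) = 3 + 3 * δ by ring]
    ring
  have mg : ∀ v, ∫ t in T..2 * T, g (t + v) ^ 2 ≤
      2 * (m * (C₂ * Z) + m * (C₁ * Z)) * T ^ (1 + 3 * δ) := fun v => by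
    have e1 : T ^ 2 * T ^ (3 * δ - 1) = T ^ (1 + 3 * δ) := by
      rw [← Real.rpow_natCast, ← Real.rpow_add hT0]
      congr 1
      push_cast
      ring
    have e2 : T⁻¹ ^ 2 * T ^ (3 + 3 * δ) = T ^ (1 + 3 * δ) := by
      rw [inv_pow, ← Real.rpow_natCast, ← Real.rpow_neg hT0.le, ← Real.rpow_add hT0]
      congr 1
      push_cast
      ring
    calc ∫ t in T..2 * T, g (t + v) ^ 2 ≤
        ∫ t in T..2 * T, ((2 * T ^ 2) * D₁ (t + v) ^ 2 + (2 * T⁻¹ ^ 2) * D₂ (t + v) ^ 2) := by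
          refine intervalIntegral.integral_mono_on hTT
            ((by fun_prop : Continuous _).intervalIntegrable _ _)
            ((by fun_prop : Continuous _).intervalIntegrable _ _) fun t _ => ?_
          rw [hg]
          simp only
          nlinarith [sq_nonneg (T * D₁ (t + v) - T⁻¹ * D₂ (t + v))]
      _ = (2 * T ^ 2) * (∫ t in T..2 * T, D₁ (t + v) ^ 2) +
          (2 * T⁻¹ ^ 2) * ∫ t in T..2 * T, D₂ (t + v) ^ 2 := by
          rw [intervalIntegral.integral_add ((by fun_prop : Continuous _).intervalIntegrable _ _)
            ((by fun_prop : Continuous _).intervalIntegrable _ _),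
            intervalIntegral.integral_const_mul, intervalIntegral.integral_const_mul]
      _ ≤ (2 * T ^ 2) * (m * (C₂ * Z) * T ^ (3 * δ - 1)) +
          (2 * T⁻¹ ^ 2) * (m * (C₁ * Z) * T ^ (3 + 3 * δ)) := by
          gcongr
          · exact m1 v
          · exact m2 v
      _ = 2 * (m * (C₂ * Z) * (T ^ 2 * T ^ (3 * δ - 1)) +
          m * (C₁ * Z) * (T⁻¹ ^ 2 * T ^ (3 + 3 * δ))) := by ring
      _ = _ := by
          rw [e1, e2]
          ring
  have cI := continuous_integral_mul_comp_add hki cg hgB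
  have mI := integral_sq_convolution_le hT0.le hk0 hki cg hgB mg
  calc ∫ t in T..2 * T, ‖riemannZeta (1 / 2 + t * Complex.I)‖ ^ 4 ≤
      ∫ t in T..2 * T, (8 * A t ^ 2 + 2 * (∫ v, k v * g (t + v)) ^ 2) := by
        refine intervalIntegral.integral_mono_on hTT ?_
          ((by fun_prop : Continuous _).intervalIntegrable _ _) fun t ht => ?_
        · refine ContinuousOn.intervalIntegrable (ContinuousOn.pow (ContinuousOn.norm ?_) 4)
          have := continuousOn_riemannZeta_vertical (1 / 2) (s := Set.uIcc T (2 * T)) fun t ht => by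
            rw [Set.uIcc_of_le hTT] at ht
            linarith [ht.1]
          push_cast at this
          exact this
        · have h1 := norm_riemannZeta_sq_le hT hN hN' ht.1 ht.2
          calc ‖riemannZeta (1 / 2 + t * Complex.I)‖ ^ 4 =
              (‖riemannZeta (1 / 2 + t * Complex.I)‖ ^ 2) ^ 2 := by ring
            _ ≤ (2 * A t + ∫ v, k v * g (t + v)) ^ 2 := by gcongr
            _ ≤ _ := sq_two_mul_add_le _ _
    _ = 8 * (∫ t in T..2 * T, A t ^ 2) +
        2 * ∫ t in T..2 * T, (∫ v, k v * g (t + v)) ^ 2 := by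
        rw [intervalIntegral.integral_add ((by fun_prop : Continuous _).intervalIntegrable _ _)
          ((by fun_prop : Continuous _).intervalIntegrable _ _),
          intervalIntegral.integral_const_mul, intervalIntegral.integral_const_mul]
    _ ≤ 8 * (m * (C₁ * Z) * T ^ (1 + 3 * δ)) +
        2 * (K ^ 2 * (2 * (m * (C₂ * Z) + m * (C₁ * Z)) * T ^ (1 + 3 * δ))) := by gcongr
    _ = (8 * (m * (C₁ * Z)) + 4 * K ^ 2 * (m * (C₂ * Z) + m * (C₁ * Z)) + 0) *
        T ^ (1 + 3 * δ) := by ring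
    _ ≤ _ := by
        gcongr
        · norm_num
        · linarith

end FourthMoment

section DyadicBlockPowers

/-- The indicator function of the block `[2^j, 2^(j+1))` as an arithmetic function. -/
def blockIndicator (j : ℕ) : ArithmeticFunction ℕ :=
  ⟨fun n => if n ∈ Finset.Ico ((2 : ℕ) ^ j) (2 ^ (j + 1)) then 1 else 0, by simp⟩

lemma blockIndicator_apply (j n : ℕ) : blockIndicator j n =
    if n ∈ Finset.Ico ((2 : ℕ) ^ j) (2 ^ (j + 1)) then 1 else 0 := rfl

lemma blockIndicator_pow_le_dk (j k n : ℕ) : (blockIndicator j ^ k) n ≤ dk k n := by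
  induction k generalizing n with
  | zero => simp [dk]
  | succ k ih =>
    rw [dk, pow_succ, pow_succ, ArithmeticFunction.mul_apply, ArithmeticFunction.mul_apply]
    refine Finset.sum_le_sum fun p hp => Nat.mul_le_mul (ih _) ?_
    rw [blockIndicator_apply, ArithmeticFunction.zeta_apply_ne
      (Nat.ne_zero_of_mem_divisorsAntidiagonal hp).2]
    split_ifs <;> simp

lemma le_of_blockIndicator_pow_ne_zero {j k n : ℕ} (h : (blockIndicator j ^ k) n ≠ 0) :
    ((2 : ℕ) ^ j) ^ k ≤ n ∧ n ≤ (2 ^ (j + 1)) ^ k := by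
  induction k generalizing n with
  | zero =>
    rw [pow_zero, ArithmeticFunction.one_apply] at h
    have : n = 1 := by simpa using h
    simp [this]
  | succ k ih =>
    rw [pow_succ, ArithmeticFunction.mul_apply] at h
    obtain ⟨p, hp, hne⟩ := Finset.exists_ne_zero_of_sum_ne_zero h
    obtain ⟨h1, h2⟩ := ih (left_ne_zero_of_mul hne)
    have h3 := right_ne_zero_of_mul hne
    rw [blockIndicator_apply] at h3
    have h4 := Finset.mem_Ico.1 (by simpa using h3 : p.2 ∈ Finset.Ico ((2 : ℕ) ^ j) (2 ^ (j + 1)))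
    rw [← (Nat.mem_divisorsAntidiagonal.1 hp).1, pow_succ, pow_succ _ k]
    exact ⟨Nat.mul_le_mul h1 h4.1, Nat.mul_le_mul h2 h4.2.le⟩

lemma LSeriesHasSum_blockIndicator_pow (j k : ℕ) (s : ℂ) :
    LSeriesHasSum (fun n => ((blockIndicator j ^ k) n : ℂ)) s
      ((∑ n ∈ Finset.Ico ((2 : ℕ) ^ j) (2 ^ (j + 1)), (n : ℂ) ^ (-s)) ^ k) := by
  have h1 : LSeriesHasSum (fun n => (blockIndicator j n : ℂ)) s
      (∑ n ∈ Finset.Ico ((2 : ℕ) ^ j) (2 ^ (j + 1)), (n : ℂ) ^ (-s)) := by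
    rw [LSeriesHasSum]
    convert! hasSum_sum_of_ne_finset_zero (s := Finset.Ico ((2 : ℕ) ^ j) (2 ^ (j + 1)))
      (f := LSeries.term (fun n => (blockIndicator j n : ℂ)) s) fun n hn => ?_ using 1
    · refine Finset.sum_congr rfl fun n hn => ?_
      have hn0 : n ≠ 0 := by
        have := (Finset.mem_Ico.1 hn).1
        have := Nat.one_le_two_pow (n := j)
        lia
      rw [LSeries.term_of_ne_zero hn0, blockIndicator_apply, if_pos hn, Complex.cpow_neg]
      simp
    · rcases eq_or_ne n 0 with rfl | h0
      · simp
      · rw [LSeries.term_of_ne_zero h0, blockIndicator_apply, if_neg hn]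
        simp
    · infer_instance
  induction k with
  | zero =>
    have h : (fun n => ((blockIndicator j ^ 0) n : ℂ)) = LSeries.delta := by
      funext n
      simp [LSeries.delta, ArithmeticFunction.one_apply]
    rw [h, pow_zero, LSeriesHasSum, funext (LSeries.term_delta s)]
    exact hasSum_ite_eq 1 1
  | succ k ih =>
    have h := ih.convolution h1
    rw [pow_succ]
    refine (LSeriesHasSum_congr _ _ fun {n} hn => ?_).1 h
    rw [LSeries.convolution_def, ArithmeticFunction.mul_apply]
    push_cast
    rfl

/-- The coefficients of the `k`-th power of a dyadic block. -/
noncomputable def blockCoeff (σ : ℝ) (j k n : ℕ) : ℝ :=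
  ((blockIndicator j ^ k) n : ℝ) * (n : ℝ) ^ (-σ)

lemma blockCoeff_zero_right (σ : ℝ) (j k : ℕ) : blockCoeff σ j k 0 = 0 := by
  simp [blockCoeff]

lemma dyadicBlock_pow (σ t : ℝ) (j k : ℕ) :
    dyadicBlock σ t j ^ k = dirichletSeries (blockCoeff σ j k) t := by
  have h := (LSeriesHasSum_blockIndicator_pow j k ((σ : ℂ) + t * Complex.I)).hasSum_mul_cpow
    (by simp)
  have h2 : dyadicBlock σ t j = ∑ n ∈ Finset.Ico ((2 : ℕ) ^ j) (2 ^ (j + 1)),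
      (n : ℂ) ^ (-((σ : ℂ) + t * Complex.I)) := by
    refine Finset.sum_congr rfl fun n hn => (natCast_cpow_neg_add n ?_ σ t).symm
    have := (Finset.mem_Ico.1 hn).1
    have := Nat.one_le_two_pow (n := j)
    lia
  rw [h2, ← h.tsum_eq, dirichletSeries]
  refine tsum_congr fun n => ?_
  rcases eq_or_ne n 0 with rfl | hn
  · simp [blockCoeff]
  · rw [natCast_cpow_neg_add n hn, blockCoeff]
    push_cast
    ring

lemma summable_blockCoeff (σ : ℝ) (j k : ℕ) : Summable fun n => ‖blockCoeff σ j k n‖ := by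
  refine summable_of_ne_finset_zero (s := Finset.range ((2 ^ (j + 1)) ^ k + 1)) fun n hn => ?_
  have : (blockIndicator j ^ k) n = 0 := by
    by_contra h
    have := (le_of_blockIndicator_pow_ne_zero h).2
    rw [Finset.mem_range] at hn
    lia
  rw [blockCoeff, this]
  simp

lemma exists_integral_dyadicBlock_pow_le (k : ℕ) {σ δ : ℝ} (hσ : σ ≤ 1) (hδ : 0 < δ) :
    ∃ C : ℝ, 0 < C ∧ ∀ (T : ℝ) (j : ℕ), 2 ≤ T → T ≤ ((2 : ℝ) ^ j) ^ k →
      ∫ t in T..2 * T, ‖dyadicBlock σ t j‖ ^ (2 * k) ≤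
        C * (((2 : ℝ) ^ j) ^ k) ^ (2 - 2 * σ + 3 * δ) := by
  obtain ⟨C, hC, h⟩ := dk_le_rpow k hδ
  set Z := ∑' n : ℕ, (n : ℝ) ^ (-(1 + δ)) with hZ
  have hZ0 : 0 ≤ Z := tsum_nonneg fun n => by positivity
  have hmv := mvConst_pos
  set e := 2 - 2 * σ + 3 * δ with he
  have he0 : 0 ≤ e := by linarith
  refine ⟨mvConst * (2 * C ^ 2 * ((2 : ℝ) ^ k) ^ e * Z) + 1, by positivity, fun T j hT hTM => ?_⟩
  set M := ((2 : ℝ) ^ j) ^ k with hM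
  have hM0 : 0 < M := by positivity
  have hQ : ∀ n : ℕ, n ≠ 0 → blockCoeff σ j k n ^ 2 * (T + n) ≤
      (2 * C ^ 2 * ((2 : ℝ) ^ k) ^ e * M ^ e) * (n : ℝ) ^ (-(1 + δ)) := by
    intro n hn
    have hn0 : (0 : ℝ) < n := by positivity
    by_cases h0 : (blockIndicator j ^ k) n = 0
    · rw [blockCoeff, h0, Nat.cast_zero, zero_mul, zero_pow two_ne_zero, zero_mul]
      positivity
    · obtain ⟨h1, h2⟩ := le_of_blockIndicator_pow_ne_zero h0
      have h1' : M ≤ n := by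
        rw [hM]
        exact_mod_cast h1
      have h2' : (n : ℝ) ≤ 2 ^ k * M := by
        have : (n : ℝ) ≤ ((2 : ℝ) ^ (j + 1)) ^ k := by exact_mod_cast h2
        rw [pow_succ, mul_pow] at this
        linarith
      have hb : ((blockIndicator j ^ k) n : ℝ) ≤ C * (n : ℝ) ^ δ :=
        le_trans (by exact_mod_cast blockIndicator_pow_le_dk j k n) (h n hn)
      calc blockCoeff σ j k n ^ 2 * (T + n) ≤
          ((C * (n : ℝ) ^ δ) * (n : ℝ) ^ (-σ)) ^ 2 * (n + n) := by
            rw [blockCoeff]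
            gcongr
            linarith
        _ = 2 * C ^ 2 * ((n : ℝ) ^ δ * (n : ℝ) ^ (-σ) * ((n : ℝ) ^ δ * (n : ℝ) ^ (-σ)) *
            (n : ℝ) ^ (1 : ℝ)) := by
            rw [Real.rpow_one]
            ring
        _ = 2 * C ^ 2 * ((n : ℝ) ^ e * (n : ℝ) ^ (-(1 + δ))) := by
            rw [← Real.rpow_add hn0, ← Real.rpow_add hn0, ← Real.rpow_add hn0,
              ← Real.rpow_add hn0, he]
            ring_nf
        _ ≤ 2 * C ^ 2 * ((2 ^ k * M) ^ e * (n : ℝ) ^ (-(1 + δ))) := by gcongr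
        _ = _ := by
            rw [Real.mul_rpow (by positivity) hM0.le]
            ring
  have := integral_norm_dirichletSeries_sq_le hT (blockCoeff_zero_right σ j k)
    (summable_blockCoeff σ j k) hδ hQ 0
  simp only [add_zero] at this
  calc ∫ t in T..2 * T, ‖dyadicBlock σ t j‖ ^ (2 * k) =
      ∫ t in T..2 * T, ‖dirichletSeries (blockCoeff σ j k) t‖ ^ 2 := by
        congr 1
        ext t
        rw [← dyadicBlock_pow, norm_pow, ← pow_mul, mul_comm]
    _ ≤ _ := this
    _ = mvConst * (2 * C ^ 2 * ((2 : ℝ) ^ k) ^ e * Z) * M ^ e := by ring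
    _ ≤ _ := by
        gcongr
        linarith

end DyadicBlockPowers

section BlockMoments

lemma continuous_dyadicBlock (σ : ℝ) (j : ℕ) : Continuous fun t => dyadicBlock σ t j := by
  have h : (fun t => dyadicBlock σ t j) = dirichletSeries (blockCoeff σ j 1) := by
    ext t
    rw [← dyadicBlock_pow, pow_one]
  rw [h]
  exact continuous_dirichletSeries (blockCoeff_zero_right σ j 1) (summable_blockCoeff σ j 1)

lemma norm_dyadicBlock_le_pow {σ : ℝ} (hσ : 0 ≤ σ) (t : ℝ) (j : ℕ) :
    ‖dyadicBlock σ t j‖ ≤ 2 ^ j := by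
  rw [dyadicBlock]
  refine (norm_sum_le_of_le _ (n := fun _ : ℕ => (1 : ℝ)) fun n hn => ?_).trans (le_of_eq ?_)
  · have h1 : 1 ≤ n := Nat.one_le_two_pow.trans (Finset.mem_Ico.1 hn).1
    rw [norm_mul, Complex.norm_real, Real.norm_of_nonneg (by positivity)]
    refine mul_le_one₀ ?_ (norm_nonneg _) (norm_natCast_cpow_mul_I_le_one n t)
    exact Real.rpow_le_one_of_one_le_of_nonpos (by exact_mod_cast h1) (by linarith)
  · rw [Finset.sum_const, Nat.card_Ico, pow_succ, mul_two, Nat.add_sub_cancel]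
    simp

lemma norm_dyadicBlock_le_const {σ T t : ℝ} {j : ℕ} (hσ : 9 / 10 ≤ σ) (hT : 2 ≤ T)
    (h1 : T ≤ t) (h2 : t ≤ 2 * T) (hj : T ^ (5 / 9 : ℝ) ≤ (2 : ℝ) ^ j)
    (hj' : (2 : ℝ) ^ j ≤ 8 * T ^ 2) : ‖dyadicBlock σ t j‖ ≤ 240 := by
  have hT0 : 0 < T := by linarith
  have ht0 : 0 < t := by linarith
  have hN1 : (1 : ℝ) ≤ 2 ^ j := one_le_pow₀ one_le_two
  set N : ℝ := (2 : ℝ) ^ j with hN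
  have hN0 : 0 < N := by linarith
  rcases le_total t N with h | h
  · have e1 : N ^ (-σ) * N ≤ 3 * t := by
      calc N ^ (-σ) * N = N ^ (-σ) * N ^ (1 : ℝ) := by rw [Real.rpow_one]
        _ = N ^ (-σ + 1) := (Real.rpow_add hN0 _ _).symm
        _ ≤ N ^ (1 / 2 : ℝ) := Real.rpow_le_rpow_of_exponent_le hN1 (by linarith)
        _ = √N := (Real.sqrt_eq_rpow N).symm
        _ ≤ √((3 * t) ^ 2) := Real.sqrt_le_sqrt (by nlinarith)
        _ = 3 * t := Real.sqrt_sq (by positivity)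
    calc ‖dyadicBlock σ t j‖ ≤ N ^ (-σ) * (32 * (N / t)) :=
          norm_dyadicBlock_le_of_large (by linarith) ht0 h
      _ = 32 * (N ^ (-σ) * N) / t := by ring
      _ ≤ 32 * (3 * t) / t := by gcongr
      _ = 96 := by
          field_simp
          norm_num
      _ ≤ 240 := by norm_num
  · have e1 : N / √t ≤ √t := by
      rw [div_le_iff₀ (Real.sqrt_pos.2 ht0), Real.mul_self_sqrt ht0.le]
      exact h
    have e2 : √t ≤ 2 * T ^ (1 / 2 : ℝ) := by
      rw [← Real.sqrt_eq_rpow]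
      refine Real.sqrt_le_iff.2 ⟨by positivity, ?_⟩
      rw [mul_pow, Real.sq_sqrt hT0.le]
      linarith
    have e3 : N ^ (-σ) ≤ T ^ (-(1 / 2) : ℝ) := by
      calc N ^ (-σ) ≤ (T ^ (5 / 9 : ℝ)) ^ (-σ) :=
            Real.rpow_le_rpow_of_nonpos (by positivity) hj (by linarith)
        _ = T ^ (5 / 9 * -σ) := (Real.rpow_mul hT0.le _ _).symm
        _ ≤ _ := Real.rpow_le_rpow_of_exponent_le (by linarith) (by linarith)
    calc ‖dyadicBlock σ t j‖ ≤ N ^ (-σ) * (60 * (√t + N / √t)) :=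
          norm_dyadicBlock_le_sqrt (by linarith) ht0
      _ ≤ T ^ (-(1 / 2) : ℝ) * (60 * (2 * T ^ (1 / 2 : ℝ) + 2 * T ^ (1 / 2 : ℝ))) := by
          gcongr
          exact e1.trans e2
      _ = 240 * (T ^ (-(1 / 2) : ℝ) * T ^ (1 / 2 : ℝ)) := by ring
      _ = 240 := by
          rw [← Real.rpow_add hT0]
          norm_num

lemma continuousOn_riemannZeta_critical {T : ℝ} (hT : 0 < T) :
    ContinuousOn (fun t : ℝ => riemannZeta (1 / 2 + t * Complex.I)) (Set.uIcc T (2 * T)) := by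
  have := continuousOn_riemannZeta_vertical (1 / 2) (s := Set.uIcc T (2 * T)) fun t ht => by
    rw [Set.uIcc_of_le (by linarith)] at ht
    linarith [ht.1]
  push_cast at this
  exact this

lemma exists_integral_riemannZeta_mul_dyadicBlock_pow_le (k : ℕ) {σ : ℝ} (hσ : 0.904392 ≤ σ)
    (hσ' : σ ≤ 1) :
    ∃ C : ℝ, 0 < C ∧ ∀ (T : ℝ) (j : ℕ), 2 ≤ T → T ≤ ((2 : ℝ) ^ j) ^ k →
      ((2 : ℝ) ^ j) ^ k ≤ T ^ (14 / 9 : ℝ) →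
      ∫ t in T..2 * T, ‖riemannZeta (1 / 2 + t * Complex.I)‖ ^ 4 * ‖dyadicBlock σ t j‖ ^ (2 * k) ≤
        C * T := by
  obtain ⟨K, hK, hζ⟩ := norm_riemannZeta_le_rpow
  obtain ⟨C, hC, h⟩ := exists_integral_dyadicBlock_pow_le k hσ' (δ := 4 / 1000) (by norm_num)
  refine ⟨2 * K ^ 4 * C, by positivity, fun T j hT h1 h2 => ?_⟩
  have hT0 : 0 < T := by linarith
  have hTT : T ≤ 2 * T := by linarith
  have hB := (continuous_dyadicBlock σ j).norm
  have hP := h T j hT h1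
  set M := ((2 : ℝ) ^ j) ^ k with hM
  have hM0 : 0 < M := by positivity
  have hW : ∀ t ∈ Set.Icc T (2 * T),
      ‖riemannZeta (1 / 2 + t * Complex.I)‖ ^ 4 ≤ 2 * K ^ 4 * T ^ (68 / 100 : ℝ) := by
    intro t ht
    have e1 := hζ (1 / 2) t le_rfl (by norm_num) (by linarith [ht.1])
    push_cast at e1
    have ht0 : 0 ≤ t := by linarith [ht.1]
    calc ‖riemannZeta (1 / 2 + t * Complex.I)‖ ^ 4 ≤ (K * t ^ (17 / 100 : ℝ)) ^ 4 := by gcongr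
      _ = K ^ 4 * t ^ (68 / 100 : ℝ) := by
          rw [mul_pow, ← Real.rpow_natCast (t ^ (17 / 100 : ℝ)), ← Real.rpow_mul ht0]
          norm_num
      _ ≤ K ^ 4 * (2 * T) ^ (68 / 100 : ℝ) := by
          gcongr
          exact ht.2
      _ ≤ K ^ 4 * (2 * T ^ (68 / 100 : ℝ)) := by
          rw [Real.mul_rpow two_pos.le hT0.le]
          gcongr
          calc (2 : ℝ) ^ (68 / 100 : ℝ) ≤ 2 ^ (1 : ℝ) :=
                Real.rpow_le_rpow_of_exponent_le one_le_two (by norm_num)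
            _ = 2 := Real.rpow_one 2
      _ = _ := by ring
  have hMe : M ^ (2 - 2 * σ + 3 * (4 / 1000)) ≤ T ^ (32 / 100 : ℝ) := by
    calc M ^ (2 - 2 * σ + 3 * (4 / 1000)) ≤ (T ^ (14 / 9 : ℝ)) ^ (2 - 2 * σ + 3 * (4 / 1000)) :=
          Real.rpow_le_rpow hM0.le h2 (by linarith)
      _ = T ^ (14 / 9 * (2 - 2 * σ + 3 * (4 / 1000))) := (Real.rpow_mul hT0.le _ _).symm
      _ ≤ _ := Real.rpow_le_rpow_of_exponent_le (by linarith) (by norm_num at hσ ⊢; linarith)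
  calc ∫ t in T..2 * T, ‖riemannZeta (1 / 2 + t * Complex.I)‖ ^ 4 * ‖dyadicBlock σ t j‖ ^ (2 * k) ≤
      ∫ t in T..2 * T, (2 * K ^ 4 * T ^ (68 / 100 : ℝ)) * ‖dyadicBlock σ t j‖ ^ (2 * k) := by
        refine intervalIntegral.integral_mono_on hTT
          (((continuousOn_riemannZeta_critical hT0).norm.pow 4).mul
            (hB.pow _).continuousOn).intervalIntegrable
          ((by fun_prop : Continuous _).intervalIntegrable _ _) fun t ht => ?_
        exact mul_le_mul_of_nonneg_right (hW t ht) (by positivity)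
    _ = (2 * K ^ 4 * T ^ (68 / 100 : ℝ)) * ∫ t in T..2 * T, ‖dyadicBlock σ t j‖ ^ (2 * k) :=
        intervalIntegral.integral_const_mul _ _
    _ ≤ (2 * K ^ 4 * T ^ (68 / 100 : ℝ)) * (C * T ^ (32 / 100 : ℝ)) := by
        gcongr
        exact hP.trans (by gcongr)
    _ = 2 * K ^ 4 * C * (T ^ (68 / 100 : ℝ) * T ^ (32 / 100 : ℝ)) := by ring
    _ = _ := by
        rw [← Real.rpow_add hT0]
        norm_num

lemma exists_pow_between {N T δ : ℝ} (hδ : 0 < δ) (hT : 2 ≤ T) (h1 : T ^ δ ≤ N)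
    (h2 : N ≤ T ^ (5 / 9 : ℝ)) :
    ∃ k : ℕ, 2 ≤ k ∧ k < ⌊1 / δ⌋₊ + 2 ∧ T ≤ N ^ k ∧ N ^ k ≤ T ^ (14 / 9 : ℝ) := by
  have hT0 : 0 < T := by linarith
  have hN1 : 1 < N := (Real.one_lt_rpow (by linarith) hδ).trans_le h1
  have hNT : N ≤ T := h2.trans (by
    calc T ^ (5 / 9 : ℝ) ≤ T ^ (1 : ℝ) :=
          Real.rpow_le_rpow_of_exponent_le (by linarith) (by norm_num)
      _ = T := Real.rpow_one T)
  obtain ⟨n, hn1, hn2⟩ := exists_nat_pow_near (by linarith : 1 ≤ T) hN1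
  have hn0 : n ≠ 0 := by
    rintro rfl
    rw [zero_add, pow_one] at hn2
    linarith
  refine ⟨n + 1, by lia, ?_, hn2.le, ?_⟩
  · have : T ^ (δ * n) ≤ T ^ (1 : ℝ) := by
      rw [Real.rpow_mul hT0.le, Real.rpow_natCast, Real.rpow_one]
      exact (pow_le_pow_left₀ (by positivity) h1 n).trans hn1
    have h3 := (Real.rpow_le_rpow_left_iff (by linarith : 1 < T)).1 this
    have : n ≤ ⌊1 / δ⌋₊ := Nat.le_floor (by rw [le_div_iff₀ hδ]; linarith)
    lia
  · calc N ^ (n + 1) = N ^ n * N := pow_succ _ _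
      _ ≤ T * T ^ (5 / 9 : ℝ) := by gcongr
      _ = T ^ (1 : ℝ) * T ^ (5 / 9 : ℝ) := by rw [Real.rpow_one]
      _ = _ := by
          rw [← Real.rpow_add hT0]
          norm_num

lemma pow_four_le_one_add_pow {x : ℝ} (hx : 0 ≤ x) {k : ℕ} (hk : 2 ≤ k) :
    x ^ 4 ≤ 1 + x ^ (2 * k) := by
  rcases le_total x 1 with h | h
  · have := pow_le_one₀ hx h (n := 4)
    have : 0 ≤ x ^ (2 * k) := by positivity
    linarith
  · have := pow_le_pow_right₀ h (by lia : 4 ≤ 2 * k)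
    linarith

lemma exists_integral_riemannZeta_mul_dyadicBlock_le {σ ε : ℝ} (hσ : 0.904392 ≤ σ) (hσ' : σ ≤ 1)
    (hε : 0 < ε) :
    ∃ C : ℝ, 0 < C ∧ ∀ (T : ℝ) (j : ℕ), 2 ≤ T → (2 : ℝ) ^ j ≤ 8 * T ^ 2 →
      ∫ t in T..2 * T, ‖riemannZeta (1 / 2 + t * Complex.I)‖ ^ 4 * ‖dyadicBlock σ t j‖ ^ 4 ≤
        C * T ^ (1 + ε) := by
  have hσ9 : 9 / 10 ≤ σ := by norm_num at hσ; linarith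
  obtain ⟨A, hA, hW⟩ := exists_integral_norm_riemannZeta_pow_four_le (ε := ε / 2) (by positivity)
  choose B hB hP using fun k => exists_integral_riemannZeta_mul_dyadicBlock_pow_le k hσ hσ'
  set D := ∑ k ∈ Finset.range (⌊1 / (ε / 8)⌋₊ + 2), B k with hD
  have hD0 : 0 ≤ D := Finset.sum_nonneg fun k _ => (hB k).le
  refine ⟨240 ^ 4 * A + D, by positivity, fun T j hT hj => ?_⟩
  have hT0 : 0 < T := by linarith
  have hTT : T ≤ 2 * T := by linarith
  have hBl := (continuous_dyadicBlock σ j).norm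
  have hWT := hW T hT
  have cW : ContinuousOn (fun t : ℝ => ‖riemannZeta (1 / 2 + t * Complex.I)‖ ^ 4)
    (Set.uIcc T (2 * T)) := (continuousOn_riemannZeta_critical hT0).norm.pow 4
  have hTε : T ^ (1 + ε / 2) ≤ T ^ (1 + ε) :=
    Real.rpow_le_rpow_of_exponent_le (by linarith) (by linarith)
  have hTε' : T ≤ T ^ (1 + ε) := by
    calc T = T ^ (1 : ℝ) := (Real.rpow_one T).symm
      _ ≤ _ := Real.rpow_le_rpow_of_exponent_le (by linarith) (by linarith)
  have huse : ∀ Q : ℝ, 0 ≤ Q → (∀ t ∈ Set.Icc T (2 * T), ‖dyadicBlock σ t j‖ ^ 4 ≤ Q) →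
      ∫ t in T..2 * T, ‖riemannZeta (1 / 2 + t * Complex.I)‖ ^ 4 * ‖dyadicBlock σ t j‖ ^ 4 ≤
        Q * (A * T ^ (1 + ε / 2)) := by
    intro Q hQ0 hQ
    calc ∫ t in T..2 * T, ‖riemannZeta (1 / 2 + t * Complex.I)‖ ^ 4 * ‖dyadicBlock σ t j‖ ^ 4 ≤
        ∫ t in T..2 * T, Q * ‖riemannZeta (1 / 2 + t * Complex.I)‖ ^ 4 := by
          refine intervalIntegral.integral_mono_on hTT
            (cW.mul (hBl.pow 4).continuousOn).intervalIntegrable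
            (continuousOn_const.mul cW).intervalIntegrable fun t ht => ?_
          rw [mul_comm Q]
          exact mul_le_mul_of_nonneg_left (hQ t ht) (by positivity)
      _ = Q * ∫ t in T..2 * T, ‖riemannZeta (1 / 2 + t * Complex.I)‖ ^ 4 :=
          intervalIntegral.integral_const_mul _ _
      _ ≤ _ := mul_le_mul_of_nonneg_left hWT hQ0
  rcases le_total ((2 : ℝ) ^ j) (T ^ (ε / 8)) with h1 | h1
  · refine (huse (T ^ (ε / 2)) (by positivity) fun t _ => ?_).trans ?_
    · calc ‖dyadicBlock σ t j‖ ^ 4 ≤ (T ^ (ε / 8)) ^ 4 := by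
            gcongr
            exact (norm_dyadicBlock_le_pow (by linarith) t j).trans h1
        _ = T ^ (ε / 2) := by
            rw [← Real.rpow_natCast, ← Real.rpow_mul hT0.le]
            congr 1
            push_cast
            ring
    · calc T ^ (ε / 2) * (A * T ^ (1 + ε / 2)) = A * (T ^ (ε / 2) * T ^ (1 + ε / 2)) := by ring
        _ = A * T ^ (1 + ε) := by
            rw [← Real.rpow_add hT0]
            ring_nf
        _ ≤ _ := by
            gcongr
            linarith
  rcases le_total (T ^ (5 / 9 : ℝ)) ((2 : ℝ) ^ j) with h2 | h2
  · refine (huse (240 ^ 4) (by positivity) fun t ht => ?_).trans ?_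
    · gcongr
      exact norm_dyadicBlock_le_const hσ9 hT ht.1 ht.2 h2 hj
    · calc (240 : ℝ) ^ 4 * (A * T ^ (1 + ε / 2)) = (240 ^ 4 * A + 0) * T ^ (1 + ε / 2) := by ring
        _ ≤ _ := by gcongr
  · obtain ⟨k, hk2, hk, hk3, hk4⟩ := exists_pow_between (by positivity) hT h1 h2
    have hBD : B k ≤ D :=
      Finset.single_le_sum (fun i _ => (hB i).le) (Finset.mem_range.2 hk)
    calc ∫ t in T..2 * T, ‖riemannZeta (1 / 2 + t * Complex.I)‖ ^ 4 * ‖dyadicBlock σ t j‖ ^ 4 ≤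
        ∫ t in T..2 * T, (‖riemannZeta (1 / 2 + t * Complex.I)‖ ^ 4 +
          ‖riemannZeta (1 / 2 + t * Complex.I)‖ ^ 4 * ‖dyadicBlock σ t j‖ ^ (2 * k)) := by
          refine intervalIntegral.integral_mono_on hTT
            (cW.mul (hBl.pow 4).continuousOn).intervalIntegrable
            (cW.add (cW.mul (hBl.pow _).continuousOn)).intervalIntegrable fun t ht => ?_
          rw [← mul_one_add]
          exact mul_le_mul_of_nonneg_left (pow_four_le_one_add_pow (norm_nonneg _) hk2)
            (by positivity)
      _ = (∫ t in T..2 * T, ‖riemannZeta (1 / 2 + t * Complex.I)‖ ^ 4) +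
          ∫ t in T..2 * T,
            ‖riemannZeta (1 / 2 + t * Complex.I)‖ ^ 4 * ‖dyadicBlock σ t j‖ ^ (2 * k) :=
          intervalIntegral.integral_add cW.intervalIntegrable
            (cW.mul (hBl.pow _).continuousOn).intervalIntegrable
      _ ≤ A * T ^ (1 + ε / 2) + B k * T := add_le_add hWT (hP k T j hT hk3 hk4)
      _ ≤ A * T ^ (1 + ε) + D * T ^ (1 + ε) := by
          have := (hB k).le
          gcongr
      _ = (1 * A + D) * T ^ (1 + ε) := by ring
      _ ≤ _ := by
          gcongr
          norm_num

end BlockMoments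

section MixedMoment

lemma sum_add_pow_four_le (p : ℕ → ℝ) (hp : ∀ j, 0 ≤ p j) (J : ℕ) :
    (∑ j ∈ Finset.range J, p j + 27) ^ 4 ≤
      8 * (J ^ 3 * ∑ j ∈ Finset.range J, p j ^ 4 + 27 ^ 4) := by
  set S := ∑ j ∈ Finset.range J, p j with hS
  have h2 : S ^ 4 ≤ J ^ 3 * ∑ j ∈ Finset.range J, p j ^ 4 := by
    have := pow_sum_le_card_mul_sum_pow (s := Finset.range J) (f := p) (fun j _ => hp j) 3
    rwa [Finset.card_range] at this
  nlinarith [sq_nonneg (S - 27), sq_nonneg (S ^ 2 - 27 ^ 2), sq_nonneg (S + 27)]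

/-- The product `ζ(s)⁴ ζ(s+a)^ℓ`. -/
noncomputable def zetaProduct (ℓ : ℕ) (a : ℝ) (s : ℂ) : ℂ :=
  riemannZeta s ^ 4 * riemannZeta (s + a) ^ ℓ

lemma exists_integral_mixed_moment_le {σ ε : ℝ} (hσ : 0.904392 ≤ σ) (hσ' : σ ≤ 1) (hε : 0 < ε) :
    ∃ C : ℝ, 0 < C ∧ ∀ T : ℝ, 2 ≤ T →
      ∫ t in T..2 * T, ‖riemannZeta (1 / 2 + t * Complex.I)‖ ^ 4 *
        ‖riemannZeta ((σ : ℂ) + t * Complex.I)‖ ^ 4 ≤ C * T ^ (1 + ε) := by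
  obtain ⟨A, hA, hW⟩ := exists_integral_norm_riemannZeta_pow_four_le hε
  obtain ⟨B, hB, hP⟩ := exists_integral_riemannZeta_mul_dyadicBlock_le hσ hσ' (ε := ε / 2)
    (by positivity)
  set η := ε / 16 with hη
  have hη0 : 0 < η := by positivity
  set L := 2 * ((1 + 1 / η) * 4 ^ η) with hL
  have hL0 : 0 < L := by positivity
  refine ⟨8 * (L ^ 4 * B + 27 ^ 4 * A), by positivity, fun T hT => ?_⟩
  have hT0 : 0 < T := by linarith
  have hTT : T ≤ 2 * T := by linarith
  obtain ⟨J, hJ1, hJ2, hJ3⟩ := exists_dyadic_length (x := 4 * T ^ 2) (by nlinarith)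
  have hJL : (J : ℝ) ≤ L * T ^ (2 * η) := by
    have h1 := log_le_const_mul_rpow hη0 (x := 4 * T ^ 2) (by nlinarith)
    have h2 : (T ^ 2) ^ η = T ^ (2 * η) := by
      rw [← Real.rpow_natCast, ← Real.rpow_mul hT0.le]
      norm_num
    rw [Real.mul_rpow (by norm_num) (by positivity), h2] at h1
    rw [hL]
    linarith
  have cW : ContinuousOn (fun t : ℝ => ‖riemannZeta (1 / 2 + t * Complex.I)‖ ^ 4)
    (Set.uIcc T (2 * T)) := (continuousOn_riemannZeta_critical hT0).norm.pow 4
  have cσ : ContinuousOn (fun t : ℝ => ‖riemannZeta ((σ : ℂ) + t * Complex.I)‖ ^ 4)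
    (Set.uIcc T (2 * T)) := ((continuousOn_riemannZeta_vertical σ fun t ht => by
      rw [Set.uIcc_of_le hTT] at ht
      linarith [ht.1]).norm).pow 4
  have cP : ∀ j, Continuous fun t => ‖dyadicBlock σ t j‖ ^ 4 := fun j =>
    (continuous_dyadicBlock σ j).norm.pow 4
  have cWP : ∀ j, ContinuousOn (fun t : ℝ => ‖riemannZeta (1 / 2 + t * Complex.I)‖ ^ 4 *
      ‖dyadicBlock σ t j‖ ^ 4) (Set.uIcc T (2 * T)) := fun j => cW.mul (cP j).continuousOn
  have iS : IntervalIntegrable (fun t : ℝ => ∑ j ∈ Finset.range J,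
      ‖riemannZeta (1 / 2 + t * Complex.I)‖ ^ 4 * ‖dyadicBlock σ t j‖ ^ 4)
      MeasureTheory.volume T (2 * T) :=
    (continuousOn_finsetSum _ fun j _ => cWP j).intervalIntegrable
  have hsum : ∑ j ∈ Finset.range J, ∫ t in T..2 * T,
      ‖riemannZeta (1 / 2 + t * Complex.I)‖ ^ 4 * ‖dyadicBlock σ t j‖ ^ 4 ≤
      J * (B * T ^ (1 + ε / 2)) := by
    refine (Finset.sum_le_card_nsmul _ _ (B * T ^ (1 + ε / 2)) fun j hj => ?_).trans (by simp)
    refine hP T j hT ?_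
    have : (2 : ℝ) ^ j ≤ 2 ^ J := pow_le_pow_right₀ one_le_two (Finset.mem_range.1 hj).le
    linarith
  have iW : IntervalIntegrable (fun t : ℝ => (8 * 27 ^ 4) *
      ‖riemannZeta (1 / 2 + t * Complex.I)‖ ^ 4) MeasureTheory.volume T (2 * T) :=
    (continuousOn_const.mul cW).intervalIntegrable
  calc ∫ t in T..2 * T, ‖riemannZeta (1 / 2 + t * Complex.I)‖ ^ 4 *
        ‖riemannZeta ((σ : ℂ) + t * Complex.I)‖ ^ 4 ≤
      ∫ t in T..2 * T, ((8 * J ^ 3) * (∑ j ∈ Finset.range J,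
        ‖riemannZeta (1 / 2 + t * Complex.I)‖ ^ 4 * ‖dyadicBlock σ t j‖ ^ 4) +
        (8 * 27 ^ 4) * ‖riemannZeta (1 / 2 + t * Complex.I)‖ ^ 4) := by
        refine intervalIntegral.integral_mono_on hTT (cW.mul cσ).intervalIntegrable
          ((iS.const_mul _).add iW) fun t ht => ?_
        have ht1 : 1 ≤ t := by linarith [ht.1]
        have e1 := norm_riemannZeta_le_sum_dyadicBlock (σ := σ) (t := t) (J := J)
          (by norm_num at hσ; linarith) (by linarith) ht1 (by nlinarith [ht.1, ht.2])
          (by nlinarith [ht.1, ht.2])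
        have e2 := (pow_le_pow_left₀ (norm_nonneg _) e1 4).trans
          (sum_add_pow_four_le (fun j => ‖dyadicBlock σ t j‖) (fun j => norm_nonneg _) J)
        refine (mul_le_mul_of_nonneg_left e2 (by positivity)).trans (le_of_eq ?_)
        rw [← Finset.mul_sum]
        ring
    _ = (8 * J ^ 3) * (∑ j ∈ Finset.range J, ∫ t in T..2 * T,
        ‖riemannZeta (1 / 2 + t * Complex.I)‖ ^ 4 * ‖dyadicBlock σ t j‖ ^ 4) +
        (8 * 27 ^ 4) * ∫ t in T..2 * T, ‖riemannZeta (1 / 2 + t * Complex.I)‖ ^ 4 := by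
        rw [intervalIntegral.integral_add (iS.const_mul _) iW, intervalIntegral.integral_const_mul,
          intervalIntegral.integral_const_mul,
          intervalIntegral.integral_finsetSum fun j _ => (cWP j).intervalIntegrable]
    _ ≤ (8 * J ^ 3) * (J * (B * T ^ (1 + ε / 2))) + (8 * 27 ^ 4) * (A * T ^ (1 + ε)) := by
        gcongr
        exact hW T hT
    _ = 8 * (J ^ 4 * (B * T ^ (1 + ε / 2))) + (8 * 27 ^ 4) * (A * T ^ (1 + ε)) := by ring
    _ ≤ 8 * ((L * T ^ (2 * η)) ^ 4 * (B * T ^ (1 + ε / 2))) +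
        (8 * 27 ^ 4) * (A * T ^ (1 + ε)) := by gcongr
    _ = 8 * (L ^ 4 * B * (T ^ (ε / 2) * T ^ (1 + ε / 2))) +
        (8 * 27 ^ 4) * (A * T ^ (1 + ε)) := by
        have : (T ^ (2 * η)) ^ 4 = T ^ (ε / 2) := by
          rw [← Real.rpow_natCast, ← Real.rpow_mul hT0.le, hη]
          congr 1
          push_cast
          ring
        rw [mul_pow, this]
        ring
    _ = _ := by
        rw [← Real.rpow_add hT0, show ε / 2 + (1 + ε / 2) = 1 + ε by ring]
        ring

/-- The first moment of `ζ(s)⁴ ζ(s+a)^ℓ` on the critical line. -/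
theorem exists_integral_norm_zetaProduct_le {ℓ : ℕ} {a ε : ℝ} (hℓ : ℓ ≤ 4) (ha : 0.404392 ≤ a)
    (ha' : a ≤ 1 / 2) (hε : 0 < ε) :
    ∃ C : ℝ, 0 < C ∧ ∀ T : ℝ, 2 ≤ T →
      ∫ t in T..2 * T, ‖zetaProduct ℓ a (1 / 2 + t * Complex.I)‖ ≤ C * T ^ (1 + ε) := by
  obtain ⟨A, hA, hW⟩ := exists_integral_norm_riemannZeta_pow_four_le hε
  obtain ⟨B, hB, hM⟩ := exists_integral_mixed_moment_le (σ := 1 / 2 + a)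
    (by norm_num at ha ⊢; linarith) (by linarith) hε
  refine ⟨A + B, by positivity, fun T hT => ?_⟩
  have hT0 : 0 < T := by linarith
  have hTT : T ≤ 2 * T := by linarith
  have cW := continuousOn_riemannZeta_critical hT0
  have cσ := continuousOn_riemannZeta_vertical (1 / 2 + a) (s := Set.uIcc T (2 * T))
    fun t ht => by
      rw [Set.uIcc_of_le hTT] at ht
      linarith [ht.1]
  have harg : ∀ t : ℝ, (1 / 2 + t * Complex.I + a : ℂ) = ((1 / 2 + a : ℝ) : ℂ) + t * Complex.I :=
    fun t => by
      push_cast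
      ring
  have cW4 := cW.norm.pow 4
  have cσ4 := cσ.norm.pow 4
  calc ∫ t in T..2 * T, ‖zetaProduct ℓ a (1 / 2 + t * Complex.I)‖ ≤
      ∫ t in T..2 * T, (‖riemannZeta (1 / 2 + t * Complex.I)‖ ^ 4 +
        ‖riemannZeta (1 / 2 + t * Complex.I)‖ ^ 4 *
          ‖riemannZeta (((1 / 2 + a : ℝ) : ℂ) + t * Complex.I)‖ ^ 4) := by
        refine intervalIntegral.integral_mono_on hTT ?_
          (cW4.add (cW4.mul cσ4)).intervalIntegrable fun t ht => ?_
        · refine ContinuousOn.intervalIntegrable (ContinuousOn.norm ?_)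
          simp only [zetaProduct, harg]
          exact (cW.pow 4).mul (cσ.pow ℓ)
        · rw [zetaProduct, harg, norm_mul, norm_pow, norm_pow, ← mul_one_add]
          refine mul_le_mul_of_nonneg_left ?_ (by positivity)
          set x := ‖riemannZeta (((1 / 2 + a : ℝ) : ℂ) + t * Complex.I)‖
          have hx : 0 ≤ x := norm_nonneg _
          rcases le_total x 1 with h | h
          · have := pow_le_one₀ hx h (n := ℓ)
            have : 0 ≤ x ^ 4 := by positivity
            linarith
          · have := pow_le_pow_right₀ h hℓ
            linarith
    _ = (∫ t in T..2 * T, ‖riemannZeta (1 / 2 + t * Complex.I)‖ ^ 4) +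
        ∫ t in T..2 * T, ‖riemannZeta (1 / 2 + t * Complex.I)‖ ^ 4 *
          ‖riemannZeta (((1 / 2 + a : ℝ) : ℂ) + t * Complex.I)‖ ^ 4 :=
        intervalIntegral.integral_add cW4.intervalIntegrable (cW4.mul cσ4).intervalIntegrable
    _ ≤ A * T ^ (1 + ε) + B * T ^ (1 + ε) := add_le_add (hW T hT) (hM T hT)
    _ = _ := by ring

end MixedMoment

section Perron

open Complex MeasureTheory

lemma hasMellin_one_sub_indicator {s : ℂ} (hs : 0 < s.re) :
    HasMellin (fun u : ℝ => ((max (1 - u) 0 : ℝ) : ℂ)) s (1 / (s * (s + 1))) := by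
  have h1 := hasMellin_one_Ioc hs
  have h2 := hasMellin_cpow_Ioc 1 (s := s) (by simp; linarith)
  have h3 := hasMellin_sub h1.1 h2.1
  have hs0 : s ≠ 0 := fun h => by simp [h] at hs
  have hs1 : s + 1 ≠ 0 := fun h => by
    have := congrArg Complex.re h
    simp at this
    linarith
  rw [h1.2, h2.2] at h3
  have e : 1 / (s * (s + 1)) = 1 / s - 1 / (s + 1) := by
    field_simp
    ring
  rw [e]
  have hEq : Set.EqOn (fun u : ℝ => Set.indicator (Set.Ioc 0 1) (fun _ => (1 : ℂ)) u -
      Set.indicator (Set.Ioc 0 1) (fun t : ℝ => (t : ℂ) ^ (1 : ℂ)) u)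
      (fun u : ℝ => ((max (1 - u) 0 : ℝ) : ℂ)) (Set.Ioi 0) := fun u hu => by
    have hu : 0 < u := hu
    by_cases h : u ≤ 1
    · have hmem : u ∈ Set.Ioc (0 : ℝ) 1 := ⟨hu, h⟩
      simp [hmem, max_eq_left (sub_nonneg.2 h)]
    · have hmem : u ∉ Set.Ioc (0 : ℝ) 1 := fun h' => h h'.2
      have : max (1 - u) 0 = 0 := max_eq_right (by linarith)
      simp only [Set.indicator_of_notMem hmem, this]
      simp
  refine ⟨(integrableOn_congr_fun (fun u hu => ?_) measurableSet_Ioi).1 h3.1, ?_⟩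
  · simp only [← hEq hu]
  · rw [← h3.2]
    exact setIntegral_congr_fun measurableSet_Ioi fun u hu => by simp only [← hEq hu]

lemma add_ofReal_mul_I_ne_zero {σ : ℝ} (hσ : 0 < σ) (t : ℝ) : (σ : ℂ) + t * I ≠ 0 := fun h => by
  have := congrArg Complex.re h
  simp at this
  linarith

lemma add_ofReal_mul_I_add_one_ne_zero {σ : ℝ} (hσ : 0 < σ) (t : ℝ) :
    (σ : ℂ) + t * I + 1 ≠ 0 := by
  have := add_ofReal_mul_I_ne_zero (σ := σ + 1) (by linarith) t
  convert this using 1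
  push_cast
  ring

lemma norm_inv_mul_add_one_le {σ : ℝ} (hσ : 1 ≤ σ) (t : ℝ) :
    ‖1 / (((σ : ℂ) + t * I) * ((σ : ℂ) + t * I + 1))‖ ≤ (1 + t ^ 2)⁻¹ := by
  rw [norm_div, norm_one, one_div]
  refine inv_anti₀ (by positivity) ?_
  have h1 : (1 + t ^ 2) ≤ ‖(σ : ℂ) + t * I‖ ^ 2 := by
    rw [← Complex.normSq_eq_norm_sq, Complex.normSq_apply]
    simp
    nlinarith
  have h2 : ‖(σ : ℂ) + t * I‖ ≤ ‖(σ : ℂ) + t * I + 1‖ := by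
    rw [← sq_le_sq₀ (norm_nonneg _) (norm_nonneg _), ← Complex.normSq_eq_norm_sq,
      ← Complex.normSq_eq_norm_sq, Complex.normSq_apply, Complex.normSq_apply]
    simp
    nlinarith
  rw [norm_mul]
  nlinarith [norm_nonneg ((σ : ℂ) + t * I)]

lemma continuous_inv_mul_add_one {σ : ℝ} (hσ : 0 < σ) :
    Continuous fun t : ℝ => 1 / (((σ : ℂ) + t * I) * ((σ : ℂ) + t * I + 1)) := by
  refine continuous_const.div (by fun_prop) fun t => ?_
  exact mul_ne_zero (add_ofReal_mul_I_ne_zero hσ t) (add_ofReal_mul_I_add_one_ne_zero hσ t)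

lemma integrable_inv_mul_add_one {σ : ℝ} (hσ : 1 ≤ σ) :
    Integrable fun t : ℝ => 1 / (((σ : ℂ) + t * I) * ((σ : ℂ) + t * I + 1)) :=
  integrable_inv_one_add_sq.mono'
    (continuous_inv_mul_add_one (by linarith)).aestronglyMeasurable
    (Filter.Eventually.of_forall fun t => norm_inv_mul_add_one_le hσ t)

/-- Perron's formula for the kernel `max (x - y) 0`. -/
theorem integral_perron_kernel {σ x y : ℝ} (hσ : 1 ≤ σ) (hx : 0 < x) (hy : 0 < y) :
    ∫ t : ℝ, (x : ℂ) ^ ((σ : ℂ) + t * I + 1) * (y : ℂ) ^ (-((σ : ℂ) + t * I)) *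
      (1 / (((σ : ℂ) + t * I) * ((σ : ℂ) + t * I + 1))) = 2 * π * (max (x - y) 0 : ℝ) := by
  have hre : ∀ t : ℝ, ((σ : ℂ) + t * I).re = σ := fun t => by simp
  have hmel : ∀ t : ℝ, mellin (fun u : ℝ => ((max (1 - u) 0 : ℝ) : ℂ)) ((σ : ℂ) + t * I) =
      1 / (((σ : ℂ) + t * I) * ((σ : ℂ) + t * I + 1)) := fun t =>
    (hasMellin_one_sub_indicator (by rw [hre]; linarith)).2
  have h := mellinInv_mellin_eq σ (fun u : ℝ => ((max (1 - u) 0 : ℝ) : ℂ)) (x := y / x)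
    (by positivity) (hasMellin_one_sub_indicator (by simp; linarith)).1
    (by
      rw [VerticalIntegrable]
      simp only [hmel]
      exact integrable_inv_mul_add_one hσ) (by fun_prop)
  rw [mellinInv] at h
  simp only [hmel] at h
  have hx0 : (x : ℂ) ≠ 0 := by exact_mod_cast hx.ne'
  have hint : ∀ t : ℝ, (x : ℂ) ^ ((σ : ℂ) + t * I + 1) * (y : ℂ) ^ (-((σ : ℂ) + t * I)) *
      (1 / (((σ : ℂ) + t * I) * ((σ : ℂ) + t * I + 1))) =
      x * (((y / x : ℝ) : ℂ) ^ (-((σ : ℂ) + t * I)) •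
        (1 / (((σ : ℂ) + t * I) * ((σ : ℂ) + t * I + 1)))) := fun t => by
    rw [div_eq_mul_inv y x, Complex.ofReal_mul, Complex.mul_cpow_ofReal_nonneg hy.le
      (by positivity), Complex.cpow_add _ _ hx0, Complex.cpow_one, Complex.ofReal_inv,
      Complex.inv_cpow _ _ (by rw [Complex.arg_ofReal_of_nonneg hx.le]; exact pi_pos.ne),
      Complex.cpow_neg (x : ℂ), inv_inv, smul_eq_mul]
    ring
  simp only [hint]
  rw [integral_const_mul]
  have h' := congrArg (fun z : ℂ => 2 * π * x * z) h
  simp only [Complex.real_smul] at h'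
  have hmax : max (x - y) 0 = x * max (1 - y / x) 0 := by
    rw [mul_max_of_nonneg _ _ hx.le, mul_zero, mul_sub, mul_one, mul_div_cancel₀ y hx.ne']
  have hp : (π : ℂ) ≠ 0 := by exact_mod_cast pi_pos.ne'
  rw [hmax, Complex.ofReal_mul, ← mul_assoc, ← h']
  generalize ∫ t : ℝ, ((y / x : ℝ) : ℂ) ^ (-((σ : ℂ) + t * I)) •
    (1 / (((σ : ℂ) + t * I) * ((σ : ℂ) + t * I + 1))) = J
  push_cast
  field_simp

/-- Perron's formula for the weighted Riesz means of the family `y : α → ℝ`. -/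
theorem integral_perron {α : Type*} [MeasurableSpace α] {ν : Measure α} [SFinite ν]
    {w : α → ℂ} {y : α → ℝ} {σ x : ℝ} (hσ : 1 ≤ σ) (hx : 0 < x) (hy : Measurable y)
    (hwy : ∀ a, w a = 0 ∨ 0 < y a) (hw : AEStronglyMeasurable w ν)
    (hint : Integrable (fun a => ‖w a‖ * y a ^ (-σ)) ν) :
    Integrable (fun t : ℝ => (x : ℂ) ^ ((σ : ℂ) + t * I + 1) *
        (1 / (((σ : ℂ) + t * I) * ((σ : ℂ) + t * I + 1))) *
        ∫ a, w a * (y a : ℂ) ^ (-((σ : ℂ) + t * I)) ∂ν) ∧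
      ∫ t : ℝ, (x : ℂ) ^ ((σ : ℂ) + t * I + 1) *
        (1 / (((σ : ℂ) + t * I) * ((σ : ℂ) + t * I + 1))) *
        ∫ a, w a * (y a : ℂ) ^ (-((σ : ℂ) + t * I)) ∂ν =
      2 * π * ∫ a, w a * (max (x - y a) 0 : ℝ) ∂ν := by
  have hx0 : (x : ℂ) ≠ 0 := by exact_mod_cast hx.ne'
  set K : ℝ → ℂ := fun t => (x : ℂ) ^ ((σ : ℂ) + t * I + 1) *
        (1 / (((σ : ℂ) + t * I) * ((σ : ℂ) + t * I + 1))) with hK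
  have hcx : Continuous fun t : ℝ => (x : ℂ) ^ ((σ : ℂ) + t * I + 1) :=
    Continuous.const_cpow (by fun_prop) (Or.inl hx0)
  have hKc : Continuous K := hcx.mul (continuous_inv_mul_add_one (by linarith))
  have hKn : ∀ t, ‖K t‖ ≤ x ^ (σ + 1) * (1 + t ^ 2)⁻¹ := fun t => by
    rw [hK]
    simp only
    rw [norm_mul, Complex.norm_cpow_eq_rpow_re_of_pos hx]
    have : ((σ : ℂ) + t * I + 1).re = σ + 1 := by simp
    rw [this]
    exact mul_le_mul_of_nonneg_left (norm_inv_mul_add_one_le hσ t) (by positivity)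
  have hprod : Integrable (fun z : α × ℝ => w z.1 * (y z.1 : ℂ) ^ (-((σ : ℂ) + z.2 * I)) * K z.2)
      (ν.prod volume) := by
    have hmaj : Integrable (fun z : α × ℝ => (‖w z.1‖ * y z.1 ^ (-σ)) *
        (x ^ (σ + 1) * (1 + z.2 ^ 2)⁻¹)) (ν.prod volume) :=
      hint.mul_prod (integrable_inv_one_add_sq.const_mul _)
    refine hmaj.mono' ?_ (Filter.Eventually.of_forall fun z => ?_)
    · refine (hw.comp_fst.mul ?_).mul (hKc.measurable.comp measurable_snd).aestronglyMeasurable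
      refine Measurable.aestronglyMeasurable ?_
      exact Measurable.pow (Complex.measurable_ofReal.comp (hy.comp measurable_fst))
        (by fun_prop)
    · rw [norm_mul, norm_mul]
      rcases hwy z.1 with h | h
      · simp [h]
      · rw [Complex.norm_cpow_eq_rpow_re_of_pos h]
        have : (-((σ : ℂ) + z.2 * I)).re = -σ := by simp
        rw [this]
        exact mul_le_mul_of_nonneg_left (hKn _) (by positivity)
  have hinner : ∀ t : ℝ, K t * ∫ a, w a * (y a : ℂ) ^ (-((σ : ℂ) + t * I)) ∂ν =
      ∫ a, w a * (y a : ℂ) ^ (-((σ : ℂ) + t * I)) * K t ∂ν := fun t => by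
    rw [integral_mul_const, mul_comm]
  change Integrable (fun t => K t * _) ∧ ∫ t, K t * _ = _
  simp only [hinner]
  refine ⟨hprod.integral_prod_right, ?_⟩
  rw [← integral_integral_swap (f := fun a (t : ℝ) => w a * (y a : ℂ) ^ (-((σ : ℂ) + t * I)) * K t)
    hprod, ← integral_const_mul]
  congr 1
  ext a
  rcases hwy a with h | h
  · simp [h]
  · have := integral_perron_kernel hσ hx h
    calc ∫ t : ℝ, w a * (y a : ℂ) ^ (-((σ : ℂ) + t * I)) * K t =
        ∫ t : ℝ, w a * ((x : ℂ) ^ ((σ : ℂ) + t * I + 1) * (y a : ℂ) ^ (-((σ : ℂ) + t * I)) *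
      (1 / (((σ : ℂ) + t * I) * ((σ : ℂ) + t * I + 1)))) := by
          congr 1
          ext t
          rw [hK]
          ring
      _ = _ := by
          rw [integral_const_mul, this]
          ring

end Perron

section PartialFractions

open Polynomial in
lemma exists_bezout_pow {p q : ℂ} (hpq : p ≠ q) (m n : ℕ) :
    ∃ u v : ℂ[X], ∀ s, u.eval s * (s - p) ^ m + v.eval s * (s - q) ^ n = 1 := by
  obtain ⟨u, v, h⟩ := (isCoprime_X_sub_C_of_isUnit_sub
    (sub_ne_zero.2 hpq).isUnit).pow (m := m) (n := n)
  refine ⟨u, v, fun s => ?_⟩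
  have := congrArg (Polynomial.eval s) h
  simpa using this

lemma exists_principalPart {g : ℂ → ℂ} (hg : Differentiable ℂ g) (p : ℂ) (m : ℕ) :
    ∃ c : ℕ → ℂ, ∃ h : ℂ → ℂ, Differentiable ℂ h ∧ ∀ s, s ≠ p →
      g s / (s - p) ^ m = ∑ j ∈ Finset.range m, c j / (s - p) ^ (j + 1) + h s := by
  induction m with
  | zero => exact ⟨0, g, hg, fun s _ => by simp⟩
  | succ m ih =>
    obtain ⟨c, h, hh, hc⟩ := ih
    refine ⟨fun j => if j = 0 then h p else c (j - 1), dslope h p, ?_, fun s hs => ?_⟩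
    · exact differentiableOn_univ.1
        ((Complex.differentiableOn_dslope Filter.univ_mem).2 hh.differentiableOn)
    · have hsp : s - p ≠ 0 := sub_ne_zero.2 hs
      rw [pow_succ, ← div_div, hc s hs, Finset.sum_range_succ', dslope_of_ne _ hs,
        slope_def_field, add_div, Finset.sum_div]
      simp only [Nat.add_eq_zero_iff, one_ne_zero, and_false, if_false, add_tsub_cancel_right,
        if_true, zero_add, pow_one, div_div, ← pow_succ]
      ring

lemma exists_partialFractions {g : ℂ → ℂ} (hg : Differentiable ℂ g) {p q : ℂ} (hpq : p ≠ q)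
    (m n : ℕ) :
    ∃ c d : ℕ → ℂ, ∃ h : ℂ → ℂ, Differentiable ℂ h ∧ ∀ s, s ≠ p → s ≠ q →
      g s / ((s - p) ^ m * (s - q) ^ n) =
        ∑ j ∈ Finset.range m, c j / (s - p) ^ (j + 1) +
        ∑ j ∈ Finset.range n, d j / (s - q) ^ (j + 1) + h s := by
  obtain ⟨u, v, huv⟩ := exists_bezout_pow hpq m n
  obtain ⟨c, h₁, hh₁, hc⟩ := exists_principalPart (hg.mul v.differentiable) p m
  obtain ⟨d, h₂, hh₂, hd⟩ := exists_principalPart (hg.mul u.differentiable) q n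
  refine ⟨c, d, fun s => h₁ s + h₂ s, hh₁.add hh₂, fun s hsp hsq => ?_⟩
  have hp : (s - p) ^ m ≠ 0 := pow_ne_zero _ (sub_ne_zero.2 hsp)
  have hq : (s - q) ^ n ≠ 0 := pow_ne_zero _ (sub_ne_zero.2 hsq)
  have e1 := hc s hsp
  have e2 := hd s hsq
  have e : g s / ((s - p) ^ m * (s - q) ^ n) =
      g s * v.eval s / (s - p) ^ m + g s * u.eval s / (s - q) ^ n := by
    rw [div_add_div _ _ hp hq, div_left_inj' (mul_ne_zero hp hq)]
    linear_combination (-g s) * huv s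
  simp only [Pi.mul_apply] at e1 e2
  rw [e, e1, e2]
  ring

/-- The sum of the principal parts attached to a pole at `p`. -/
noncomputable def principalPart (c : ℕ → ℂ) (p : ℂ) (m : ℕ) (s : ℂ) : ℂ :=
  ∑ j ∈ Finset.range m, c j / (s - p) ^ (j + 1)

lemma exists_zetaProduct_eq (ℓ : ℕ) {a : ℝ} (ha : 0 < a) :
    ∃ c d : ℕ → ℂ, ∃ h : ℂ → ℂ, Differentiable ℂ h ∧ ∀ s : ℂ, s ≠ 1 → s ≠ ((1 - a : ℝ) : ℂ) →
      zetaProduct ℓ a s =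
        principalPart c 1 4 s + principalPart d ((1 - a : ℝ) : ℂ) ℓ s + h s := by
  have hne : (1 : ℂ) ≠ ((1 - a : ℝ) : ℂ) := fun h => by
    have := congrArg Complex.re h
    simp at this
    linarith
  have hg : Differentiable ℂ fun s : ℂ => riemannZeta₁ s ^ 4 * riemannZeta₁ (s + a) ^ ℓ :=
    (differentiable_riemannZeta₁.pow 4).mul
      ((differentiable_riemannZeta₁.comp (differentiable_id.add_const _)).pow ℓ)
  obtain ⟨c, d, h, hh, heq⟩ := exists_partialFractions hg hne 4 ℓ
  refine ⟨c, d, h, hh, fun s h1 h2 => ?_⟩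
  have h3 : s + a ≠ 1 := fun h => h2 (by
    push_cast
    linear_combination h)
  have h4 : s + a - 1 = s - ((1 - a : ℝ) : ℂ) := by
    push_cast
    ring
  rw [principalPart, principalPart, ← heq s h1 h2, zetaProduct, riemannZeta_eq_inv_sub_mul h1,
    riemannZeta_eq_inv_sub_mul h3, h4]
  have hp : s - 1 ≠ 0 := sub_ne_zero.2 h1
  have hq : s - ((1 - a : ℝ) : ℂ) ≠ 0 := sub_ne_zero.2 h2
  rw [mul_pow, mul_pow, inv_pow, inv_pow]
  field_simp

lemma norm_principalPart_le (c : ℕ → ℂ) (p : ℝ) (m : ℕ) {s : ℂ} (hs : 1 ≤ |s.im|) :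
    ‖principalPart c p m s‖ ≤ ∑ j ∈ Finset.range m, ‖c j‖ := by
  refine norm_sum_le_of_le _ fun j _ => ?_
  rw [norm_div, norm_pow]
  refine div_le_self (norm_nonneg _) (one_le_pow₀ (hs.trans ?_))
  have := Complex.abs_im_le_norm (s - p)
  simpa using this

lemma continuous_principalPart_vertical (c : ℕ → ℂ) {p σ : ℝ} (hp : p ≠ σ) (m : ℕ) :
    Continuous fun t : ℝ => principalPart c p m ((σ : ℂ) + t * Complex.I) := by
  refine continuous_finsetSum _ fun j _ => continuous_const.div (by fun_prop) fun t => ?_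
  refine pow_ne_zero _ fun h => hp ?_
  have := congrArg Complex.re h
  simp at this
  linarith

end PartialFractions

section LaplaceTransform

open MeasureTheory

lemma integrableOn_pow_mul_exp_neg_mul (j : ℕ) {b : ℝ} (hb : 0 < b) :
    IntegrableOn (fun u : ℝ => u ^ j * Real.exp (-b * u)) (Set.Ioi 0) := by
  have := integrableOn_rpow_mul_exp_neg_mul_rpow (p := 1) (s := j) (b := b)
    (by linarith [Nat.cast_nonneg (α := ℝ) j]) one_pos hb
  simpa using this

lemma tendsto_pow_mul_exp_neg_mul (j : ℕ) {b : ℝ} (hb : 0 < b) :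
    Filter.Tendsto (fun u : ℝ => u ^ j * Real.exp (-b * u)) Filter.atTop (nhds 0) := by
  have := tendsto_rpow_mul_exp_neg_mul_atTop_nhds_zero (j : ℝ) b hb
  simpa using this

/-- The density whose Laplace transform is `principalPart c p m`. -/
noncomputable def poleDensity (c : ℕ → ℂ) (p : ℝ) (m : ℕ) (u : ℝ) : ℂ :=
  ∑ j ∈ Finset.range m, c j * (u ^ j / j.factorial * Complex.exp (p * u))

lemma continuous_poleDensity (c : ℕ → ℂ) (p : ℝ) (m : ℕ) : Continuous (poleDensity c p m) := by
  unfold poleDensity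
  fun_prop

lemma norm_pow_mul_cexp (z : ℂ) (j : ℕ) {u : ℝ} (hu : 0 ≤ u) :
    ‖(u : ℂ) ^ j / j.factorial * Complex.exp (-z * u)‖ =
      (u ^ j * Real.exp (-z.re * u)) / j.factorial := by
  rw [norm_mul, norm_div, Complex.norm_exp, norm_pow, Complex.norm_of_nonneg hu]
  simp
  ring

lemma integrableOn_pow_mul_cexp {z : ℂ} (hz : 0 < z.re) (j : ℕ) :
    IntegrableOn (fun u : ℝ => (u : ℂ) ^ j / j.factorial * Complex.exp (-z * u))
      (Set.Ioi 0) := by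
  refine ((integrableOn_pow_mul_exp_neg_mul j hz).div_const (j.factorial : ℝ)).mono'
    (by fun_prop) ?_
  filter_upwards [ae_restrict_mem measurableSet_Ioi] with u hu
  exact (norm_pow_mul_cexp z j (le_of_lt hu)).le

lemma integral_pow_mul_cexp {z : ℂ} (hz : 0 < z.re) (j : ℕ) :
    ∫ u : ℝ in Set.Ioi 0, (u : ℂ) ^ j / j.factorial * Complex.exp (-z * u) = 1 / z ^ (j + 1) := by
  have hz0 : z ≠ 0 := fun h => by simp [h] at hz
  induction j with
  | zero =>
    have := integral_exp_mul_complex_Ioi (a := -z) (by simpa using hz) 0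
    simpa [hz0, neg_div, div_neg] using this
  | succ j ih =>
    have hd : ∀ u : ℝ, HasDerivAt (fun u : ℝ => (u : ℂ) ^ (j + 1) / (j + 1).factorial *
        Complex.exp (-z * u)) ((u : ℂ) ^ j / j.factorial * Complex.exp (-z * u) -
        z * ((u : ℂ) ^ (j + 1) / (j + 1).factorial * Complex.exp (-z * u))) u := fun u => by
      have h0 : HasDerivAt (fun u : ℝ => (u : ℂ)) 1 u := Complex.ofRealCLM.hasDerivAt
      have h1 := (h0.fun_pow (j + 1)).div_const ((j + 1).factorial : ℂ)
      have h2 := (h0.const_mul (-z)).cexp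
      refine (h1.mul h2).congr_deriv ?_
      have hf : (j.factorial : ℂ) ≠ 0 := by exact_mod_cast j.factorial_ne_zero
      have hj : ((j : ℂ) + 1) ≠ 0 := by exact_mod_cast j.succ_ne_zero
      rw [Nat.factorial_succ]
      push_cast
      field_simp
      ring
    have hi := (integrableOn_pow_mul_cexp hz j).sub
      ((integrableOn_pow_mul_cexp hz (j + 1)).const_mul z)
    have hlim : Filter.Tendsto (fun u : ℝ => (u : ℂ) ^ (j + 1) / (j + 1).factorial *
        Complex.exp (-z * u)) Filter.atTop (nhds 0) := by
      rw [tendsto_zero_iff_norm_tendsto_zero]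
      have := (tendsto_pow_mul_exp_neg_mul (j + 1) hz).div_const ((j + 1).factorial : ℝ)
      rw [zero_div] at this
      refine this.congr' ?_
      filter_upwards [Filter.eventually_ge_atTop 0] with u hu
      rw [norm_pow_mul_cexp z (j + 1) hu]
    have h := integral_Ioi_of_hasDerivAt_of_tendsto (hd 0).continuousAt.continuousWithinAt
      (fun u _ => hd u) hi hlim
    rw [integral_sub (integrableOn_pow_mul_cexp hz j)
      ((integrableOn_pow_mul_cexp hz (j + 1)).const_mul z), integral_const_mul, ih] at h
    simp only [Complex.ofReal_zero, ne_eq, Nat.add_eq_zero_iff, one_ne_zero, and_false,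
      not_false_eq_true, zero_pow, zero_div, zero_mul, sub_zero] at h
    rw [pow_succ z (j + 1), ← div_div, eq_div_iff hz0]
    linear_combination -h

lemma poleDensity_mul_cpow (c : ℕ → ℂ) (p : ℝ) (m : ℕ) (s : ℂ) (u : ℝ) :
    poleDensity c p m u * ((Real.exp u : ℝ) : ℂ) ^ (-s) = ∑ j ∈ Finset.range m,
      c j * ((u : ℂ) ^ j / j.factorial * Complex.exp (-(s - p) * u)) := by
  rw [poleDensity, Finset.sum_mul]
  refine Finset.sum_congr rfl fun j _ => ?_
  have : ((Real.exp u : ℝ) : ℂ) ^ (-s) = Complex.exp (-s * u) := by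
    rw [Complex.cpow_def_of_ne_zero (by exact_mod_cast (Real.exp_pos u).ne'),
      ← Complex.ofReal_log (Real.exp_pos u).le, Real.log_exp, mul_comm]
  rw [this, mul_assoc, mul_assoc, ← Complex.exp_add]
  ring_nf

lemma integrableOn_poleDensity (c : ℕ → ℂ) (p : ℝ) (m : ℕ) {s : ℂ} (hs : p < s.re) :
    IntegrableOn (fun u => poleDensity c p m u * ((Real.exp u : ℝ) : ℂ) ^ (-s)) (Set.Ioi 0) := by
  simp only [poleDensity_mul_cpow]
  exact integrable_finsetSum _ fun j _ =>
    (integrableOn_pow_mul_cexp (by simpa using hs) j).const_mul _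

lemma integral_poleDensity (c : ℕ → ℂ) (p : ℝ) (m : ℕ) {s : ℂ} (hs : p < s.re) :
    ∫ u : ℝ in Set.Ioi 0, poleDensity c p m u * ((Real.exp u : ℝ) : ℂ) ^ (-s) =
      principalPart c p m s := by
  simp only [poleDensity_mul_cpow]
  have hz : 0 < (s - p).re := by simpa using hs
  rw [integral_finsetSum _ fun j _ => (integrableOn_pow_mul_cexp hz j).const_mul _, principalPart]
  refine Finset.sum_congr rfl fun j _ => ?_
  rw [integral_const_mul, integral_pow_mul_cexp hz, mul_one_div]

end LaplaceTransform

section MainTerm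

open MeasureTheory

lemma integral_pow_mul_cexp_interval {p : ℝ} (hp : p ≠ 0) (j : ℕ) :
    ∃ q : ℕ → ℂ, ∃ r : ℂ, ∀ L : ℝ,
      ∫ u in (0 : ℝ)..L, (u : ℂ) ^ j / j.factorial * Complex.exp (p * u) =
        Complex.exp (p * L) * ∑ k ∈ Finset.range (j + 1), q k * (L : ℂ) ^ k + r := by
  have hp0 : (p : ℂ) ≠ 0 := by exact_mod_cast hp
  have hint : ∀ (j : ℕ) (L : ℝ), IntervalIntegrable (fun u : ℝ => (u : ℂ) ^ j / j.factorial *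
      Complex.exp (p * u)) volume 0 L := fun j L =>
    Continuous.intervalIntegrable (by fun_prop) _ _
  induction j with
  | zero =>
    refine ⟨fun _ => 1 / p, -(1 / p), fun L => ?_⟩
    have := integral_exp_mul_complex (a := 0) (b := L) hp0
    simp [this]
    field_simp
    ring
  | succ j ih =>
    obtain ⟨q, r, hq⟩ := ih
    refine ⟨fun k => if k = j + 1 then 1 / (p * (j + 1).factorial) else -q k / p, -r / p,
      fun L => ?_⟩
    have hd : ∀ u : ℝ, HasDerivAt (fun u : ℝ => (u : ℂ) ^ (j + 1) / (j + 1).factorial *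
        Complex.exp (p * u)) ((u : ℂ) ^ j / j.factorial * Complex.exp (p * u) +
        p * ((u : ℂ) ^ (j + 1) / (j + 1).factorial * Complex.exp (p * u))) u := fun u => by
      have h0 : HasDerivAt (fun u : ℝ => (u : ℂ)) 1 u := Complex.ofRealCLM.hasDerivAt
      have h1 := (h0.fun_pow (j + 1)).div_const ((j + 1).factorial : ℂ)
      have h2 := (h0.const_mul (p : ℂ)).cexp
      refine (h1.mul h2).congr_deriv ?_
      have hf : (j.factorial : ℂ) ≠ 0 := by exact_mod_cast j.factorial_ne_zero
      have hj : ((j : ℂ) + 1) ≠ 0 := by exact_mod_cast j.succ_ne_zero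
      rw [Nat.factorial_succ]
      push_cast
      field_simp
    have h := intervalIntegral.integral_eq_sub_of_hasDerivAt (a := 0) (b := L)
      (fun u _ => hd u) ((hint j L).add ((hint (j + 1) L).const_mul _))
    rw [intervalIntegral.integral_add (hint j L) ((hint (j + 1) L).const_mul _),
      intervalIntegral.integral_const_mul, hq] at h
    simp only [Complex.ofReal_zero, ne_eq, Nat.add_eq_zero_iff, one_ne_zero, and_false,
      not_false_eq_true, zero_pow, zero_div, zero_mul, sub_zero] at h
    have hsum : ∑ k ∈ Finset.range (j + 1),
        (if k = j + 1 then 1 / (p * ((j + 1).factorial : ℂ)) else -q k / p) * (L : ℂ) ^ k =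
        -(∑ k ∈ Finset.range (j + 1), q k * (L : ℂ) ^ k) / p := by
      rw [← Finset.sum_neg_distrib, Finset.sum_div]
      refine Finset.sum_congr rfl fun k hk => ?_
      rw [if_neg (Finset.mem_range.1 hk).ne]
      ring
    rw [Finset.sum_range_succ, hsum]
    simp only [if_true]
    have hf : ((j + 1).factorial : ℂ) ≠ 0 := by exact_mod_cast (j + 1).factorial_ne_zero
    generalize ∫ u in (0 : ℝ)..L, (u : ℂ) ^ (j + 1) / (j + 1).factorial * Complex.exp (p * u) = J
      at h ⊢
    apply mul_left_cancel₀ hp0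
    rw [show (p : ℂ) * J = (L : ℂ) ^ (j + 1) / (j + 1).factorial * Complex.exp (p * L) -
      (Complex.exp (p * L) * ∑ k ∈ Finset.range (j + 1), q k * (L : ℂ) ^ k + r) by
        linear_combination h]
    field_simp
    ring

lemma exists_integral_poleDensity_eq (c : ℕ → ℂ) {p : ℝ} (hp : p ≠ 0) (m : ℕ) :
    ∃ q : ℕ → ℂ, ∃ r : ℂ, ∀ X : ℝ, 0 < X →
      ∫ u in (0 : ℝ)..Real.log X, poleDensity c p m u =
        ((X ^ p : ℝ) : ℂ) * ∑ k ∈ Finset.range m, q k * ((Real.log X : ℝ) : ℂ) ^ k + r := by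
  induction m with
  | zero => exact ⟨0, 0, fun X _ => by simp [poleDensity]⟩
  | succ m ih =>
    obtain ⟨q, r, hq⟩ := ih
    obtain ⟨q', r', hq'⟩ := integral_pow_mul_cexp_interval hp m
    refine ⟨fun k => (if k = m then 0 else q k) + c m * q' k, r + c m * r', fun X hX => ?_⟩
    have hsplit : ∀ u, poleDensity c p (m + 1) u = poleDensity c p m u +
        c m * ((u : ℂ) ^ m / m.factorial * Complex.exp (p * u)) := fun u =>
      Finset.sum_range_succ _ _
    have hexp : Complex.exp (p * (Real.log X : ℝ)) = ((X ^ p : ℝ) : ℂ) := by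
      rw [Real.rpow_def_of_pos hX]
      push_cast
      rw [mul_comm]
    have hsum : ∑ k ∈ Finset.range (m + 1), (if k = m then 0 else q k) *
        ((Real.log X : ℝ) : ℂ) ^ k =
        ∑ k ∈ Finset.range m, q k * ((Real.log X : ℝ) : ℂ) ^ k := by
      rw [Finset.sum_range_succ, if_pos rfl, zero_mul, add_zero]
      refine Finset.sum_congr rfl fun k hk => ?_
      rw [if_neg (Finset.mem_range.1 hk).ne]
    simp only [hsplit]
    rw [intervalIntegral.integral_add ((continuous_poleDensity c p m).intervalIntegrable _ _)
      (Continuous.intervalIntegrable (by fun_prop) _ _), intervalIntegral.integral_const_mul,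
      hq X hX, hq' (Real.log X), hexp]
    simp only [add_mul, Finset.sum_add_distrib, hsum, mul_assoc, ← Finset.mul_sum]
    ring

lemma norm_poleDensity_le (c : ℕ → ℂ) {p ε : ℝ} (hp : p ≤ 1) (hε : 0 < ε) (m : ℕ) :
    ∃ C : ℝ, 0 < C ∧ ∀ u : ℝ, 0 ≤ u → ‖poleDensity c p m u‖ ≤ C * Real.exp ((1 + ε) * u) := by
  refine ⟨∑ j ∈ Finset.range m, ‖c j‖ * (1 / ε ^ j) + 1, by positivity, fun u hu => ?_⟩
  have h : ‖poleDensity c p m u‖ ≤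
      ∑ j ∈ Finset.range m, ‖c j‖ * (1 / ε ^ j) * Real.exp ((1 + ε) * u) := by
    refine norm_sum_le_of_le _ fun j _ => ?_
    rw [norm_mul, mul_assoc]
    refine mul_le_mul_of_nonneg_left ?_ (norm_nonneg _)
    have h1 := norm_pow_mul_cexp (-(p : ℂ)) j hu
    rw [neg_neg] at h1
    rw [h1, Complex.neg_re, Complex.ofReal_re, neg_neg]
    have h2 := Real.pow_div_factorial_le_exp (ε * u) (by positivity) j
    calc u ^ j * Real.exp (p * u) / j.factorial =
        (1 / ε ^ j) * ((ε * u) ^ j / j.factorial) * Real.exp (p * u) := by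
          rw [mul_pow]
          field_simp
      _ ≤ (1 / ε ^ j) * Real.exp (ε * u) * Real.exp (1 * u) := by gcongr
      _ = _ := by
          rw [mul_assoc, ← Real.exp_add]
          ring_nf
  rw [← Finset.sum_mul] at h
  nlinarith [Real.exp_pos ((1 + ε) * u)]

end MainTerm

section WeightedMoment

open MeasureTheory

lemma integrable_mul_rpow_of_dyadic {f : ℝ → ℝ} (hf : Continuous f) (hf0 : ∀ t, 0 ≤ f t)
    (heven : ∀ t, f (-t) = f t) {C ε : ℝ} (hε : 0 < ε)
    (hC : ∀ T : ℝ, 2 ≤ T → ∫ t in T..2 * T, f t ≤ C * T ^ (1 + ε / 2)) :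
    Integrable fun t => f t * (1 + |t|) ^ (-(1 + ε)) := by
  set g : ℝ → ℝ := fun t => f t * (1 + |t|) ^ (-(1 + ε)) with hg
  have hgc : Continuous g := hf.mul (Continuous.rpow_const (by fun_prop) fun t =>
    Or.inl (by positivity))
  have hg0 : ∀ t, 0 ≤ g t := fun t => mul_nonneg (hf0 t) (by positivity)
  have hgi : ∀ x y, IntervalIntegrable g volume x y := fun x y => hgc.intervalIntegrable x y
  set ρ : ℝ := 2 ^ (-(ε / 2)) with hρ
  have hρ0 : 0 < ρ := by positivity
  have hρ1 : ρ < 1 := Real.rpow_lt_one_of_one_lt_of_neg one_lt_two (by linarith)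
  have hblock : ∀ k : ℕ, ∫ t in (2 : ℝ) ^ (k + 1)..2 ^ (k + 1 + 1), g t ≤ C * ρ ^ (k + 1) :=
    fun k => by
    set T : ℝ := 2 ^ (k + 1) with hT
    have hT0 : 0 < T := by positivity
    have hT2 : 2 ≤ T := by
      rw [hT, pow_succ]
      linarith [one_le_pow₀ (n := k) (one_le_two (α := ℝ))]
    rw [pow_succ, ← hT, mul_comm T 2]
    calc ∫ t in T..2 * T, g t ≤ ∫ t in T..2 * T, f t * T ^ (-(1 + ε)) := by
          refine intervalIntegral.integral_mono_on (by linarith) (hgi _ _)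
            ((hf.mul continuous_const).intervalIntegrable _ _) fun t ht => ?_
          refine mul_le_mul_of_nonneg_left ?_ (hf0 t)
          refine Real.rpow_le_rpow_of_nonpos hT0 ?_ (by linarith)
          linarith [le_abs_self t, ht.1]
      _ = (∫ t in T..2 * T, f t) * T ^ (-(1 + ε)) := intervalIntegral.integral_mul_const _ _
      _ ≤ C * T ^ (1 + ε / 2) * T ^ (-(1 + ε)) := by
          gcongr
          exact hC T hT2
      _ = C * ρ ^ (k + 1) := by
          rw [mul_assoc, ← Real.rpow_add hT0, hT, hρ, ← Real.rpow_natCast, ← Real.rpow_natCast,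
            ← Real.rpow_mul two_pos.le, ← Real.rpow_mul two_pos.le]
          ring_nf
  have hsum : ∀ n : ℕ, ∫ t in (2 : ℝ)..2 ^ (n + 1), g t ≤ |C| * (1 - ρ)⁻¹ := fun n => by
    have h1 := intervalIntegral.sum_integral_adjacent_intervals
      (a := fun k : ℕ => (2 : ℝ) ^ (k + 1))
      (n := n) (f := g) (μ := volume) fun k _ => hgi _ _
    simp only [zero_add, pow_one] at h1
    rw [← h1]
    calc ∑ k ∈ Finset.range n, ∫ t in (2 : ℝ) ^ (k + 1)..2 ^ (k + 1 + 1), g t ≤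
        ∑ k ∈ Finset.range n, |C| * ρ ^ k := by
          refine Finset.sum_le_sum fun k _ => (hblock k).trans ?_
          refine mul_le_mul (le_abs_self C) ?_ (by positivity) (abs_nonneg _)
          exact pow_le_pow_of_le_one hρ0.le hρ1.le k.le_succ
      _ = |C| * ∑ k ∈ Finset.range n, ρ ^ k := by rw [Finset.mul_sum]
      _ ≤ _ := by
          refine mul_le_mul_of_nonneg_left ?_ (abs_nonneg _)
          rw [← tsum_geometric_of_lt_one hρ0.le hρ1]
          exact (summable_geometric_of_lt_one hρ0.le hρ1).sum_le_tsum _ fun k _ => by positivity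
  have hlim : Filter.Tendsto (fun n : ℕ => (2 : ℝ) ^ (n + 1)) Filter.atTop Filter.atTop :=
    (tendsto_pow_atTop_atTop_of_one_lt one_lt_two).comp (Filter.tendsto_add_atTop_nat 1)
  refine integrable_of_intervalIntegral_norm_bounded
    (2 * ((∫ t in (0 : ℝ)..2, g t) + |C| * (1 - ρ)⁻¹)) (fun n => (hgi _ _).1)
    (Filter.tendsto_neg_atTop_atBot.comp hlim) hlim (Filter.Eventually.of_forall fun n => ?_)
  simp only [Real.norm_of_nonneg (hg0 _), Function.comp_apply]
  have h1 : ∫ t in -(2 : ℝ) ^ (n + 1)..0, g t = ∫ t in (0 : ℝ)..2 ^ (n + 1), g t := by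
    have h2 := intervalIntegral.integral_comp_neg (a := 0) (b := (2 : ℝ) ^ (n + 1)) g
    rw [neg_zero] at h2
    rw [← h2]
    refine intervalIntegral.integral_congr fun t _ => ?_
    simp only [hg, heven, abs_neg]
  rw [← intervalIntegral.integral_add_adjacent_intervals (hgi _ 0) (hgi 0 _), h1, ← two_mul,
    ← intervalIntegral.integral_add_adjacent_intervals (hgi _ 2) (hgi 2 _)]
  linarith [hsum n]

lemma norm_zetaProduct_conj (ℓ : ℕ) (a : ℝ) (s : ℂ) :
    ‖zetaProduct ℓ a ((starRingEnd ℂ) s)‖ = ‖zetaProduct ℓ a s‖ := by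
  have : (starRingEnd ℂ) s + a = (starRingEnd ℂ) (s + a) := by simp
  rw [zetaProduct, zetaProduct, this, riemannZeta_conj, riemannZeta_conj]
  simp

lemma norm_zetaProduct_vertical_neg (ℓ : ℕ) (a σ t : ℝ) :
    ‖zetaProduct ℓ a (σ + (-t : ℝ) * Complex.I)‖ = ‖zetaProduct ℓ a (σ + t * Complex.I)‖ := by
  rw [← norm_zetaProduct_conj]
  simp

lemma continuous_zetaProduct_vertical (ℓ : ℕ) {a σ : ℝ} (h1 : σ ≠ 1) (h2 : σ + a ≠ 1) :
    Continuous fun t : ℝ => zetaProduct ℓ a (σ + t * Complex.I) := by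
  unfold zetaProduct
  refine Continuous.mul (Continuous.pow ?_ 4) (Continuous.pow ?_ ℓ)
  · refine continuous_iff_continuousAt.2 fun t => ?_
    refine (differentiableAt_riemannZeta fun h => h1 ?_).continuousAt.comp
      (f := fun t : ℝ => (σ : ℂ) + t * Complex.I) (by fun_prop)
    simpa using congrArg Complex.re h
  · refine continuous_iff_continuousAt.2 fun t => ?_
    refine (differentiableAt_riemannZeta fun h => h2 ?_).continuousAt.comp
      (f := fun t : ℝ => (σ : ℂ) + t * Complex.I + a) (by fun_prop)
    simpa using congrArg Complex.re h

lemma integrable_norm_zetaProduct_mul_rpow {ℓ : ℕ} {a ε : ℝ} (hℓ : ℓ ≤ 4) (ha : 0.404392 ≤ a)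
    (ha' : a < 1 / 2) (hε : 0 < ε) :
    Integrable fun t : ℝ =>
      ‖zetaProduct ℓ a ((1 / 2 : ℝ) + t * Complex.I)‖ * (1 + |t|) ^ (-(1 + ε)) := by
  obtain ⟨C, -, hC⟩ := exists_integral_norm_zetaProduct_le hℓ ha ha'.le (half_pos hε)
  refine integrable_mul_rpow_of_dyadic
    (continuous_zetaProduct_vertical ℓ (by norm_num) (by linarith)).norm
    (fun t => norm_nonneg _) (fun t => norm_zetaProduct_vertical_neg ℓ a _ t) hε (C := C) ?_
  simpa using hC

lemma exists_norm_zetaProduct_le (ℓ : ℕ) {a : ℝ} (hℓ : ℓ ≤ 4) (ha : 0 ≤ a) (ha' : a ≤ 1) :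
    ∃ K : ℝ, 0 < K ∧ ∀ σ t : ℝ, 1 / 2 ≤ σ → σ ≤ 2 → 1 ≤ |t| →
      ‖zetaProduct ℓ a (σ + t * Complex.I)‖ ≤ K * |t| ^ (136 / 100 : ℝ) := by
  obtain ⟨K, hK, h⟩ := norm_riemannZeta_le_rpow
  have key : ∀ σ t : ℝ, 1 / 2 ≤ σ → σ ≤ 2 → 1 ≤ t →
      ‖zetaProduct ℓ a (σ + t * Complex.I)‖ ≤ K ^ 4 * (K + 1) ^ ℓ * t ^ (136 / 100 : ℝ) :=
    fun σ t h1 h2 ht => by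
    have ht0 : 0 < t := by linarith
    have e1 := h σ t h1 (by linarith) ht
    have e2 := h (σ + a) t (by linarith) (by linarith) ht
    have hcast : (σ : ℂ) + t * Complex.I + a = ((σ + a : ℝ) : ℂ) + t * Complex.I := by
      push_cast
      ring
    have hu : 1 ≤ t ^ (17 / 100 : ℝ) := Real.one_le_rpow ht (by norm_num)
    have hpow : (t ^ (17 / 100 : ℝ)) ^ 8 = t ^ (136 / 100 : ℝ) := by
      rw [← Real.rpow_natCast, ← Real.rpow_mul ht0.le]
      norm_num
    rw [zetaProduct, hcast, norm_mul, norm_pow, norm_pow]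
    calc ‖riemannZeta (σ + t * Complex.I)‖ ^ 4 *
          ‖riemannZeta (((σ + a : ℝ) : ℂ) + t * Complex.I)‖ ^ ℓ ≤
        (K * t ^ (17 / 100 : ℝ)) ^ 4 * ((K + 1) * t ^ (17 / 100 : ℝ)) ^ ℓ := by
          refine mul_le_mul (pow_le_pow_left₀ (norm_nonneg _) e1 4)
            (pow_le_pow_left₀ (norm_nonneg _) (e2.trans ?_) ℓ) (by positivity) (by positivity)
          nlinarith
      _ = K ^ 4 * (K + 1) ^ ℓ * ((t ^ (17 / 100 : ℝ)) ^ 4 * (t ^ (17 / 100 : ℝ)) ^ ℓ) := by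
          rw [mul_pow, mul_pow]
          ring
      _ ≤ K ^ 4 * (K + 1) ^ ℓ * ((t ^ (17 / 100 : ℝ)) ^ 4 * (t ^ (17 / 100 : ℝ)) ^ 4) := by
          gcongr
      _ = _ := by
          rw [← pow_add, hpow]
  refine ⟨K ^ 4 * (K + 1) ^ ℓ, by positivity, fun σ t h1 h2 ht => ?_⟩
  rcases le_total 0 t with h0 | h0
  · rw [abs_of_nonneg h0] at ht ⊢
    exact key σ t h1 h2 ht
  · rw [abs_of_nonpos h0] at ht ⊢
    rw [← norm_zetaProduct_vertical_neg]
    exact key σ (-t) h1 h2 ht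

end WeightedMoment

section ContourShift

open MeasureTheory Complex

/-- The integrand in Perron's formula for Riesz means of order one. -/
noncomputable def perronIntegrand (h : ℂ → ℂ) (x : ℝ) (s : ℂ) : ℂ :=
  (x : ℂ) ^ (s + 1) * (1 / (s * (s + 1))) * h s

lemma differentiableOn_perronIntegrand {h : ℂ → ℂ} (hh : Differentiable ℂ h) {x : ℝ} (hx : 0 < x)
    {S : Set ℂ} (hS : ∀ s ∈ S, 0 < s.re) : DifferentiableOn ℂ (perronIntegrand h x) S := by
  intro s hs
  have hs0 := hS s hs
  have h0 : s ≠ 0 := fun h => by simp [h] at hs0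
  have h1 : s + 1 ≠ 0 := fun h => by
    have := congrArg Complex.re h
    simp at this
    linarith
  refine DifferentiableAt.differentiableWithinAt (DifferentiableAt.mul (DifferentiableAt.mul ?_ ?_)
    (hh s))
  · exact (differentiableAt_id.add_const _).const_cpow (Or.inl (by exact_mod_cast hx.ne'))
  · exact (differentiableAt_const _).div (differentiableAt_id.mul (differentiableAt_id.add_const _))
      (mul_ne_zero h0 h1)

lemma one_add_abs_div_three_le_norm {σ : ℝ} (hσ : 1 / 2 ≤ σ) (t : ℝ) :
    (1 + |t|) / 3 ≤ ‖(σ : ℂ) + t * I‖ := by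
  refine abs_le_of_sq_le_sq' ?_ (norm_nonneg _) |>.2
  rw [← Complex.normSq_eq_norm_sq, Complex.normSq_apply]
  simp
  nlinarith [sq_abs t, sq_nonneg (|t| - 1 / 4), sq_nonneg (1 - |t|)]

lemma one_add_abs_div_three_le_norm_add_one {σ : ℝ} (hσ : 1 / 2 ≤ σ) (t : ℝ) :
    (1 + |t|) / 3 ≤ ‖(σ : ℂ) + t * I + 1‖ := by
  have := one_add_abs_div_three_le_norm (σ := σ + 1) (by linarith) t
  convert! this using 2
  push_cast
  ring

lemma norm_cpow_add_one_sub_le {x : ℝ} (hx : 0 < x) {z : ℂ} (hz : z.re = 3 / 2) {ε : ℝ}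
    (hε : 0 < ε) (hε' : ε ≤ 1) :
    ‖((x + 1 : ℝ) : ℂ) ^ z - (x : ℂ) ^ z‖ ≤ 2 * (x + 1) ^ (1 / 2 + ε) * ‖z‖ ^ (1 - ε) := by
  have hx1 : 0 < x + 1 := by linarith
  set m := ‖((x + 1 : ℝ) : ℂ) ^ z - (x : ℂ) ^ z‖ with hm
  have hm0 : 0 ≤ m := norm_nonneg _
  have hA : m ≤ 2 * (x + 1) ^ (3 / 2 : ℝ) := by
    refine (norm_sub_le _ _).trans ?_
    rw [Complex.norm_cpow_eq_rpow_re_of_pos hx1, Complex.norm_cpow_eq_rpow_re_of_pos hx, hz]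
    have : x ^ (3 / 2 : ℝ) ≤ (x + 1) ^ (3 / 2 : ℝ) :=
      Real.rpow_le_rpow hx.le (by linarith) (by norm_num)
    linarith
  have hB : m ≤ ‖z‖ * (x + 1) ^ (1 / 2 : ℝ) := by
    have hd : ∀ y ∈ Set.Icc x (x + 1), HasDerivWithinAt (fun y : ℝ => (y : ℂ) ^ z)
        (z * (y : ℂ) ^ (z - 1)) (Set.Icc x (x + 1)) y := fun y hy => by
      have hy0 : 0 < y := hx.trans_le hy.1
      have h1 := (hasDerivAt_id (y : ℂ)).cpow_const (c := z) (Or.inl (by simpa using hy0))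
      have := h1.comp_ofReal
      simp only [id, mul_one] at this
      exact this.hasDerivWithinAt
    have := (convex_Icc x (x + 1)).norm_image_sub_le_of_norm_hasDerivWithin_le
      (C := ‖z‖ * (x + 1) ^ (1 / 2 : ℝ)) hd (fun y hy => by
        have hy0 : 0 < y := hx.trans_le hy.1
        rw [norm_mul, Complex.norm_cpow_eq_rpow_re_of_pos hy0, Complex.sub_re, hz, Complex.one_re]
        refine mul_le_mul_of_nonneg_left ?_ (norm_nonneg _)
        norm_num
        exact Real.rpow_le_rpow hy0.le hy.2 (by norm_num))
      (Set.left_mem_Icc.2 (by linarith)) (Set.right_mem_Icc.2 (by linarith))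
    rwa [add_sub_cancel_left, norm_one, mul_one] at this
  have hsplit : m = m ^ ε * m ^ (1 - ε) := by
    rcases hm0.eq_or_lt with h | h
    · rw [← h, Real.zero_rpow hε.ne', zero_mul]
    · rw [← Real.rpow_add h, add_sub_cancel, Real.rpow_one]
  rw [hsplit]
  calc m ^ ε * m ^ (1 - ε) ≤
      (2 * (x + 1) ^ (3 / 2 : ℝ)) ^ ε * (‖z‖ * (x + 1) ^ (1 / 2 : ℝ)) ^ (1 - ε) :=
        mul_le_mul (Real.rpow_le_rpow hm0 hA hε.le) (Real.rpow_le_rpow hm0 hB (by linarith))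
          (by positivity) (by positivity)
    _ = 2 ^ ε * ((x + 1) ^ (3 / 2 * ε) * (x + 1) ^ (1 / 2 * (1 - ε))) * ‖z‖ ^ (1 - ε) := by
        rw [Real.mul_rpow (by norm_num) (by positivity), Real.mul_rpow (norm_nonneg _)
          (by positivity), ← Real.rpow_mul hx1.le, ← Real.rpow_mul hx1.le]
        ring
    _ ≤ 2 * ((x + 1) ^ (3 / 2 * ε) * (x + 1) ^ (1 / 2 * (1 - ε))) * ‖z‖ ^ (1 - ε) := by
        have : (2 : ℝ) ^ ε ≤ 2 := by
          simpa using Real.rpow_le_rpow_of_exponent_le (one_le_two (α := ℝ)) hε'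
        gcongr
    _ = _ := by
        rw [← Real.rpow_add hx1]
        ring_nf

lemma norm_inv_mul_add_one_critical_le {ε : ℝ} (hε : 0 < ε) (hε' : ε ≤ 1) {σ : ℝ}
    (hσ : 1 / 2 ≤ σ) (t : ℝ) :
    ‖(σ : ℂ) + t * I + 1‖ ^ (1 - ε) * ‖1 / (((σ : ℂ) + t * I) * ((σ : ℂ) + t * I + 1))‖ ≤
      9 * (1 + |t|) ^ (-(1 + ε)) := by
  have h1 := one_add_abs_div_three_le_norm hσ t
  have h2 := one_add_abs_div_three_le_norm_add_one hσ t
  set u := ‖(σ : ℂ) + t * I‖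
  set v := ‖(σ : ℂ) + t * I + 1‖
  have hN : 0 < (1 + |t|) / 3 := by positivity
  have hu : 0 < u := hN.trans_le h1
  have hv : 0 < v := hN.trans_le h2
  have e : v ^ (1 - ε) * ‖1 / (((σ : ℂ) + t * I) * ((σ : ℂ) + t * I + 1))‖ =
      u ^ (-1 : ℝ) * v ^ (-ε) := by
    rw [norm_div, norm_one, norm_mul, one_div, mul_inv, Real.rpow_neg_one,
      show 1 - ε = 1 + -ε by ring, Real.rpow_add hv, Real.rpow_one]
    change v * v ^ (-ε) * (u⁻¹ * v⁻¹) = _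
    field_simp
  rw [e]
  calc u ^ (-1 : ℝ) * v ^ (-ε) ≤ ((1 + |t|) / 3) ^ (-1 : ℝ) * ((1 + |t|) / 3) ^ (-ε) :=
        mul_le_mul (Real.rpow_le_rpow_of_nonpos hN h1 (by norm_num))
          (Real.rpow_le_rpow_of_nonpos hN h2 (by linarith)) (by positivity) (by positivity)
    _ = 3 ^ (1 + ε) * (1 + |t|) ^ (-(1 + ε)) := by
        rw [← Real.rpow_add hN, Real.div_rpow (by positivity) (by norm_num),
          show (-1 : ℝ) + -ε = -(1 + ε) by ring, Real.rpow_neg (by norm_num : (0 : ℝ) ≤ 3),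
          div_inv_eq_mul, mul_comm]
    _ ≤ _ := by
        have : (3 : ℝ) ^ (1 + ε) ≤ 9 := by
          refine (Real.rpow_le_rpow_of_exponent_le (y := 1 + ε) (z := 2) (by norm_num)
            (by linarith)).trans ?_
          norm_num
        gcongr

/-- The hypotheses needed to shift the contour in Perron's formula to the critical line. -/
structure CriticalGrowth (h : ℂ → ℂ) : Prop where
  differentiable : Differentiable ℂ h
  growth : ∃ K : ℝ, 0 < K ∧ ∀ σ t : ℝ, 1 / 2 ≤ σ → σ ≤ 2 → 1 ≤ |t| →
    ‖h (σ + t * I)‖ ≤ K * |t| ^ (136 / 100 : ℝ)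
  integrable : ∀ ε : ℝ, 0 < ε →
    Integrable fun t : ℝ => ‖h ((1 / 2 : ℝ) + t * I)‖ * (1 + |t|) ^ (-(1 + ε))

lemma CriticalGrowth.integrable_perronIntegrand {h : ℂ → ℂ} (hh : CriticalGrowth h) {x : ℝ}
    (hx : 0 < x) : Integrable fun t : ℝ => perronIntegrand h x ((1 / 2 : ℝ) + t * I) := by
  refine ((hh.integrable 1 one_pos).const_mul (x ^ (3 / 2 : ℝ) * 9)).mono' ?_
    (Filter.Eventually.of_forall fun t => ?_)
  · refine Continuous.aestronglyMeasurable ?_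
    have := (differentiableOn_perronIntegrand hh.differentiable hx (S := {s | 0 < s.re})
      fun s hs => hs).continuousOn
    refine this.comp_continuous (f := fun t : ℝ => ((1 / 2 : ℝ) : ℂ) + t * I) (by fun_prop)
      fun t => ?_
    simp
  · rw [perronIntegrand, norm_mul, norm_mul, Complex.norm_cpow_eq_rpow_re_of_pos hx]
    have hre : (((1 / 2 : ℝ) : ℂ) + t * I + 1).re = 3 / 2 := by
      simp
      norm_num
    have h1 := norm_inv_mul_add_one_critical_le one_pos le_rfl (σ := 1 / 2) le_rfl t
    rw [sub_self, Real.rpow_zero, one_mul] at h1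
    rw [hre]
    calc x ^ (3 / 2 : ℝ) * ‖1 / ((((1 / 2 : ℝ) : ℂ) + t * I) * (((1 / 2 : ℝ) : ℂ) + t * I + 1))‖ *
          ‖h (((1 / 2 : ℝ) : ℂ) + t * I)‖ ≤
        x ^ (3 / 2 : ℝ) * (9 * (1 + |t|) ^ (-(1 + 1) : ℝ)) *
          ‖h (((1 / 2 : ℝ) : ℂ) + t * I)‖ := by gcongr
      _ = _ := by ring

/-- Moving the line of integration in Perron's formula to the critical line. -/
theorem CriticalGrowth.integral_perronIntegrand_eq {h : ℂ → ℂ} (hh : CriticalGrowth h) {x : ℝ}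
    (hx : 1 ≤ x) (hi : Integrable fun t : ℝ => perronIntegrand h x ((2 : ℝ) + t * I)) :
    ∫ t : ℝ, perronIntegrand h x ((2 : ℝ) + t * I) =
      ∫ t : ℝ, perronIntegrand h x ((1 / 2 : ℝ) + t * I) := by
  have hx0 : 0 < x := by linarith
  obtain ⟨K, hK, hg⟩ := hh.growth
  have hi' := hh.integrable_perronIntegrand hx0
  have hshift := tendsto_integral_vertical_sub (f := perronIntegrand h x) (a := 1 / 2) (b := 2)
    (by norm_num) (differentiableOn_perronIntegrand hh.differentiable hx0 fun s hs =>
      lt_of_lt_of_le (by norm_num) hs.1) (fun ε hε => by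
    have hlim : Filter.Tendsto (fun v : ℝ => x ^ (3 : ℝ) * 9 * K * v ^ (-(64 / 100) : ℝ))
        Filter.atTop (nhds 0) := by
      simpa using (tendsto_rpow_neg_atTop (y := 64 / 100) (by norm_num)).const_mul
        (x ^ (3 : ℝ) * 9 * K)
    obtain ⟨R, hR⟩ := Filter.eventually_atTop.1 ((tendsto_order.1 hlim).2 ε hε)
    refine ⟨max R 1, fun v hv σ hσ => ?_⟩
    have hv1 : 1 ≤ |v| := (le_max_right _ _).trans hv
    have hv0 : 0 < |v| := by linarith
    refine le_trans ?_ (hR |v| ((le_max_left _ _).trans hv)).le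
    rw [perronIntegrand, norm_mul, norm_mul, Complex.norm_cpow_eq_rpow_re_of_pos hx0]
    have hre : ((σ : ℂ) + v * I + 1).re = σ + 1 := by simp
    have h1 := norm_inv_mul_add_one_critical_le one_pos le_rfl (σ := σ) hσ.1 v
    rw [sub_self, Real.rpow_zero, one_mul] at h1
    have h2 : (1 + |v|) ^ (-(1 + 1) : ℝ) ≤ |v| ^ (-(1 + 1) : ℝ) :=
      Real.rpow_le_rpow_of_nonpos hv0 (by linarith) (by norm_num)
    have h3 : x ^ (σ + 1) ≤ x ^ (3 : ℝ) :=
      Real.rpow_le_rpow_of_exponent_le hx (by linarith [hσ.2])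
    rw [hre]
    calc x ^ (σ + 1) * ‖1 / (((σ : ℂ) + v * I) * ((σ : ℂ) + v * I + 1))‖ *
          ‖h ((σ : ℂ) + v * I)‖ ≤
        x ^ (3 : ℝ) * (9 * |v| ^ (-(1 + 1) : ℝ)) * (K * |v| ^ (136 / 100 : ℝ)) := by
          refine mul_le_mul (mul_le_mul h3 (h1.trans ?_) (norm_nonneg _) (by positivity))
            (hg σ v hσ.1 hσ.2 hv1) (norm_nonneg _) (by positivity)
          gcongr
      _ = x ^ (3 : ℝ) * 9 * K * (|v| ^ (-(1 + 1) : ℝ) * |v| ^ (136 / 100 : ℝ)) := by ring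
      _ = _ := by
          rw [← Real.rpow_add hv0]
          norm_num)
  have hneg : Filter.Tendsto (fun R : ℝ => -R) Filter.atTop Filter.atBot :=
    Filter.tendsto_neg_atTop_atBot
  have hlim1 := intervalIntegral_tendsto_integral hi hneg Filter.tendsto_id
  have hlim2 := intervalIntegral_tendsto_integral hi' hneg Filter.tendsto_id
  have hlim := hlim1.sub hlim2
  refine sub_eq_zero.1 (tendsto_nhds_unique hlim (hshift.congr fun R => ?_))
  exact intervalIntegral.integral_sub hi.intervalIntegrable hi'.intervalIntegrable

theorem CriticalGrowth.exists_norm_integral_sub_le {h : ℂ → ℂ} (hh : CriticalGrowth h) {ε : ℝ}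
    (hε : 0 < ε) (hε' : ε ≤ 1) :
    ∃ C : ℝ, 0 < C ∧ ∀ x : ℝ, 1 ≤ x →
      ‖(∫ t : ℝ, perronIntegrand h (x + 1) ((1 / 2 : ℝ) + t * I)) -
        ∫ t : ℝ, perronIntegrand h x ((1 / 2 : ℝ) + t * I)‖ ≤ C * x ^ (1 / 2 + ε) := by
  set J := ∫ t : ℝ, ‖h ((1 / 2 : ℝ) + t * I)‖ * (1 + |t|) ^ (-(1 + ε)) with hJ
  have hJ0 : 0 ≤ J := integral_nonneg fun t => by positivity
  refine ⟨72 * J + 1, by positivity, fun x hx => ?_⟩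
  have hx0 : 0 < x := by linarith
  have hx1 : 0 < x + 1 := by linarith
  rw [← integral_sub (hh.integrable_perronIntegrand hx1) (hh.integrable_perronIntegrand hx0)]
  have hb : ∀ t : ℝ, ‖perronIntegrand h (x + 1) ((1 / 2 : ℝ) + t * I) -
      perronIntegrand h x ((1 / 2 : ℝ) + t * I)‖ ≤
      (18 * (x + 1) ^ (1 / 2 + ε)) * (‖h ((1 / 2 : ℝ) + t * I)‖ * (1 + |t|) ^ (-(1 + ε))) :=
    fun t => by
    set s : ℂ := ((1 / 2 : ℝ) : ℂ) + t * I with hs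
    have hre : (s + 1).re = 3 / 2 := by
      simp [hs]
      norm_num
    have e : perronIntegrand h (x + 1) s - perronIntegrand h x s =
        (((x + 1 : ℝ) : ℂ) ^ (s + 1) - (x : ℂ) ^ (s + 1)) * (1 / (s * (s + 1))) * h s := by
      rw [perronIntegrand, perronIntegrand]
      ring
    rw [e, norm_mul, norm_mul]
    have h1 := norm_cpow_add_one_sub_le hx0 hre hε hε'
    have h2 := norm_inv_mul_add_one_critical_le hε hε' (σ := 1 / 2) le_rfl t
    rw [← hs] at h2
    calc ‖((x + 1 : ℝ) : ℂ) ^ (s + 1) - (x : ℂ) ^ (s + 1)‖ * ‖1 / (s * (s + 1))‖ * ‖h s‖ ≤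
        (2 * (x + 1) ^ (1 / 2 + ε) * ‖s + 1‖ ^ (1 - ε)) * ‖1 / (s * (s + 1))‖ * ‖h s‖ := by gcongr
      _ = 2 * (x + 1) ^ (1 / 2 + ε) * (‖s + 1‖ ^ (1 - ε) * ‖1 / (s * (s + 1))‖) * ‖h s‖ := by
          ring
      _ ≤ 2 * (x + 1) ^ (1 / 2 + ε) * (9 * (1 + |t|) ^ (-(1 + ε))) * ‖h s‖ := by gcongr
      _ = _ := by ring
  have h4 : (x + 1) ^ (1 / 2 + ε) ≤ 4 * x ^ (1 / 2 + ε) := by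
    calc (x + 1) ^ (1 / 2 + ε) ≤ (2 * x) ^ (1 / 2 + ε) :=
          Real.rpow_le_rpow hx1.le (by linarith) (by positivity)
      _ = 2 ^ (1 / 2 + ε) * x ^ (1 / 2 + ε) := Real.mul_rpow (by norm_num) hx0.le
      _ ≤ 2 ^ (2 : ℝ) * x ^ (1 / 2 + ε) := by
          gcongr
          · norm_num
          · linarith
      _ = _ := by norm_num
  refine (norm_integral_le_of_norm_le ((hh.integrable ε hε).const_mul _)
    (Filter.Eventually.of_forall hb)).trans ?_
  rw [integral_const_mul, ← hJ]
  have : 0 < x ^ (1 / 2 + ε) := by positivity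
  nlinarith

end ContourShift

section RegularPart

open MeasureTheory

lemma exists_norm_principalPart_vertical_le (c : ℕ → ℂ) {p σ : ℝ} (hp : p ≠ σ) (m : ℕ) :
    ∃ C : ℝ, ∀ t : ℝ, ‖principalPart c p m ((σ : ℂ) + t * Complex.I)‖ ≤ C := by
  refine ⟨∑ j ∈ Finset.range m, ‖c j‖ / |σ - p| ^ (j + 1), fun t => ?_⟩
  refine norm_sum_le_of_le _ fun j _ => ?_
  rw [norm_div, norm_pow]
  have h : |σ - p| ≤ ‖(σ : ℂ) + t * Complex.I - p‖ := by
    simpa using Complex.abs_re_le_norm ((σ : ℂ) + t * Complex.I - p)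
  have h0 : 0 < |σ - p| := abs_pos.2 (sub_ne_zero.2 hp.symm)
  gcongr

lemma integrable_norm_principalPart_mul_rpow (c : ℕ → ℂ) {p σ ε : ℝ} (hp : p ≠ σ) (m : ℕ)
    (hε : 0 < ε) :
    Integrable fun t : ℝ =>
      ‖principalPart c p m ((σ : ℂ) + t * Complex.I)‖ * (1 + |t|) ^ (-(1 + ε)) := by
  obtain ⟨C, hC⟩ := exists_norm_principalPart_vertical_le c hp m
  have h1 : Integrable fun t : ℝ => (1 + |t|) ^ (-(1 + ε)) := by
    have := integrable_one_add_norm (E := ℝ) (μ := volume) (r := 1 + ε) (by simpa using hε)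
    simpa only [Real.norm_eq_abs] using this
  refine Integrable.bdd_mul (c := C) h1
    (continuous_principalPart_vertical c hp m).norm.aestronglyMeasurable
    (Filter.Eventually.of_forall fun t => ?_)
  simpa using hC t

lemma criticalGrowth_of_zetaProduct_eq {ℓ : ℕ} (hℓ : ℓ ≤ 4) {a : ℝ} (ha : 0.404392 ≤ a)
    (ha' : a < 1 / 2) {c d : ℕ → ℂ} {h : ℂ → ℂ} (hh : Differentiable ℂ h)
    (heq : ∀ s : ℂ, s ≠ 1 → s ≠ ((1 - a : ℝ) : ℂ) → zetaProduct ℓ a s =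
      principalPart c (1 : ℝ) 4 s + principalPart d ((1 - a : ℝ) : ℂ) ℓ s + h s) :
    CriticalGrowth h := by
  have ha0 : 0 ≤ a := le_trans (by norm_num) ha
  have hh' : ∀ s : ℂ, s ≠ 1 → s ≠ ((1 - a : ℝ) : ℂ) → ‖h s‖ ≤ ‖zetaProduct ℓ a s‖ +
      ‖principalPart c (1 : ℝ) 4 s‖ + ‖principalPart d ((1 - a : ℝ) : ℂ) ℓ s‖ := fun s h1 h2 => by
    have e : h s = zetaProduct ℓ a s - principalPart c (1 : ℝ) 4 s -
        principalPart d ((1 - a : ℝ) : ℂ) ℓ s := by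
      rw [heq s h1 h2]
      ring
    rw [e]
    exact (norm_sub_le _ _).trans (add_le_add_left (norm_sub_le _ _) _)
  refine ⟨hh, ?_, fun ε hε => ?_⟩
  · obtain ⟨K, hK, hb⟩ := exists_norm_zetaProduct_le ℓ hℓ ha0 (by linarith)
    refine ⟨K + ∑ j ∈ Finset.range 4, ‖c j‖ + ∑ j ∈ Finset.range ℓ, ‖d j‖, by positivity,
      fun σ t hσ hσ' ht => ?_⟩
    have him : ((σ : ℂ) + t * Complex.I).im = t := by simp
    have hne : ∀ p : ℝ, (σ : ℂ) + t * Complex.I ≠ p := fun p h => by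
      rw [h, Complex.ofReal_im] at him
      rw [← him, abs_zero] at ht
      linarith
    have h1 := norm_principalPart_le c 1 4 (s := (σ : ℂ) + t * Complex.I) (by rwa [him])
    have h2 := norm_principalPart_le d (1 - a) ℓ (s := (σ : ℂ) + t * Complex.I) (by rwa [him])
    have h3 := hb σ t hσ hσ' ht
    have h4 : (1 : ℝ) ≤ |t| ^ (136 / 100 : ℝ) := Real.one_le_rpow ht (by norm_num)
    refine (hh' _ (by simpa using hne 1) (hne _)).trans ?_
    have h5 : 0 ≤ ∑ j ∈ Finset.range 4, ‖c j‖ := by positivity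
    have h6 : 0 ≤ ∑ j ∈ Finset.range ℓ, ‖d j‖ := by positivity
    rw [add_mul, add_mul]
    exact add_le_add (add_le_add h3 (h1.trans (le_mul_of_one_le_right h5 h4)))
      (h2.trans (le_mul_of_one_le_right h6 h4))
  · have i1 := integrable_norm_zetaProduct_mul_rpow hℓ ha ha' hε
    have i2 := integrable_norm_principalPart_mul_rpow c (p := 1) (σ := 1 / 2) (by norm_num) 4 hε
    have i3 := integrable_norm_principalPart_mul_rpow d (p := 1 - a) (σ := 1 / 2)
      (by intro h; linarith) ℓ hε
    refine ((i1.add i2).add i3).mono' ?_ (Filter.Eventually.of_forall fun t => ?_)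
    · refine Continuous.aestronglyMeasurable (Continuous.mul ?_ ?_)
      · exact (hh.continuous.comp (by fun_prop)).norm
      · refine Continuous.rpow_const (by fun_prop) fun t => Or.inl ?_
        positivity
    · have hre : (((1 / 2 : ℝ) : ℂ) + t * Complex.I).re = 1 / 2 := by simp
      have hne : ∀ p : ℝ, p ≠ 1 / 2 → ((1 / 2 : ℝ) : ℂ) + t * Complex.I ≠ p := fun p hp h => by
        rw [h, Complex.ofReal_re] at hre
        exact hp hre
      have hb := hh' (((1 / 2 : ℝ) : ℂ) + t * Complex.I)
        (by simpa using hne 1 (by norm_num)) (hne _ (by intro h; linarith))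
      rw [Real.norm_of_nonneg (by positivity)]
      refine (mul_le_mul_of_nonneg_right hb (by positivity)).trans (le_of_eq ?_)
      simp only [Pi.add_apply]
      ring

end RegularPart

section PerronApplications

open MeasureTheory

lemma dWeighted_zero (ℓ : ℕ) (a : ℝ) : dWeighted ℓ a 0 = 0 := by
  simp [dWeighted]

lemma integral_perronIntegrand_zetaProduct (ℓ : ℕ) {a : ℝ} (ha : 0 ≤ a) {x : ℝ} (hx : 0 < x) :
    Integrable (fun t : ℝ => perronIntegrand (zetaProduct ℓ a) x ((2 : ℝ) + t * Complex.I)) ∧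
      ∫ t : ℝ, perronIntegrand (zetaProduct ℓ a) x ((2 : ℝ) + t * Complex.I) =
        2 * π * ∑' n : ℕ, (dWeighted ℓ a n : ℂ) * (max (x - n) 0 : ℝ) := by
  have h0 : (dWeighted ℓ a 0 : ℂ) = 0 := by simp [dWeighted_zero]
  have hs : ∀ {s : ℂ}, 1 < s.re → HasSum (fun n : ℕ => (dWeighted ℓ a n : ℂ) * (n : ℂ) ^ (-s))
      (zetaProduct ℓ a s) := fun hs => (LSeriesHasSum_dWeighted ℓ ha hs).hasSum_mul_cpow h0
  have hint : Integrable (fun n : ℕ => ‖(dWeighted ℓ a n : ℂ)‖ * ((n : ℕ) : ℝ) ^ (-(2 : ℝ)))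
      Measure.count := by
    refine integrable_count_iff.2 ?_
    refine ((hs (s := 2) (by simp)).summable.norm).congr fun n => ?_
    rcases eq_or_ne n 0 with rfl | hn
    · simp [h0]
    · rw [norm_mul, Complex.norm_natCast_cpow_of_pos (Nat.pos_of_ne_zero hn)]
      simp
  have hP := integral_perron (ν := Measure.count) (w := fun n : ℕ => (dWeighted ℓ a n : ℂ))
    (y := fun n : ℕ => (n : ℝ)) (σ := 2) (x := x) (by norm_num) hx
    (measurable_from_top) (fun n => by
      rcases eq_or_ne n 0 with rfl | hn
      · exact Or.inl h0
      · exact Or.inr (by positivity))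
    (measurable_from_top.aestronglyMeasurable) hint
  have e1 : ∀ t : ℝ, ∫ n : ℕ, (dWeighted ℓ a n : ℂ) * (((n : ℕ) : ℝ) : ℂ) ^
      (-(((2 : ℝ) : ℂ) + t * Complex.I)) ∂Measure.count =
        zetaProduct ℓ a (((2 : ℝ) : ℂ) + t * Complex.I) := fun t => by
    have h := hs (s := ((2 : ℝ) : ℂ) + t * Complex.I) (by simp)
    have hi : Integrable (fun n : ℕ => (dWeighted ℓ a n : ℂ) * (((n : ℕ) : ℝ) : ℂ) ^
        (-(((2 : ℝ) : ℂ) + t * Complex.I))) Measure.count := by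
      refine integrable_count_iff.2 ?_
      simpa using h.summable.norm
    rw [integral_countable hi]
    simpa using h.tsum_eq
  have e2 : ∫ n : ℕ, (dWeighted ℓ a n : ℂ) * (max (x - (n : ℝ)) 0 : ℝ) ∂Measure.count =
      ∑' n : ℕ, (dWeighted ℓ a n : ℂ) * (max (x - n) 0 : ℝ) := by
    have hi : Integrable (fun n : ℕ => (dWeighted ℓ a n : ℂ) * (max (x - (n : ℝ)) 0 : ℝ))
        Measure.count := by
      refine integrable_count_iff.2 (summable_of_ne_finset_zero
        (s := Finset.range (⌊x⌋₊ + 1)) fun n hn => ?_)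
      have : x < n := by
        rw [Finset.mem_range, not_lt] at hn
        exact (Nat.lt_floor_add_one x).trans_le (by exact_mod_cast hn)
      simp [max_eq_right (sub_nonpos.2 this.le)]
    rw [integral_countable hi]
    simp
  simp only [e1, e2] at hP
  exact hP

lemma integral_perronIntegrand_principalPart (c : ℕ → ℂ) {p : ℝ} (hp : p ≤ 1) (m : ℕ) {x : ℝ}
    (hx : 0 < x) :
    Integrable (fun t : ℝ => perronIntegrand (principalPart c p m) x ((2 : ℝ) + t * Complex.I)) ∧
      ∫ t : ℝ, perronIntegrand (principalPart c p m) x ((2 : ℝ) + t * Complex.I) =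
        2 * π * ∫ u : ℝ in Set.Ioi 0, poleDensity c p m u * (max (x - Real.exp u) 0 : ℝ) := by
  have hre : ∀ t : ℝ, p < (((2 : ℝ) : ℂ) + t * Complex.I).re := fun t => by
    simp
    linarith
  have hP := integral_perron (ν := volume.restrict (Set.Ioi 0)) (w := poleDensity c p m)
    (y := Real.exp) (σ := 2) (x := x) (by norm_num) hx Real.measurable_exp
    (fun u => Or.inr (Real.exp_pos u)) (continuous_poleDensity c p m).aestronglyMeasurable (by
      have := (integrableOn_poleDensity c p m (s := (2 : ℝ)) (by simp; linarith)).norm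
      refine this.congr (Filter.Eventually.of_forall fun u => ?_)
      simp only [norm_mul]
      rw [Complex.norm_cpow_eq_rpow_re_of_pos (Real.exp_pos u)]
      simp)
  simp only [fun t : ℝ => integral_poleDensity c p m (hre t)] at hP
  exact hP

end PerronApplications

section UnsmoothedSums

open MeasureTheory

lemma hinge_sub_of_le {x y : ℝ} (h : y ≤ x) : max (x + 1 - y) 0 - max (x - y) 0 = 1 := by
  rw [max_eq_left (by linarith), max_eq_left (by linarith)]
  ring

lemma abs_hinge_sub_le (x y : ℝ) : |max (x + 1 - y) 0 - max (x - y) 0| ≤ 1 := by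
  refine (abs_max_sub_max_le_abs _ _ _).trans ?_
  simp

lemma norm_tsum_hinge_sub_sum_le (f : ℕ → ℂ) (h0 : f 0 = 0) {x : ℝ} (hx : 0 ≤ x) :
    ‖(∑' n : ℕ, f n * (max (x + 1 - n) 0 : ℝ)) - (∑' n : ℕ, f n * (max (x - n) 0 : ℝ)) -
      ∑ n ∈ Finset.Icc 1 ⌊x⌋₊, f n‖ ≤ ‖f (⌊x⌋₊ + 1)‖ := by
  have hfin : ∀ z ≤ x + 1, ∑' n : ℕ, f n * (max (z - n) 0 : ℝ) =
      ∑ n ∈ Finset.Icc 1 (⌊x⌋₊ + 1), f n * (max (z - n) 0 : ℝ) := fun z hz => by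
    refine tsum_eq_sum fun n hn => ?_
    rcases eq_or_ne n 0 with rfl | hn0
    · simp [h0]
    · have h1 : ⌊x⌋₊ + 1 < n := by
        by_contra hcon
        exact hn (Finset.mem_Icc.2 ⟨by omega, by omega⟩)
      have h2 : ((⌊x⌋₊ : ℝ) + 1) + 1 ≤ n := by exact_mod_cast h1
      have h3 := Nat.lt_floor_add_one x
      simp [max_eq_right (show z - n ≤ 0 by linarith)]
  rw [hfin _ le_rfl, hfin _ (by linarith), ← Finset.sum_sub_distrib,
    Finset.sum_Icc_succ_top (by omega)]
  have hmain : ∑ n ∈ Finset.Icc 1 ⌊x⌋₊, (f n * (max (x + 1 - n) 0 : ℝ) -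
      f n * (max (x - n) 0 : ℝ)) = ∑ n ∈ Finset.Icc 1 ⌊x⌋₊, f n := by
    refine Finset.sum_congr rfl fun n hn => ?_
    have hnx : (n : ℝ) ≤ x := (Nat.le_floor_iff hx).1 (Finset.mem_Icc.1 hn).2
    rw [← mul_sub, ← Complex.ofReal_sub, hinge_sub_of_le hnx, Complex.ofReal_one, mul_one]
  rw [hmain, add_sub_cancel_left, ← mul_sub, ← Complex.ofReal_sub, norm_mul, Complex.norm_real,
    Real.norm_eq_abs]
  exact mul_le_of_le_one_right (norm_nonneg _) (abs_hinge_sub_le _ _)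

lemma setIntegral_hinge_eq (w : ℝ → ℂ) {x z : ℝ} (hx : 1 ≤ x) (hz : z ≤ x) :
    ∫ u : ℝ in Set.Ioi 0, w u * (max (z - Real.exp u) 0 : ℝ) =
      ∫ u in (0 : ℝ)..Real.log x, w u * (max (z - Real.exp u) 0 : ℝ) := by
  rw [intervalIntegral.integral_of_le (Real.log_nonneg hx)]
  refine setIntegral_eq_of_subset_of_forall_sdiff_eq_zero measurableSet_Ioi
    Set.Ioc_subset_Ioi_self fun u hu => ?_
  have hu1 : Real.log x < u := by
    by_contra hcon
    exact hu.2 ⟨hu.1, not_lt.1 hcon⟩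
  have hu2 : x < Real.exp u := (Real.log_lt_iff_lt_exp (by linarith)).1 hu1
  simp [max_eq_right (show z - Real.exp u ≤ 0 by linarith)]

lemma norm_setIntegral_hinge_sub_integral_le {w : ℝ → ℂ} (hw : Continuous w) {C ε : ℝ}
    (hC : 0 ≤ C) (hε : 0 < ε) (hwC : ∀ u, 0 ≤ u → ‖w u‖ ≤ C * Real.exp ((1 + ε) * u))
    {x : ℝ} (hx : 1 ≤ x) :
    ‖(∫ u : ℝ in Set.Ioi 0, w u * (max (x + 1 - Real.exp u) 0 : ℝ)) -
        (∫ u : ℝ in Set.Ioi 0, w u * (max (x - Real.exp u) 0 : ℝ)) -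
        ∫ u in (0 : ℝ)..Real.log x, w u‖ ≤ C * 2 ^ (1 + ε) * x ^ ε := by
  have hx0 : 0 < x := by linarith
  have hl : Real.log x ≤ Real.log (x + 1) := Real.log_le_log hx0 (by linarith)
  have hl0 : 0 ≤ Real.log x := Real.log_nonneg hx
  have hcont : ∀ z : ℝ, Continuous fun u : ℝ => w u * (max (z - Real.exp u) 0 : ℝ) := fun z =>
    hw.mul (Complex.continuous_ofReal.comp (by fun_prop))
  rw [setIntegral_hinge_eq w (x := x + 1) (by linarith) le_rfl,
    setIntegral_hinge_eq w (x := x + 1) (by linarith) (by linarith),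
    ← intervalIntegral.integral_sub ((hcont _).intervalIntegrable _ _)
      ((hcont _).intervalIntegrable _ _)]
  set K : ℝ → ℂ := fun u => w u * (max (x + 1 - Real.exp u) 0 : ℝ) -
    w u * (max (x - Real.exp u) 0 : ℝ) with hK
  have hKc : Continuous K := (hcont _).sub (hcont _)
  have hKe : ∀ u, K u =
      w u * ((max (x + 1 - Real.exp u) 0 - max (x - Real.exp u) 0 : ℝ) : ℂ) := fun u => by
    rw [hK, Complex.ofReal_sub, mul_sub]
  have hfst : ∫ u in (0 : ℝ)..Real.log x, K u = ∫ u in (0 : ℝ)..Real.log x, w u := by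
    refine intervalIntegral.integral_congr fun u hu => ?_
    rw [Set.uIcc_of_le hl0] at hu
    have hu1 : Real.exp u ≤ x := (Real.le_log_iff_exp_le hx0).1 hu.2
    rw [hKe, hinge_sub_of_le hu1, Complex.ofReal_one, mul_one]
  rw [← intervalIntegral.integral_add_adjacent_intervals (b := Real.log x)
    (hKc.intervalIntegrable _ _) (hKc.intervalIntegrable _ _), hfst, add_sub_cancel_left]
  have hbound : ∀ u ∈ Set.uIoc (Real.log x) (Real.log (x + 1)),
      ‖K u‖ ≤ C * (x + 1) ^ (1 + ε) := fun u hu => by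
    rw [Set.uIoc_of_le hl] at hu
    have hu1 : Real.exp ((1 + ε) * u) ≤ (x + 1) ^ (1 + ε) := by
      rw [Real.rpow_def_of_pos (by linarith), mul_comm (Real.log _)]
      exact Real.exp_le_exp.2 (mul_le_mul_of_nonneg_left hu.2 (by linarith))
    rw [hKe, norm_mul, Complex.norm_real, Real.norm_eq_abs]
    refine (mul_le_of_le_one_right (norm_nonneg _) (abs_hinge_sub_le _ _)).trans ?_
    exact (hwC u (hl0.trans hu.1.le)).trans (mul_le_mul_of_nonneg_left hu1 hC)
  refine (intervalIntegral.norm_integral_le_of_norm_le_const hbound).trans ?_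
  rw [abs_of_nonneg (sub_nonneg.2 hl), ← Real.log_div (by linarith) hx0.ne']
  have h1 : Real.log ((x + 1) / x) ≤ x⁻¹ := by
    have h := Real.log_le_sub_one_of_pos (x := (x + 1) / x) (by positivity)
    have e : (x + 1) / x - 1 = x⁻¹ := by
      field_simp
      ring
    rwa [e] at h
  have h2 : (x + 1) ^ (1 + ε) ≤ 2 ^ (1 + ε) * x ^ (1 + ε) := by
    rw [← Real.mul_rpow (by norm_num) hx0.le]
    exact Real.rpow_le_rpow (by linarith) (by linarith) (by linarith)
  calc C * (x + 1) ^ (1 + ε) * Real.log ((x + 1) / x)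
      ≤ C * (2 ^ (1 + ε) * x ^ (1 + ε)) * x⁻¹ :=
        mul_le_mul (mul_le_mul_of_nonneg_left h2 hC) h1
          (Real.log_nonneg (by rw [le_div_iff₀ hx0]; linarith)) (by positivity)
    _ = C * 2 ^ (1 + ε) * x ^ ε := by
        rw [Real.rpow_add hx0 1 ε, Real.rpow_one]
        field_simp

end UnsmoothedSums

section Conclusion

open MeasureTheory

/-- The summatory function is approximated by the integrals of the two pole densities. -/
theorem exists_norm_sum_dWeighted_sub_le {ℓ : ℕ} (hℓ : ℓ ≤ 4) {a : ℝ} (ha : 0.404392 ≤ a)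
    (ha' : a < 1 / 2) : ∃ c d : ℕ → ℂ, ∀ ε : ℝ, 0 < ε → ε ≤ 1 → ∃ C : ℝ, 0 < C ∧
      ∀ x : ℝ, 1 ≤ x → ‖((∑ n ∈ Finset.Icc 1 ⌊x⌋₊, dWeighted ℓ a n : ℝ) : ℂ) -
        (∫ u in (0 : ℝ)..Real.log x, poleDensity c 1 4 u) -
        ∫ u in (0 : ℝ)..Real.log x, poleDensity d (1 - a) ℓ u‖ ≤ C * x ^ (1 / 2 + ε) := by
  have ha0 : 0 < a := lt_of_lt_of_le (by norm_num) ha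
  obtain ⟨c, d, h, hh, heq⟩ := exists_zetaProduct_eq ℓ ha0
  replace heq : ∀ s : ℂ, s ≠ 1 → s ≠ ((1 - a : ℝ) : ℂ) → zetaProduct ℓ a s =
      principalPart c (1 : ℝ) 4 s + principalPart d ((1 - a : ℝ) : ℂ) ℓ s + h s := by
    simpa using heq
  have hcg := criticalGrowth_of_zetaProduct_eq hℓ ha ha' hh heq
  refine ⟨c, d, fun ε hε hε' => ?_⟩
  obtain ⟨C₀, hC₀, hb₀⟩ := hcg.exists_norm_integral_sub_le hε hε'
  obtain ⟨C₁, hC₁, hb₁⟩ := norm_poleDensity_le c le_rfl hε 4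
  obtain ⟨C₂, hC₂, hb₂⟩ := norm_poleDensity_le d (p := 1 - a) (by linarith) hε ℓ
  obtain ⟨C₃, hC₃, hb₃⟩ := dWeighted_le_rpow ℓ ha0.le hε
  set S : ℝ → ℂ := fun x => ∑' n : ℕ, (dWeighted ℓ a n : ℂ) * (max (x - n) 0 : ℝ)
  set M : ℝ → ℂ := fun x =>
    ∫ u : ℝ in Set.Ioi 0, poleDensity c 1 4 u * (max (x - Real.exp u) 0 : ℝ)
  set N : ℝ → ℂ := fun x =>
    ∫ u : ℝ in Set.Ioi 0, poleDensity d (1 - a) ℓ u * (max (x - Real.exp u) 0 : ℝ)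
  have hshift : ∀ x : ℝ, 1 ≤ x → ∫ t : ℝ, perronIntegrand h x ((1 / 2 : ℝ) + t * Complex.I) =
      2 * π * (S x - M x - N x) := fun x hx => by
    obtain ⟨i1, e1⟩ := integral_perronIntegrand_zetaProduct ℓ ha0.le (x := x) (by linarith)
    obtain ⟨i2, e2⟩ := integral_perronIntegrand_principalPart c le_rfl 4 (x := x) (by linarith)
    obtain ⟨i3, e3⟩ := integral_perronIntegrand_principalPart d (p := 1 - a) (by linarith) ℓ
      (x := x) (by linarith)
    have hfun : (fun t : ℝ => perronIntegrand h x ((2 : ℝ) + t * Complex.I)) = fun t : ℝ =>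
        perronIntegrand (zetaProduct ℓ a) x ((2 : ℝ) + t * Complex.I) -
        perronIntegrand (principalPart c (1 : ℝ) 4) x ((2 : ℝ) + t * Complex.I) -
        perronIntegrand (principalPart d ((1 - a : ℝ) : ℂ) ℓ) x ((2 : ℝ) + t * Complex.I) := by
      funext t
      have hre : (((2 : ℝ) : ℂ) + t * Complex.I).re = 2 := by simp
      have hne : ∀ p : ℝ, p < 2 → ((2 : ℝ) : ℂ) + t * Complex.I ≠ p := fun p hp h => by
        rw [h, Complex.ofReal_re] at hre
        linarith
      simp only [perronIntegrand]
      rw [heq _ (by simpa using hne 1 (by norm_num)) (hne _ (by linarith))]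
      ring
    have i12 : Integrable fun t : ℝ =>
        perronIntegrand (zetaProduct ℓ a) x ((2 : ℝ) + t * Complex.I) -
        perronIntegrand (principalPart c (1 : ℝ) 4) x ((2 : ℝ) + t * Complex.I) := i1.sub i2
    have hi : Integrable fun t : ℝ => perronIntegrand h x ((2 : ℝ) + t * Complex.I) := by
      rw [hfun]
      exact i12.sub i3
    rw [← hcg.integral_perronIntegrand_eq hx hi, hfun, integral_sub i12 i3, integral_sub i1 i2,
      e1, e2, e3]
    ring
  refine ⟨C₀ + C₃ * 2 ^ ε + C₁ * 2 ^ (1 + ε) + C₂ * 2 ^ (1 + ε), by positivity, fun x hx => ?_⟩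
  have hx0 : 0 < x := by linarith
  have hxε : x ^ ε ≤ x ^ (1 / 2 + ε) := Real.rpow_le_rpow_of_exponent_le hx (by linarith)
  have hsum := norm_tsum_hinge_sub_sum_le (fun n => (dWeighted ℓ a n : ℂ))
    (by simp [dWeighted_zero]) hx0.le
  have hM' := norm_setIntegral_hinge_sub_integral_le (continuous_poleDensity c 1 4) hC₁.le hε
    hb₁ hx
  have hN' := norm_setIntegral_hinge_sub_integral_le (continuous_poleDensity d (1 - a) ℓ) hC₂.le
    hε hb₂ hx
  have hdiff := hb₀ x hx
  rw [hshift _ (by linarith), hshift _ hx, ← mul_sub, norm_mul] at hdiff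
  have hpi : (1 : ℝ) ≤ ‖(2 * π : ℂ)‖ := by
    rw [norm_mul, Complex.norm_real, Real.norm_of_nonneg Real.pi_pos.le]
    simp
    linarith [Real.pi_gt_three]
  replace hdiff := (le_mul_of_one_le_left (norm_nonneg _) hpi).trans hdiff
  have hlast : ‖(dWeighted ℓ a (⌊x⌋₊ + 1) : ℂ)‖ ≤ C₃ * 2 ^ ε * x ^ ε := by
    rw [Complex.norm_real, Real.norm_of_nonneg (dWeighted_nonneg _ _ _)]
    refine (hb₃ _ (by omega)).trans ?_
    rw [mul_assoc, ← Real.mul_rpow (by norm_num) hx0.le]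
    have := Nat.floor_le hx0.le
    gcongr
    push_cast
    linarith
  rw [Complex.ofReal_sum]
  change ‖S (x + 1) - S x - _‖ ≤ _ at hsum
  change ‖M (x + 1) - M x - _‖ ≤ _ at hM'
  change ‖N (x + 1) - N x - _‖ ≤ _ at hN'
  set s := ∑ n ∈ Finset.Icc 1 ⌊x⌋₊, (dWeighted ℓ a n : ℂ)
  set m := ∫ u in (0 : ℝ)..Real.log x, poleDensity c 1 4 u
  set n := ∫ u in (0 : ℝ)..Real.log x, poleDensity d (1 - a) ℓ u
  have hsplit : s - m - n = ((S (x + 1) - M (x + 1) - N (x + 1)) - (S x - M x - N x)) -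
      (S (x + 1) - S x - s) + (M (x + 1) - M x - m) + (N (x + 1) - N x - n) := by ring
  rw [hsplit]
  refine (norm_add_le_of_le (norm_add_le_of_le (norm_sub_le_of_le hdiff (hsum.trans hlast)) hM')
    hN').trans ?_
  rw [add_mul, add_mul, add_mul]
  gcongr

lemma re_mul_sum_eq (y L : ℝ) (q : ℕ → ℂ) (m : ℕ) :
    (((y : ℝ) : ℂ) * ∑ k ∈ Finset.range m, q k * ((L : ℝ) : ℂ) ^ k).re =
      y * ∑ k : Fin m, (q k).re * L ^ (k : ℕ) := by
  rw [Complex.re_ofReal_mul, Complex.re_sum, Finset.sum_range]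
  congr 1
  refine Finset.sum_congr rfl fun k _ => ?_
  rw [← Complex.ofReal_pow, Complex.re_mul_ofReal]

end Conclusion

/-- Corollary 2 of Ivić–Zhai, case `ℓ ∈ {3, 4}`: for fixed `a` in the stated range, the
error term `E_{4,ℓ}(X)` in the asymptotic formula for `∑_{n ≤ X} d_{4,ℓ}(n;a)` is
`≪_ε X^{1/2+ε}`. -/
theorem weighted_divisor_error_l3_l4 (ℓ : ℕ) (hℓ : ℓ = 3 ∨ ℓ = 4)
    (a : ℝ) (ha₁ : 0.404392 ≤ a) (ha₂ : a < 1 / 2) :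
    ∃ c : Fin 4 → ℝ, ∃ c' : Fin ℓ → ℝ, ∀ ε : ℝ, 0 < ε → ∃ C : ℝ, 0 < C ∧
      ∀ X : ℝ, 2 ≤ X →
        |(∑ n ∈ Finset.Icc 1 ⌊X⌋₊, dWeighted ℓ a n) -
            X * ∑ k : Fin 4, c k * Real.log X ^ (k : ℕ) -
            X ^ (1 - a) * ∑ k : Fin ℓ, c' k * Real.log X ^ (k : ℕ)| ≤
          C * X ^ (1 / 2 + ε) := by
  obtain ⟨c, d, hcd⟩ := exists_norm_sum_dWeighted_sub_le (ℓ := ℓ) (by omega) ha₁ ha₂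
  obtain ⟨q, r, hq⟩ := exists_integral_poleDensity_eq c one_ne_zero 4
  obtain ⟨q', r', hq'⟩ := exists_integral_poleDensity_eq d (p := 1 - a) (by linarith) ℓ
  refine ⟨fun k => (q k).re, fun k => (q' k).re, fun ε hε => ?_⟩
  obtain ⟨C, hC, hb⟩ := hcd (min ε 1) (by positivity) (min_le_right _ _)
  refine ⟨C + ‖r + r'‖, by positivity, fun X hX => ?_⟩
  have hX0 : 0 < X := by linarith
  have h := hb X (by linarith)
  rw [hq X hX0, hq' X hX0, Real.rpow_one] at h
  set s := ∑ n ∈ Finset.Icc 1 ⌊X⌋₊, dWeighted ℓ a n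
  set A := (X : ℂ) * ∑ k ∈ Finset.range 4, q k * ((Real.log X : ℝ) : ℂ) ^ k with hA
  set B := ((X ^ (1 - a) : ℝ) : ℂ) * ∑ k ∈ Finset.range ℓ, q' k * ((Real.log X : ℝ) : ℂ) ^ k
    with hB
  have hre : s - X * ∑ k : Fin 4, (q k).re * Real.log X ^ (k : ℕ) -
      X ^ (1 - a) * ∑ k : Fin ℓ, (q' k).re * Real.log X ^ (k : ℕ) = ((s : ℂ) - A - B).re := by
    rw [Complex.sub_re, Complex.sub_re, hA, hB, re_mul_sum_eq, re_mul_sum_eq, Complex.ofReal_re]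
  have hsplit : (s : ℂ) - A - B = ((s : ℂ) - (A + r) - (B + r')) + (r + r') := by ring
  have h1 : X ^ (1 / 2 + min ε 1) ≤ X ^ (1 / 2 + ε) :=
    Real.rpow_le_rpow_of_exponent_le (by linarith) (by linarith [min_le_left ε 1])
  have h2 : 1 ≤ X ^ (1 / 2 + ε) := Real.one_le_rpow (by linarith) (by linarith)
  rw [hre]
  refine (Complex.abs_re_le_norm _).trans ?_
  rw [hsplit, add_mul]
  exact norm_add_le_of_le (h.trans (mul_le_mul_of_nonneg_left h1 hC.le))
    (le_mul_of_one_le_right (norm_nonneg _) h2)
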